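/- Suppose the transmitters form a stationary planar Poisson process of intensity λ, so that the distance density is p(t) = 2πλt/λ·1{t ≥ 0}, i.e. take p(t) = 2π t·1{t ≥ 0} in the Laplace transform of I. Then for every x ∈ ℝ, |P((I − E[I])/√Var(I) ≤ x) − Φ(x)| ≤ c(x)/√λ, where c(x) = (1/√(2π)) · (m_{H³}/(m_{H²})^{3/2}) · (∫₀^∞ G³(t) t dt / (∫₀^∞ G²(t) t dt)^{3/2}) · min(0.4785, 31.935/(1+|x|³)). -/

import Mathlib

open MeasureTheory ProbabilityTheory Filter
open scoped Topology ENNReal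

namespace BerryEsseen
open Real

/-- The Fejér-type bump `(1 - cos v) / v ^ 2`, with its continuous value at `0`. -/
noncomputable def fejer (v : ℝ) : ℝ := sinc (v / 2) ^ 2 / 2

/-- The real part of Prawitz's kernel is `1 - t`; this is its imaginary part. -/
noncomputable def prawitzIm (t : ℝ) : ℝ := (1 - t) * (cos (π * t) / sin (π * t)) + 1 / π

/-- Prawitz's majorant of the indicator of the negative half-line. -/
noncomputable def majorant (u : ℝ) : ℝ :=
  1 / 2 + ∫ t in Set.Ioo (0 : ℝ) 1, ((1 - t) * cos (u * t) - prawitzIm t * sin (u * t))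

lemma fejer_nonneg (v : ℝ) : 0 ≤ fejer v := by unfold fejer; positivity

lemma fejer_zero : fejer 0 = 1 / 2 := by simp [fejer]

lemma fejer_neg (v : ℝ) : fejer (-v) = fejer v := by
  unfold fejer; rw [neg_div, sinc_neg]

lemma continuous_fejer : Continuous fejer := by
  unfold fejer
  have := continuous_sinc
  fun_prop

lemma fejer_of_ne_zero {v : ℝ} (hv : v ≠ 0) : fejer v = (1 - cos v) / v ^ 2 := by
  unfold fejer
  rw [sinc_of_ne_zero (by positivity)]
  have h : cos v = 1 - 2 * sin (v / 2) ^ 2 := by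
    have := cos_sq (v / 2)
    have h2 := sin_sq_add_cos_sq (v / 2)
    rw [mul_div_cancel₀ _ (two_ne_zero)] at this
    linarith
  rw [h]; field_simp; ring

lemma cos_add_two_pi_mul_nat (u : ℝ) (n : ℕ) : cos (u + 2 * π * n) = cos u := by
  rw [show u + 2 * π * n = u + n * (2 * π) by ring]; exact cos_add_nat_mul_two_pi u n

lemma integral_one_sub_mul_cos (v : ℝ) :
    ∫ t in Set.Ioo (0 : ℝ) 1, (1 - t) * cos (v * t) = fejer v := by
  rw [← integral_Ioc_eq_integral_Ioo, ← intervalIntegral.integral_of_le zero_le_one]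
  by_cases hv : v = 0
  · subst hv
    have : ∀ t ∈ Set.uIcc (0 : ℝ) 1, HasDerivAt (fun t : ℝ => t - t ^ 2 / 2) ((1 - t) * cos (0 * t)) t := by
      intro t _
      have := (hasDerivAt_id t).sub (((hasDerivAt_id t).pow 2).div_const 2)
      convert! this using 1
      simp
    rw [intervalIntegral.integral_eq_sub_of_hasDerivAt this
      (Continuous.intervalIntegrable (by fun_prop) _ _), fejer_zero]
    norm_num
  · have : ∀ t ∈ Set.uIcc (0 : ℝ) 1, HasDerivAt
        (fun t : ℝ => (1 - t) * sin (v * t) / v - cos (v * t) / v ^ 2) ((1 - t) * cos (v * t)) t := by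
      intro t _
      have h1 : HasDerivAt (fun t : ℝ => v * t) v t := by
        simpa using (hasDerivAt_id t).const_mul v
      have h2 := (((hasDerivAt_id t).const_sub 1).mul h1.sin).div_const v
      have h3 := h1.cos.div_const (v ^ 2)
      convert! h2.sub h3 using 1
      simp only [id]
      field_simp
      ring
    rw [intervalIntegral.integral_eq_sub_of_hasDerivAt this
      (Continuous.intervalIntegrable (by fun_prop) _ _), fejer_of_ne_zero hv]
    simp
    field_simp
    ring

lemma two_mul_le_sin_pi_mul {t : ℝ} (h0 : 0 < t) (h1 : t < 1) : 2 * (t * (1 - t)) ≤ sin (π * t) := by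
  have hpi := pi_pos
  rcases le_total t (1 / 2) with h | h
  · have := mul_le_sin (x := π * t) (by positivity) (by nlinarith)
    have h2 : 2 / π * (π * t) = 2 * t := by field_simp
    nlinarith
  · have := mul_le_sin (x := π * (1 - t)) (by nlinarith) (by nlinarith)
    have h2 : 2 / π * (π * (1 - t)) = 2 * (1 - t) := by field_simp
    have h3 : sin (π * (1 - t)) = sin (π * t) := by
      rw [mul_sub, mul_one, sin_pi_sub]
    nlinarith

lemma sin_pi_mul_pos {t : ℝ} (ht : t ∈ Set.Ioo (0 : ℝ) 1) : 0 < sin (π * t) :=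
  lt_of_lt_of_le (by have := ht.1; have := ht.2; nlinarith [mul_pos ht.1 (sub_pos.2 ht.2)])
    (two_mul_le_sin_pi_mul ht.1 ht.2)

/-- A function on `(0, 1)` of the form `(1 - t) * s t / sin (π t) * r t` with `|s t| ≤ C t`, `|r| ≤ 1`. -/
lemma integrableOn_div_sin {s r : ℝ → ℝ} (hs : Continuous s) (hr : Continuous r) {C : ℝ}
    (hsC : ∀ t, 0 < t → |s t| ≤ C * t) (hr1 : ∀ t, |r t| ≤ 1) :
    IntegrableOn (fun t => (1 - t) * s t / sin (π * t) * r t) (Set.Ioo 0 1) := by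
  have hfin : volume (Set.Ioo (0 : ℝ) 1) < ⊤ := by simp
  refine Measure.integrableOn_of_bounded (M := C / 2) hfin.ne (Measurable.aestronglyMeasurable ?_) ?_
  · have := hs.measurable
    have := hr.measurable
    fun_prop
  filter_upwards [ae_restrict_mem measurableSet_Ioo] with t ht
  have h1 := two_mul_le_sin_pi_mul ht.1 ht.2
  have h2 := sin_pi_mul_pos ht
  have h3 := hsC t ht.1
  have h4 := hr1 t
  have ht1 : 0 < 1 - t := sub_pos.2 ht.2
  rw [norm_eq_abs, abs_mul, abs_div, abs_mul, abs_of_pos h2, abs_of_pos ht1]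
  have h5 : (1 - t) * |s t| / sin (π * t) ≤ C / 2 := by
    rw [div_le_iff₀ h2]
    have hC : 0 ≤ C := by
      by_contra hC
      have := abs_nonneg (s t)
      nlinarith [ht.1]
    nlinarith [mul_le_mul_of_nonneg_left h3 ht1.le, mul_le_mul_of_nonneg_left h1 hC]
  calc _ ≤ (1 - t) * |s t| / sin (π * t) * 1 := by gcongr
    _ ≤ _ := by linarith

lemma tendsto_integral_mul_osc {S : Set ℝ} (hS : MeasurableSet S) {g : ℝ → ℝ} (hg : IntegrableOn g S) :
    Tendsto (fun N : ℕ => ∫ t in S, g t * cos ((2 * N + 1) * (π * t))) atTop (𝓝 0) ∧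
    Tendsto (fun N : ℕ => ∫ t in S, g t * sin ((2 * N + 1) * (π * t))) atTop (𝓝 0) := by
  have hw : Tendsto (fun N : ℕ => ((2 * N + 1 : ℝ) / 2)) atTop (cocompact ℝ) := by
    refine Tendsto.mono_right ?_ atTop_le_cocompact
    have : Tendsto (fun N : ℕ => (N : ℝ)) atTop atTop := tendsto_natCast_atTop_atTop
    refine tendsto_atTop_mono (fun N => ?_) this
    linarith
  have h := (Real.tendsto_integral_exp_smul_cocompact
    (fun t => ((S.indicator g t : ℝ) : ℂ))).comp hw
  have hi : Integrable (S.indicator g) := (integrable_indicator_iff hS).2 hg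
  have hInt : ∀ w : ℝ, Integrable (fun v : ℝ => Real.fourierChar (-(v * w)) • ((S.indicator g v : ℝ) : ℂ)) := by
    intro w
    have := (Real.fourierIntegral_convergent_iff (μ := volume) (f := fun t => ((S.indicator g t : ℝ) : ℂ)) w).2 hi.ofReal
    simpa [mul_comm] using this
  have hval : ∀ (N : ℕ) (v : ℝ), Real.fourierChar (-(v * ((2 * N + 1 : ℝ) / 2))) • ((S.indicator g v : ℝ) : ℂ)
      = ((S.indicator g v * cos ((2 * N + 1) * (π * v)) : ℝ) : ℂ)
        - ((S.indicator g v * sin ((2 * N + 1) * (π * v)) : ℝ) : ℂ) * Complex.I := by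
    intro N v
    rw [Circle.smul_def, Real.fourierChar_apply]
    rw [show ((2 * π * -(v * ((2 * N + 1 : ℝ) / 2)) : ℝ) : ℂ) * Complex.I
      = ((-((2 * N + 1) * (π * v)) : ℝ) : ℂ) * Complex.I by push_cast; ring]
    rw [Complex.exp_mul_I, ← Complex.ofReal_cos, ← Complex.ofReal_sin, cos_neg, sin_neg]
    push_cast
    simp only [smul_eq_mul]
    ring
  have hre := (Complex.continuous_re.tendsto 0).comp h
  have him := (Complex.continuous_im.tendsto 0).comp h
  have e1 : ∀ N : ℕ, (∫ v : ℝ, Real.fourierChar (-(v * ((2 * N + 1 : ℝ) / 2))) • ((S.indicator g v : ℝ) : ℂ)).re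
      = ∫ t in S, g t * cos ((2 * N + 1) * (π * t)) := by
    intro N
    have := (integral_re (hInt ((2 * N + 1 : ℝ) / 2)))
    simp only [RCLike.re_to_complex] at this
    rw [← this, ← integral_indicator hS]
    congr 1; ext v
    rw [hval, Complex.sub_re, Complex.ofReal_re, Complex.re_ofReal_mul]
    by_cases hv : v ∈ S <;> simp [hv]
  have e2 : ∀ N : ℕ, (∫ v : ℝ, Real.fourierChar (-(v * ((2 * N + 1 : ℝ) / 2))) • ((S.indicator g v : ℝ) : ℂ)).im
      = - ∫ t in S, g t * sin ((2 * N + 1) * (π * t)) := by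
    intro N
    have := (integral_im (hInt ((2 * N + 1 : ℝ) / 2)))
    simp only [RCLike.im_to_complex] at this
    rw [← this, ← integral_neg, ← integral_indicator hS]
    congr 1; ext v
    rw [hval, Complex.sub_im, Complex.ofReal_im, Complex.im_ofReal_mul]
    by_cases hv : v ∈ S <;> simp [hv]
  constructor
  · simpa only [Function.comp_def, e1, Complex.zero_re] using hre
  · have := him.neg
    simpa only [Function.comp_def, e2, Complex.zero_im, neg_neg, neg_zero] using this

lemma abs_sin_mul_le (u t : ℝ) (ht : 0 < t) : |sin (u * t)| ≤ |u| * t := by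
  have := abs_sin_le_abs (x := u * t)
  rwa [abs_mul, abs_of_pos ht] at this

lemma abs_cos_mul_sub_one_le (u t : ℝ) (ht : 0 < t) : |cos (u * t) - 1| ≤ |u| * t := by
  have h1 : cos (u * t) - 1 = - (2 * sin (u * t / 2) ^ 2) := by
    have := cos_sq (u * t / 2)
    have h2 := sin_sq_add_cos_sq (u * t / 2)
    rw [mul_div_cancel₀ _ (two_ne_zero)] at this
    linarith
  have h2 := abs_sin_le_abs (x := u * t / 2)
  have h3 := abs_sin_le_one (u * t / 2)
  rw [abs_div, abs_mul, abs_of_pos ht, abs_two] at h2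
  rw [h1, abs_neg, abs_mul, abs_two, abs_pow]
  nlinarith [abs_nonneg (sin (u * t / 2))]

lemma integrableOn_one_sub_mul {r : ℝ → ℝ} (hr : Continuous r) :
    IntegrableOn (fun t => (1 - t) * r t) (Set.Ioo 0 1) :=
  (Continuous.integrableOn_Icc (by fun_prop)).mono_set Set.Ioo_subset_Icc_self

lemma two_mul_sum_sin_mul_sin (N : ℕ) (t : ℝ) :
    (∑ n ∈ Finset.range N, 2 * sin (2 * π * (n + 1 : ℕ) * t)) * sin (π * t) =
      cos (π * t) - cos ((2 * N + 1) * (π * t)) := by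
  induction N with
  | zero => simp
  | succ n ih =>
    rw [Finset.sum_range_succ, add_mul, ih]
    have e1 : (2 * (n : ℝ) + 1) * (π * t) = 2 * π * (n + 1 : ℕ) * t - π * t := by push_cast; ring
    have e2 : (2 * ((n + 1 : ℕ) : ℝ) + 1) * (π * t) = 2 * π * (n + 1 : ℕ) * t + π * t := by push_cast; ring
    rw [e1, e2, cos_sub, cos_add]
    ring

lemma one_add_sum_cos_mul_sin (N : ℕ) (t : ℝ) :
    (1 + ∑ n ∈ Finset.range N, 2 * cos (2 * π * (n + 1 : ℕ) * t)) * sin (π * t) =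
      sin ((2 * N + 1) * (π * t)) := by
  induction N with
  | zero => simp
  | succ n ih =>
    rw [Finset.sum_range_succ, ← add_assoc, add_mul, ih]
    have e1 : (2 * (n : ℝ) + 1) * (π * t) = 2 * π * (n + 1 : ℕ) * t - π * t := by push_cast; ring
    have e2 : (2 * ((n + 1 : ℕ) : ℝ) + 1) * (π * t) = 2 * π * (n + 1 : ℕ) * t + π * t := by push_cast; ring
    rw [e1, e2, sin_sub, sin_add]
    ring

/-- The oscillatory integral in the majorant. -/
noncomputable def cotIntegral (u : ℝ) : ℝ :=
  ∫ t in Set.Ioo (0 : ℝ) 1, (1 - t) * sin (u * t) / sin (π * t) * cos (π * t)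

lemma integrableOn_cotIntegral (u : ℝ) {r : ℝ → ℝ} (hr : Continuous r) (hr1 : ∀ t, |r t| ≤ 1) :
    IntegrableOn (fun t => (1 - t) * sin (u * t) / sin (π * t) * r t) (Set.Ioo 0 1) :=
  integrableOn_div_sin (by fun_prop) hr (abs_sin_mul_le u) hr1

lemma tendsto_sum_fejer_sub (u : ℝ) :
    Tendsto (fun N : ℕ => ∑ n ∈ Finset.range N,
      (fejer (u - 2 * π * (n + 1 : ℕ)) - fejer (u + 2 * π * (n + 1 : ℕ)))) atTop
      (𝓝 (cotIntegral u)) := by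
  have hg : IntegrableOn (fun t => (1 - t) * sin (u * t) / sin (π * t)) (Set.Ioo 0 1) := by
    simpa using integrableOn_cotIntegral u (r := fun _ => 1) continuous_const (by simp)
  have h := (tendsto_integral_mul_osc measurableSet_Ioo hg).1
  have h2 := h.const_sub (cotIntegral u)
  rw [sub_zero] at h2
  refine h2.congr fun N => ?_
  have e1 : ∀ n : ℕ, fejer (u - 2 * π * (n + 1 : ℕ)) - fejer (u + 2 * π * (n + 1 : ℕ))
      = ∫ t in Set.Ioo (0 : ℝ) 1, (1 - t) * (sin (u * t) * (2 * sin (2 * π * (n + 1 : ℕ) * t))) := by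
    intro n
    rw [← integral_one_sub_mul_cos, ← integral_one_sub_mul_cos, ← integral_sub
      (integrableOn_one_sub_mul (by fun_prop)) (integrableOn_one_sub_mul (by fun_prop))]
    congr 1; ext t
    rw [sub_mul u, add_mul u, cos_sub, cos_add]; ring
  rw [Finset.sum_congr rfl fun n _ => e1 n,
    ← integral_finsetSum _ fun n _ => integrableOn_one_sub_mul (by fun_prop), cotIntegral,
    ← integral_sub (integrableOn_cotIntegral u (by fun_prop) fun t => abs_cos_le_one _)
      (integrableOn_cotIntegral u (by fun_prop) fun t => abs_cos_le_one _)]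
  refine setIntegral_congr_fun measurableSet_Ioo fun t ht => ?_
  have hs := sin_pi_mul_pos ht
  have := two_mul_sum_sin_mul_sin N t
  rw [← Finset.mul_sum, ← Finset.mul_sum, ← mul_sub, ← this]
  generalize ∑ n ∈ Finset.range N, 2 * sin (2 * π * (n + 1 : ℕ) * t) = S
  generalize sin (π * t) = σ at *
  field_simp

lemma tendsto_sum_fejer_add (u : ℝ) :
    Tendsto (fun N : ℕ => fejer u + ∑ n ∈ Finset.range N,
      (fejer (u - 2 * π * (n + 1 : ℕ)) + fejer (u + 2 * π * (n + 1 : ℕ)))) atTop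
      (𝓝 (1 / 2)) := by
  have hi : ∀ {r : ℝ → ℝ}, Continuous r → (∀ t, |r t| ≤ 1) →
      IntegrableOn (fun t => (1 - t) * (cos (u * t) - 1) / sin (π * t) * r t) (Set.Ioo 0 1) :=
    fun hr hr1 => integrableOn_div_sin (by fun_prop) hr (abs_cos_mul_sub_one_le u) hr1
  have hg : IntegrableOn (fun t => (1 - t) * (cos (u * t) - 1) / sin (π * t)) (Set.Ioo 0 1) := by
    simpa using hi (r := fun _ => 1) continuous_const (by simp)
  have h := (tendsto_integral_mul_osc measurableSet_Ioo hg).2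
  have h2 := h.const_add (1 / 2 : ℝ)
  rw [add_zero] at h2
  refine h2.congr fun N => ?_
  have e0 : ∀ v : ℝ, fejer v + ∑ n ∈ Finset.range N,
      (fejer (v - 2 * π * (n + 1 : ℕ)) + fejer (v + 2 * π * (n + 1 : ℕ)))
      = ∫ t in Set.Ioo (0 : ℝ) 1, (1 - t) * (cos (v * t) *
          (1 + ∑ n ∈ Finset.range N, 2 * cos (2 * π * (n + 1 : ℕ) * t))) := by
    intro v
    have e1 : ∀ n : ℕ, fejer (v - 2 * π * (n + 1 : ℕ)) + fejer (v + 2 * π * (n + 1 : ℕ))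
        = ∫ t in Set.Ioo (0 : ℝ) 1, (1 - t) * (cos (v * t) * (2 * cos (2 * π * (n + 1 : ℕ) * t))) := by
      intro n
      rw [← integral_one_sub_mul_cos, ← integral_one_sub_mul_cos, ← integral_add
        (integrableOn_one_sub_mul (by fun_prop)) (integrableOn_one_sub_mul (by fun_prop))]
      congr 1; ext t
      rw [sub_mul v, add_mul v, cos_sub, cos_add]; ring
    rw [Finset.sum_congr rfl fun n _ => e1 n,
      ← integral_finsetSum _ fun n _ => integrableOn_one_sub_mul (by fun_prop),
      ← integral_one_sub_mul_cos, ← integral_add (integrableOn_one_sub_mul (by fun_prop))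
        (integrable_finsetSum _ fun n _ => integrableOn_one_sub_mul (by fun_prop))]
    congr 1; ext t
    rw [← Finset.mul_sum, ← Finset.mul_sum]; ring
  have e2 : fejer 0 + ∑ n ∈ Finset.range N,
      (fejer (0 - 2 * π * (n + 1 : ℕ)) + fejer (0 + 2 * π * (n + 1 : ℕ))) = 1 / 2 := by
    have : ∀ n : ℕ, fejer (2 * π * (n + 1 : ℕ)) = 0 := by
      intro n
      have hne : 2 * π * ((n + 1 : ℕ) : ℝ) ≠ 0 := by positivity
      rw [fejer_of_ne_zero hne, ← zero_add (2 * π * _), cos_add_two_pi_mul_nat]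
      simp
    simp only [zero_sub, zero_add, fejer_neg, this, fejer_zero]
    simp
  rw [e0 0] at e2
  rw [e0 u, ← e2, ← integral_add (integrableOn_one_sub_mul (by fun_prop))
    (hi (by fun_prop) fun t => abs_sin_le_one _)]
  refine setIntegral_congr_fun measurableSet_Ioo fun t ht => ?_
  have hs := sin_pi_mul_pos ht
  rw [← one_add_sum_cos_mul_sin N t, zero_mul, cos_zero]
  generalize ∑ n ∈ Finset.range N, 2 * cos (2 * π * (n + 1 : ℕ) * t) = S
  generalize sin (π * t) = σ at *
  field_simp
  ring

lemma prawitz_integrand_eq {u t : ℝ} : (1 - t) * cos (u * t) - prawitzIm t * sin (u * t) =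
    (1 - t) * cos (u * t) - (1 - t) * sin (u * t) / sin (π * t) * cos (π * t)
      - sin (u * t) / π := by
  unfold prawitzIm; ring

lemma integral_sin_mul (u : ℝ) : ∫ t in Set.Ioo (0 : ℝ) 1, sin (u * t) / π = (1 - cos u) / (π * u) := by
  rw [← integral_Ioc_eq_integral_Ioo, ← intervalIntegral.integral_of_le zero_le_one]
  by_cases hu : u = 0
  · simp [hu]
  · rw [intervalIntegral.integral_div, intervalIntegral.integral_comp_mul_left (fun x => sin x) hu]
    simp
    field_simp

lemma majorant_eq (u : ℝ) :
    majorant u = 1 / 2 + fejer u - cotIntegral u - (1 - cos u) / (π * u) := by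
  unfold majorant
  simp_rw [prawitz_integrand_eq]
  have hsin : IntegrableOn (fun t => sin (u * t) / π) (Set.Ioo 0 1) :=
    (Continuous.integrableOn_Icc (by fun_prop)).mono_set Set.Ioo_subset_Icc_self
  have hcot := integrableOn_cotIntegral u (r := fun t => cos (π * t)) (by fun_prop)
    fun t => abs_cos_le_one _
  have hcos := integrableOn_one_sub_mul (r := fun t => cos (u * t)) (by fun_prop)
  have h1 : IntegrableOn (fun t => (1 - t) * cos (u * t) -
      (1 - t) * sin (u * t) / sin (π * t) * cos (π * t)) (Set.Ioo 0 1) := hcos.sub hcot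
  rw [integral_sub h1 hsin, integral_sub hcos hcot, integral_sin_mul,
    integral_one_sub_mul_cos, cotIntegral]
  ring

lemma cotIntegral_neg (u : ℝ) : cotIntegral (-u) = - cotIntegral u := by
  unfold cotIntegral
  rw [← integral_neg]
  congr 1; ext t
  rw [neg_mul, sin_neg]; ring

lemma majorant_add_majorant_neg (u : ℝ) : majorant u + majorant (-u) = 1 + 2 * fejer u := by
  rw [majorant_eq, majorant_eq, cotIntegral_neg, fejer_neg, cos_neg, mul_neg, div_neg]
  ring

lemma tendsto_sum_fejer_right (u : ℝ) :
    Tendsto (fun N : ℕ => 2 * ∑ n ∈ Finset.range N, fejer (u + 2 * π * (n + 1 : ℕ))) atTop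
      (𝓝 (1 / 2 - cotIntegral u - fejer u)) := by
  have := ((tendsto_sum_fejer_add u).sub (tendsto_sum_fejer_sub u)).sub_const (fejer u)
  refine this.congr fun N => ?_
  rw [Finset.sum_add_distrib, Finset.sum_sub_distrib]; ring

lemma fejer_shift {u : ℝ} (hu : 0 < u) (n : ℕ) :
    fejer (u + 2 * π * n) = (1 - cos u) / (u + 2 * π * n) ^ 2 := by
  have : u + 2 * π * n ≠ 0 := by have := pi_pos; positivity
  rw [fejer_of_ne_zero this, cos_add_two_pi_mul_nat]

lemma sum_fejer_ge {u : ℝ} (hu : 0 < u) (N : ℕ) :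
    (1 - cos u) / (2 * π) * (1 / u - 1 / (u + 2 * π * (N + 1 : ℕ))) ≤
      fejer u + ∑ n ∈ Finset.range N, fejer (u + 2 * π * (n + 1 : ℕ)) := by
  have hpi := pi_pos
  have hc : 0 ≤ 1 - cos u := by linarith [cos_le_one u]
  have key : ∀ v : ℝ, 0 < v → 1 / (2 * π) * (1 / v - 1 / (v + 2 * π)) ≤ 1 / v ^ 2 := by
    intro v hv
    rw [div_sub_div _ _ (by positivity) (by positivity)]
    field_simp
    nlinarith
  induction N with
  | zero =>
    have h0 := fejer_shift hu 0
    simp only [Nat.cast_zero, mul_zero, add_zero] at h0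
    have := mul_le_mul_of_nonneg_left (key u hu) hc
    simp only [Finset.range_zero, Finset.sum_empty, add_zero, zero_add, Nat.cast_one, mul_one, h0]
    calc _ = (1 - cos u) * (1 / (2 * π) * (1 / u - 1 / (u + 2 * π))) := by ring
      _ ≤ _ := this
      _ = _ := by ring
  | succ n ih =>
    rw [Finset.sum_range_succ, fejer_shift hu (n + 1)]
    have := mul_le_mul_of_nonneg_left (key (u + 2 * π * (n + 1 : ℕ)) (by positivity)) hc
    have e : u + 2 * π * (n + 1 : ℕ) + 2 * π = u + 2 * π * (n + 1 + 1 : ℕ) := by push_cast; ring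
    rw [e] at this
    calc _ = (1 - cos u) / (2 * π) * (1 / u - 1 / (u + 2 * π * (n + 1 : ℕ))) + (1 - cos u) *
          (1 / (2 * π) * (1 / (u + 2 * π * (n + 1 : ℕ)) - 1 / (u + 2 * π * (n + 1 + 1 : ℕ)))) := by ring
      _ ≤ _ := add_le_add ih this
      _ = _ := by ring

lemma sum_fejer_le {u : ℝ} (hu : 0 < u) (N : ℕ) :
    ∑ n ∈ Finset.range N, fejer (u + 2 * π * (n + 1 : ℕ)) ≤
    (1 - cos u) / (2 * π) * (1 / u - 1 / (u + 2 * π * N)) := by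
  have hpi := pi_pos
  have hc : 0 ≤ 1 - cos u := by linarith [cos_le_one u]
  have key : ∀ v : ℝ, 0 < v → 1 / (v + 2 * π) ^ 2 ≤ 1 / (2 * π) * (1 / v - 1 / (v + 2 * π)) := by
    intro v hv
    rw [div_sub_div _ _ (by positivity) (by positivity)]
    field_simp
    nlinarith
  induction N with
  | zero => simp
  | succ n ih =>
    rw [Finset.sum_range_succ, fejer_shift hu (n + 1)]
    have := mul_le_mul_of_nonneg_left (key (u + 2 * π * n) (by positivity)) hc
    have e : u + 2 * π * n + 2 * π = u + 2 * π * (n + 1 : ℕ) := by push_cast; ring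
    rw [e] at this
    calc _ ≤ _ := add_le_add ih (le_of_eq_of_le (by ring) this)
      _ = _ := by ring

lemma tendsto_inv_shift (u : ℝ) : Tendsto (fun N : ℕ => 1 / (u + 2 * π * (N : ℕ))) atTop (𝓝 0) := by
  have hpi := pi_pos
  have : Tendsto (fun N : ℕ => u + 2 * π * (N : ℕ)) atTop atTop :=
    tendsto_atTop_add_const_left _ _
      ((tendsto_natCast_atTop_atTop).const_mul_atTop (by positivity))
  simp only [one_div]
  exact this.inv_tendsto_atTop

lemma majorant_nonneg_of_pos {u : ℝ} (hu : 0 < u) : 0 ≤ majorant u := by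
  have h1 := (tendsto_sum_fejer_right u).const_add (2 * fejer u)
  have h2 := (((tendsto_inv_shift u).comp (tendsto_add_atTop_nat 1)).const_sub
    (1 / u)).const_mul ((1 - cos u) / (2 * π))
  have := le_of_tendsto_of_tendsto' (h2.const_mul 2) h1 fun N => by
    have := sum_fejer_ge hu N
    simp only [Function.comp]
    linarith
  rw [majorant_eq]
  have e : 2 * ((1 - cos u) / (2 * π) * (1 / u - 0)) = (1 - cos u) / (π * u) := by
    field_simp; simp
  rw [e] at this
  linarith

lemma one_le_majorant_neg {u : ℝ} (hu : 0 < u) : 1 ≤ majorant (-u) := by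
  have hpi := pi_pos
  have h2 := ((tendsto_inv_shift u).const_sub (1 / u)).const_mul ((1 - cos u) / (2 * π))
  have := le_of_tendsto_of_tendsto' (tendsto_sum_fejer_right u) (h2.const_mul 2) fun N => by
    have := sum_fejer_le hu N
    linarith
  have e : 2 * ((1 - cos u) / (2 * π) * (1 / u - 0)) = (1 - cos u) / (π * u) := by
    field_simp; simp
  rw [e] at this
  have h3 := majorant_add_majorant_neg u
  have h4 := majorant_eq u
  linarith

lemma majorant_zero : majorant 0 = 1 := by
  have := majorant_add_majorant_neg 0
  rw [neg_zero, fejer_zero] at this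
  linarith

lemma majorant_nonneg (u : ℝ) : 0 ≤ majorant u := by
  rcases lt_trichotomy u 0 with h | h | h
  · have := one_le_majorant_neg (neg_pos.2 h); rw [neg_neg] at this; linarith
  · rw [h, majorant_zero]; exact zero_le_one
  · exact majorant_nonneg_of_pos h

lemma one_le_majorant {u : ℝ} (hu : u ≤ 0) : 1 ≤ majorant u := by
  rcases hu.lt_or_eq with h | h
  · have := one_le_majorant_neg (neg_pos.2 h); rwa [neg_neg] at this
  · rw [h, majorant_zero]

lemma two_mul_integral_fejer_le (N : ℕ) : ∫ u in (0 : ℝ)..(N * (2 * π)), fejer u ≤ π / 2 := by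
  have hpi := pi_pos
  have hc := continuous_fejer
  have hsum : ∫ u in (0 : ℝ)..(N * (2 * π)), fejer u =
      ∑ n ∈ Finset.range N, ∫ u in (0 : ℝ)..(2 * π), fejer (u + 2 * π * n) := by
    have := intervalIntegral.sum_integral_adjacent_intervals (f := fejer) (μ := volume)
      (a := fun n : ℕ => (n : ℝ) * (2 * π)) (n := N) fun k _ => hc.intervalIntegrable _ _
    simp only [Nat.cast_zero, zero_mul] at this
    rw [← this]
    refine Finset.sum_congr rfl fun n _ => ?_
    rw [intervalIntegral.integral_comp_add_right fejer]
    congr 1 <;> push_cast <;> ring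
  have hrefl : ∀ n : ℕ, ∫ u in (0 : ℝ)..(2 * π), fejer (u + 2 * π * n) =
      ∫ u in (0 : ℝ)..(2 * π), fejer (u - 2 * π * (n + 1 : ℕ)) := by
    intro n
    have := intervalIntegral.integral_comp_sub_left (fun u => fejer (u - 2 * π * (n + 1 : ℕ)))
      (a := 0) (b := 2 * π) (2 * π)
    rw [sub_zero, sub_self] at this
    rw [← this]
    congr 1; ext u
    rw [← fejer_neg]
    congr 1; push_cast; ring
  have hle : ∀ u : ℝ, ∑ n ∈ Finset.range N, (fejer (u + 2 * π * n) + fejer (u - 2 * π * (n + 1 : ℕ)))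
      ≤ 1 / 2 := by
    intro u
    have hmono : Monotone (fun N : ℕ => fejer u + ∑ n ∈ Finset.range N,
      (fejer (u - 2 * π * (n + 1 : ℕ)) + fejer (u + 2 * π * (n + 1 : ℕ)))) := by
      refine monotone_nat_of_le_succ fun n => ?_
      rw [Finset.sum_range_succ]
      linarith [fejer_nonneg (u - 2 * π * (n + 1 : ℕ)), fejer_nonneg (u + 2 * π * (n + 1 : ℕ))]
    refine le_trans ?_ (hmono.ge_of_tendsto (tendsto_sum_fejer_add u) N)
    simp only [Finset.sum_add_distrib]
    have h1 : ∑ n ∈ Finset.range N, fejer (u + 2 * π * n) ≤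
        ∑ n ∈ Finset.range (N + 1), fejer (u + 2 * π * n) := by
      rw [Finset.sum_range_succ]
      linarith [fejer_nonneg (u + 2 * π * N)]
    rw [Finset.sum_range_succ'] at h1
    simp only [Nat.cast_zero, mul_zero, add_zero] at h1
    linarith
  have h2 : 2 * ∫ u in (0 : ℝ)..(N * (2 * π)), fejer u ≤ ∫ u in (0 : ℝ)..(2 * π), (1 / 2 : ℝ) := by
    calc 2 * ∫ u in (0 : ℝ)..(N * (2 * π)), fejer u
        = ∑ n ∈ Finset.range N, ∫ u in (0 : ℝ)..(2 * π),
          (fejer (u + 2 * π * n) + fejer (u - 2 * π * (n + 1 : ℕ))) := by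
          rw [two_mul]
          nth_rewrite 2 [hsum]
          rw [Finset.sum_congr rfl fun n _ => hrefl n, hsum, ← Finset.sum_add_distrib]
          refine Finset.sum_congr rfl fun n _ => ?_
          rw [intervalIntegral.integral_add] <;> exact Continuous.intervalIntegrable (by fun_prop) _ _
      _ = ∫ u in (0 : ℝ)..(2 * π), ∑ n ∈ Finset.range N,
          (fejer (u + 2 * π * n) + fejer (u - 2 * π * (n + 1 : ℕ))) := by
          rw [intervalIntegral.integral_finsetSum]
          intro n _
          exact Continuous.intervalIntegrable (by fun_prop) _ _
      _ ≤ _ := by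
          refine intervalIntegral.integral_mono_on (by positivity)
            (Continuous.intervalIntegrable (by fun_prop) _ _) (by simp) fun u _ => hle u
  simp at h2
  linarith

lemma tendsto_nat_mul_two_pi : Tendsto (fun N : ℕ => (N : ℝ) * (2 * π)) atTop atTop := by
  have hpi := pi_pos
  exact (tendsto_natCast_atTop_atTop).atTop_mul_const (by positivity)

lemma integrableOn_fejer : IntegrableOn fejer (Set.Ioi 0) := by
  refine integrableOn_Ioi_of_intervalIntegral_norm_bounded (π / 2) 0 (fun N : ℕ => ?_)
    tendsto_nat_mul_two_pi (Eventually.of_forall fun N => ?_)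
  · exact (continuous_fejer.integrableOn_Icc).mono_set Set.Ioc_subset_Icc_self
  · simp only [norm_of_nonneg (fejer_nonneg _)]
    exact two_mul_integral_fejer_le N

lemma integral_fejer_le : ∫ u in Set.Ioi (0 : ℝ), fejer u ≤ π / 2 :=
  le_of_tendsto' (intervalIntegral_tendsto_integral_Ioi 0 integrableOn_fejer tendsto_nat_mul_two_pi)
    two_mul_integral_fejer_le

lemma measurable_majorant : Measurable majorant := by
  unfold majorant prawitzIm
  refine Measurable.const_add ?_ _
  refine (StronglyMeasurable.integral_prod_right
    (f := fun u t => (1 - t) * cos (u * t) - ((1 - t) * (cos (π * t) / sin (π * t)) + 1 / π) * sin (u * t)) ?_).measurable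
  refine Measurable.stronglyMeasurable ?_
  fun_prop

/-- Error of the majorant. -/
noncomputable def majorantGap (u : ℝ) : ℝ := majorant u - (Set.Iic (0 : ℝ)).indicator 1 u

lemma measurable_majorantGap : Measurable majorantGap :=
  measurable_majorant.sub (measurable_one.indicator measurableSet_Iic)

lemma majorantGap_nonneg (u : ℝ) : 0 ≤ majorantGap u := by
  unfold majorantGap
  by_cases hu : u ≤ 0
  · simp [hu, one_le_majorant hu]
  · simp [hu, majorant_nonneg]

lemma majorantGap_add_neg {u : ℝ} (hu : 0 < u) : majorantGap u + majorantGap (-u) = 2 * fejer u := by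
  unfold majorantGap
  have h1 : ¬ u ≤ 0 := not_le.2 hu
  have h2 : -u ≤ 0 := by linarith
  have := majorant_add_majorant_neg u
  simp only [Set.indicator, Set.mem_Iic, h1, h2, if_true, if_false, Pi.one_apply]
  linarith

lemma integrableOn_majorantGap_Ioi : IntegrableOn majorantGap (Set.Ioi 0) := by
  refine (integrableOn_fejer.const_mul 2).mono' measurable_majorantGap.aestronglyMeasurable ?_
  filter_upwards [ae_restrict_mem measurableSet_Ioi] with u hu
  rw [norm_of_nonneg (majorantGap_nonneg u), ← majorantGap_add_neg hu]
  linarith [majorantGap_nonneg (-u)]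

lemma integrableOn_majorantGap_neg : IntegrableOn (fun u => majorantGap (-u)) (Set.Ioi 0) := by
  refine (integrableOn_fejer.const_mul 2).mono'
    (measurable_majorantGap.comp measurable_neg).aestronglyMeasurable ?_
  filter_upwards [ae_restrict_mem measurableSet_Ioi] with u hu
  rw [norm_of_nonneg (majorantGap_nonneg _), ← majorantGap_add_neg hu]
  linarith [majorantGap_nonneg u]

lemma integrable_majorantGap : Integrable majorantGap := by
  rw [← integrableOn_univ, ← Set.Iic_union_Ioi (a := (0 : ℝ))]
  refine IntegrableOn.union ?_ integrableOn_majorantGap_Ioi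
  rw [integrableOn_Iic_iff_integrableOn_Iio, ← (Measure.measurePreserving_neg (volume : Measure ℝ)).integrableOn_comp_preimage
    (MeasurableEquiv.neg ℝ).measurableEmbedding]
  simpa using! integrableOn_majorantGap_neg

lemma integral_majorantGap_le : ∫ u, majorantGap u ≤ π := by
  rw [← intervalIntegral.integral_Iic_add_Ioi integrable_majorantGap.integrableOn
    integrable_majorantGap.integrableOn (b := 0)]
  have h := integral_comp_neg_Ioi (0 : ℝ) majorantGap
  rw [neg_zero] at h
  rw [← h, ← integral_add integrableOn_majorantGap_neg integrableOn_majorantGap_Ioi]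
  have : ∫ u in Set.Ioi (0 : ℝ), (majorantGap (-u) + majorantGap u) = ∫ u in Set.Ioi (0 : ℝ), 2 * fejer u := by
    refine setIntegral_congr_fun measurableSet_Ioi fun u hu => ?_
    have := majorantGap_add_neg hu
    linarith
  rw [this, integral_const_mul]
  linarith [integral_fejer_le]

lemma abs_prawitzIm_mul_le {t : ℝ} (ht : t ∈ Set.Ioo (0 : ℝ) 1) : |prawitzIm t| * t ≤ 1 := by
  have hpi := pi_gt_three
  have hs := sin_pi_mul_pos ht
  have h1 := two_mul_le_sin_pi_mul ht.1 ht.2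
  have ht1 : 0 < 1 - t := sub_pos.2 ht.2
  have h2 : |(1 - t) * (cos (π * t) / sin (π * t))| * t ≤ 1 / 2 := by
    rw [abs_mul, abs_div, abs_of_pos hs, abs_of_pos ht1]
    rw [← mul_div_assoc, div_mul_eq_mul_div, div_le_iff₀ hs]
    have := abs_cos_le_one (π * t)
    nlinarith [mul_pos ht1 ht.1, mul_le_mul_of_nonneg_left this (mul_pos ht1 ht.1).le]
  have h3 : |1 / π| * t ≤ 1 / 2 := by
    rw [abs_of_pos (by positivity), div_mul_eq_mul_div, div_le_iff₀ (by positivity)]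
    nlinarith [ht.2]
  unfold prawitzIm
  calc _ ≤ (|(1 - t) * (cos (π * t) / sin (π * t))| + |1 / π|) * t := by
        gcongr
        · exact ht.1.le
        · exact abs_add_le _ _
    _ ≤ 1 := by linarith

/-- Prawitz's kernel as a complex number. -/
noncomputable def prawitz (t : ℝ) : ℂ := ⟨1 - t, prawitzIm t⟩

lemma measurable_prawitzIm : Measurable prawitzIm := by unfold prawitzIm; fun_prop

lemma integral_prawitz_integrand (μ : Measure ℝ) [IsProbabilityMeasure μ] (T x t : ℝ) :
    ∫ w, ((1 - t) * cos (T * (w - x) * t) - prawitzIm t * sin (T * (w - x) * t)) ∂μ =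
      (prawitz t * Complex.exp (((-(T * x * t) : ℝ) : ℂ) * Complex.I) * charFun μ (T * t)).re := by
  rw [charFun_apply_real, ← integral_const_mul]
  have hInt : Integrable (fun w : ℝ => prawitz t * Complex.exp (((-(T * x * t) : ℝ) : ℂ) * Complex.I) *
      Complex.exp (((T * t : ℝ) : ℂ) * (w : ℂ) * Complex.I)) μ := by
    refine Integrable.const_mul ?_ _
    refine Integrable.of_bound (C := 1) (by fun_prop) (Eventually.of_forall fun w => ?_)
    rw [← Complex.ofReal_mul, Complex.norm_exp_ofReal_mul_I]
  have := integral_re hInt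
  simp only [RCLike.re_to_complex] at this
  rw [← this]
  congr 1; ext w
  rw [mul_assoc (prawitz t), ← Complex.exp_add]
  have e : ((-(T * x * t) : ℝ) : ℂ) * Complex.I + ((T * t : ℝ) : ℂ) * (w : ℂ) * Complex.I =
      ((T * (w - x) * t : ℝ) : ℂ) * Complex.I := by push_cast; ring
  rw [e, Complex.exp_mul_I, ← Complex.ofReal_cos, ← Complex.ofReal_sin]
  generalize cos (T * (w - x) * t) = a
  generalize sin (T * (w - x) * t) = b
  simp [prawitz]

lemma integrable_prod_prawitz (μ : Measure ℝ) [IsProbabilityMeasure μ] (hμ : Integrable (fun w => w) μ)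
    (T x : ℝ) : Integrable (Function.uncurry fun (w t : ℝ) =>
      (1 - t) * cos (T * (w - x) * t) - prawitzIm t * sin (T * (w - x) * t))
      (μ.prod (volume.restrict (Set.Ioo (0 : ℝ) 1))) := by
  have h1 : Integrable (fun w : ℝ => 1 + |T * (w - x)|) μ :=
    (integrable_const _).add (((hμ.sub (integrable_const _)).const_mul _).abs)
  have h2 := h1.comp_fst (volume.restrict (Set.Ioo (0 : ℝ) 1))
  have hm := measurable_prawitzIm
  refine h2.mono' (Measurable.aestronglyMeasurable (by fun_prop)) ?_
  have : ∀ᵐ z ∂(μ.prod (volume.restrict (Set.Ioo (0 : ℝ) 1))), z.2 ∈ Set.Ioo (0 : ℝ) 1 := by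
    have h := ae_restrict_mem (μ := μ.prod volume) (MeasurableSet.univ.prod (measurableSet_Ioo (a := (0 : ℝ)) (b := 1)))
    rw [← Measure.prod_restrict, Measure.restrict_univ] at h
    filter_upwards [h] with z hz using hz.2
  filter_upwards [this] with z hz
  have hk := abs_prawitzIm_mul_le hz
  have hz1 : 0 < 1 - z.2 := sub_pos.2 hz.2
  have hz0 := hz.1
  simp only [Function.uncurry]
  have hs : |sin (T * (z.1 - x) * z.2)| ≤ |T * (z.1 - x)| * z.2 := abs_sin_mul_le _ _ hz.1
  have hc := abs_cos_le_one (T * (z.1 - x) * z.2)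
  calc ‖(1 - z.2) * cos (T * (z.1 - x) * z.2) - prawitzIm z.2 * sin (T * (z.1 - x) * z.2)‖
      ≤ |(1 - z.2) * cos (T * (z.1 - x) * z.2)| + |prawitzIm z.2 * sin (T * (z.1 - x) * z.2)| := abs_sub _ _
    _ = (1 - z.2) * |cos (T * (z.1 - x) * z.2)| + |prawitzIm z.2| * |sin (T * (z.1 - x) * z.2)| := by
        rw [abs_mul, abs_mul, abs_of_pos hz1]
    _ ≤ (1 - z.2) * 1 + |prawitzIm z.2| * (|T * (z.1 - x)| * z.2) := by gcongr
    _ = (1 - z.2) * 1 + |prawitzIm z.2| * z.2 * |T * (z.1 - x)| := by ring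
    _ ≤ (1 - z.2) * 1 + 1 * |T * (z.1 - x)| := by gcongr
    _ ≤ 1 + |T * (z.1 - x)| := by linarith

lemma integral_majorant_eq (μ : Measure ℝ) [IsProbabilityMeasure μ] (hμ : Integrable (fun w => w) μ)
    (T x : ℝ) :
    IntegrableOn (fun t => (prawitz t * Complex.exp (((-(T * x * t) : ℝ) : ℂ) * Complex.I) *
      charFun μ (T * t)).re) (Set.Ioo 0 1) ∧ Integrable (fun w => majorant (T * (w - x))) μ ∧
    ∫ w, majorant (T * (w - x)) ∂μ = 1 / 2 + ∫ t in Set.Ioo (0 : ℝ) 1,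
      (prawitz t * Complex.exp (((-(T * x * t) : ℝ) : ℂ) * Complex.I) * charFun μ (T * t)).re := by
  have hp := integrable_prod_prawitz μ hμ T x
  have h1 := hp.integral_prod_left
  have h2 := hp.integral_prod_right
  simp only [Function.uncurry] at h1 h2
  simp_rw [integral_prawitz_integrand] at h2
  refine ⟨h2, (integrable_const _).add h1, ?_⟩
  simp_rw [← integral_prawitz_integrand]
  rw [← integral_integral_swap hp]
  simp only [majorant]
  rw [integral_add (integrable_const _) h1]
  simp

lemma integral_majorant_gaussian_le {T : ℝ} (hT : 0 < T) (x : ℝ) :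
    ∫ w, majorant (T * (w - x)) ∂(gaussianReal 0 1) ≤
      (gaussianReal 0 1).real (Set.Iic x) + √(π / 2) / T := by
  have hpi := pi_pos
  have hg : Integrable (fun w : ℝ => w) (gaussianReal 0 1) :=
    (memLp_id_gaussianReal 1).integrable (by simp)
  have hM := (integral_majorant_eq _ hg T x).2.1
  have hind : ∀ w : ℝ, majorant (T * (w - x)) = (Set.Iic x).indicator 1 w + majorantGap (T * (w - x)) := by
    intro w
    unfold majorantGap
    have : (Set.Iic (0 : ℝ)).indicator (1 : ℝ → ℝ) (T * (w - x)) = (Set.Iic x).indicator 1 w := by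
      have : T * (w - x) ≤ 0 ↔ w ≤ x := by
        rw [← sub_nonpos (a := w)]
        constructor
        · intro h; by_contra h'; push Not at h'; nlinarith [mul_pos hT h']
        · intro h; nlinarith
      simp [Set.indicator, this]
    rw [this]; ring
  have hi : Integrable ((Set.Iic x).indicator (1 : ℝ → ℝ)) (gaussianReal 0 1) :=
    (integrable_const (1 : ℝ)).indicator measurableSet_Iic
  have hGi : Integrable (fun w => majorantGap (T * (w - x))) := by
    have := (integrable_majorantGap.comp_mul_left' hT.ne').comp_sub_right x
    simpa using this
  have hGg : ∫ w, majorantGap (T * (w - x)) ∂(gaussianReal 0 1) ≤ √(π / 2) / T := by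
    rw [integral_gaussianReal_eq_integral_smul (by simp)]
    calc ∫ w, gaussianPDFReal 0 1 w • majorantGap (T * (w - x))
        ≤ ∫ w, (√(2 * π))⁻¹ * majorantGap (T * (w - x)) := by
          refine integral_mono_of_nonneg (Eventually.of_forall fun w => ?_) (hGi.const_mul _)
            (Eventually.of_forall fun w => ?_)
          · exact smul_nonneg (gaussianPDFReal_nonneg _ _ _) (majorantGap_nonneg _)
          · simp only [smul_eq_mul]
            refine mul_le_mul_of_nonneg_right ?_ (majorantGap_nonneg _)
            simp only [gaussianPDFReal, NNReal.coe_one, mul_one]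
            have : rexp (-(w - 0) ^ 2 / 2) ≤ 1 := by
              rw [exp_le_one_iff]; nlinarith [sq_nonneg (w - 0)]
            calc _ ≤ (√(2 * π))⁻¹ * 1 := by gcongr
              _ = _ := mul_one _
      _ = (√(2 * π))⁻¹ * (T⁻¹ * ∫ w, majorantGap w) := by
          rw [integral_const_mul, integral_sub_right_eq_self (fun w => majorantGap (T * w)),
            Measure.integral_comp_mul_left, abs_of_pos (by positivity), smul_eq_mul]
      _ ≤ (√(2 * π))⁻¹ * (T⁻¹ * π) := by
          gcongr
          exact integral_majorantGap_le
      _ = √(π / 2) / T := by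
          rw [show √(π / 2) = (√(2 * π))⁻¹ * π from ?_]
          · ring
          · rw [eq_comm, inv_mul_eq_div, div_eq_iff (by positivity), ← sqrt_mul (by positivity),
              show π / 2 * (2 * π) = π ^ 2 by ring, sqrt_sq hpi.le]
  simp_rw [hind]
  rw [integral_add hi, integral_indicator_one measurableSet_Iic]
  · linarith
  · have := hM.sub hi
    refine this.congr (Eventually.of_forall fun w => ?_)
    simp [hind w]

theorem smoothing (μ : Measure ℝ) [IsProbabilityMeasure μ] (hμ : Integrable (fun w => w) μ)
    {T : ℝ} (hT : 0 < T) {h : ℝ → ℝ} (hh : IntegrableOn h (Set.Ioo 0 1))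
    (hle : ∀ t ∈ Set.Ioo (0 : ℝ) 1,
      ‖prawitz t‖ * ‖charFun μ (T * t) - charFun (gaussianReal 0 1) (T * t)‖ ≤ h t) (x : ℝ) :
    μ.real (Set.Iic x) - (gaussianReal 0 1).real (Set.Iic x) ≤
      (∫ t in Set.Ioo (0 : ℝ) 1, h t) + √(π / 2) / T := by
  have hg : Integrable (fun w : ℝ => w) (gaussianReal 0 1) :=
    (memLp_id_gaussianReal 1).integrable (by simp)
  obtain ⟨a1, a2, a3⟩ := integral_majorant_eq μ hμ T x
  obtain ⟨b1, b2, b3⟩ := integral_majorant_eq _ hg T x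
  have h1 := integral_majorant_gaussian_le hT x
  have h2 : μ.real (Set.Iic x) ≤ ∫ w, majorant (T * (w - x)) ∂μ := by
    rw [← integral_indicator_one measurableSet_Iic]
    refine integral_mono_of_nonneg (Eventually.of_forall fun w => ?_) a2 (Eventually.of_forall fun w => ?_)
    · exact Set.indicator_nonneg (fun _ _ => zero_le_one) _
    · refine Set.indicator_le' (g := fun w => majorant (T * (w - x))) (fun w hw => ?_)
        (fun w _ => majorant_nonneg _) w
      exact one_le_majorant (mul_nonpos_of_nonneg_of_nonpos hT.le (sub_nonpos.2 hw))
  have h3 : (∫ t in Set.Ioo (0 : ℝ) 1,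
      (prawitz t * Complex.exp (((-(T * x * t) : ℝ) : ℂ) * Complex.I) * charFun μ (T * t)).re) -
      (∫ t in Set.Ioo (0 : ℝ) 1,
      (prawitz t * Complex.exp (((-(T * x * t) : ℝ) : ℂ) * Complex.I) *
        charFun (gaussianReal 0 1) (T * t)).re) ≤ ∫ t in Set.Ioo (0 : ℝ) 1, h t := by
    rw [← integral_sub a1 b1]
    refine setIntegral_mono_on (a1.sub b1) hh measurableSet_Ioo fun t ht => ?_
    refine le_trans ?_ (hle t ht)
    rw [← Complex.sub_re, ← mul_sub]
    refine (Complex.re_le_norm _).trans ?_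
    rw [norm_mul, norm_mul, Complex.norm_exp_ofReal_mul_I, mul_one]
  linarith

/-- `μ` is a centred law of unit variance which satisfies the Stein identity of an infinitely
divisible law without Gaussian part; `τ` is the normalized second-moment measure of its jumps. -/
structure IsSteinPair (μ τ : Measure ℝ) (L : ℝ) : Prop where
  isProb : IsProbabilityMeasure μ
  isProb_jump : IsProbabilityMeasure τ
  integrable_sq : Integrable (fun w => w ^ 2) μ
  integral_id : ∫ w, w ∂μ = 0
  integral_sq : ∫ w, w ^ 2 ∂μ = 1
  jump_ne_zero : ∀ᵐ y ∂τ, y ≠ 0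
  integrable_abs : Integrable (fun y => |y|) τ
  integral_abs : ∫ y, |y| ∂τ = L
  integrable_inv : Integrable (fun y => y⁻¹) τ
  stein : ∀ g : ℝ → ℝ, Measurable g → (∃ C, ∀ w, |g w| ≤ C) →
    ∫ w, w * g w ∂μ = ∫ y, ∫ w, (g (w + y) - g w) / y ∂μ ∂τ

lemma norm_exp_taylor_aux (x : ℝ) (hx : 0 ≤ x) :
    ‖Complex.exp (x * Complex.I) - 1 - x * Complex.I‖ ≤ x ^ 2 / 2 ∧
    ‖Complex.exp (x * Complex.I) - 1 - x * Complex.I + x ^ 2 / 2‖ ≤ x ^ 3 / 6 ∧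
    ‖Complex.exp (x * Complex.I) - 1 - x * Complex.I + x ^ 2 / 2 + x ^ 3 / 6 * Complex.I‖ ≤ x ^ 4 / 24 := by
  have hid : ∀ t : ℝ, HasDerivAt (fun t : ℝ => (t : ℂ)) 1 t := fun t => Complex.ofRealCLM.hasDerivAt
  have hexp : ∀ t : ℝ, HasDerivAt (fun t : ℝ => Complex.exp (t * Complex.I)) (Complex.exp (t * Complex.I) * Complex.I) t := by
    intro t
    simpa using ((hid t).mul_const Complex.I).cexp
  have key : ∀ (f f' : ℝ → ℂ) (B B' : ℝ → ℝ), (∀ t, HasDerivAt f (f' t) t) → (∀ t, HasDerivAt B (B' t) t) →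
      f 0 = 0 → B 0 = 0 → (∀ t, 0 ≤ t → ‖f' t‖ ≤ B' t) → ∀ t, 0 ≤ t → ‖f t‖ ≤ B t := by
    intro f f' B B' hf hB h0 hB0 hb t ht
    refine image_norm_le_of_norm_deriv_right_le_deriv_boundary (a := 0) (b := t) (f' := f')
      (fun s _ => (hf s).continuousAt.continuousWithinAt) (fun s _ => (hf s).hasDerivWithinAt)
      (by simp [h0, hB0]) hB (fun s hs => hb s hs.1) ⟨ht, le_rfl⟩
  have k0 : ∀ t : ℝ, 0 ≤ t → ‖Complex.exp (t * Complex.I) - 1‖ ≤ t :=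
    key _ (fun t => Complex.exp (t * Complex.I) * Complex.I) (fun t => t) (fun _ => 1)
      (fun t => (hexp t).sub_const 1) (fun t => hasDerivAt_id t) (by simp) rfl
      (fun t _ => by simp [Complex.norm_exp_ofReal_mul_I])
  have k1 : ∀ t : ℝ, 0 ≤ t → ‖Complex.exp (t * Complex.I) - 1 - t * Complex.I‖ ≤ t ^ 2 / 2 :=
    key _ (fun t => (Complex.exp (t * Complex.I) - 1) * Complex.I) (fun t => t ^ 2 / 2) (fun t => t)
      (fun t => by
        convert! ((hexp t).sub_const 1).sub ((hid t).mul_const Complex.I) using 1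
        ring)
      (fun t => by
        convert! ((hasDerivAt_id t).pow 2).div_const 2 using 1
        simp) (by simp) (by simp)
      (fun t ht => by simpa using k0 t ht)
  have k2 : ∀ t : ℝ, 0 ≤ t → ‖Complex.exp (t * Complex.I) - 1 - t * Complex.I + t ^ 2 / 2‖ ≤ t ^ 3 / 6 :=
    key _ (fun t => (Complex.exp (t * Complex.I) - 1 - t * Complex.I) * Complex.I) (fun t => t ^ 3 / 6)
      (fun t => t ^ 2 / 2)
      (fun t => by
        convert! (((hexp t).sub_const 1).sub ((hid t).mul_const Complex.I)).add
          (((hid t).pow 2).div_const 2) using 1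
        simp only [sub_mul, mul_assoc, Complex.I_mul_I]
        push_cast
        ring)
      (fun t => by
        convert! ((hasDerivAt_id t).pow 3).div_const 6 using 1
        simp; ring) (by simp) (by simp)
      (fun t ht => by simpa using k1 t ht)
  have k3 : ∀ t : ℝ, 0 ≤ t → ‖Complex.exp (t * Complex.I) - 1 - t * Complex.I + t ^ 2 / 2 +
      t ^ 3 / 6 * Complex.I‖ ≤ t ^ 4 / 24 :=
    key _ (fun t => (Complex.exp (t * Complex.I) - 1 - t * Complex.I + t ^ 2 / 2) * Complex.I) (fun t => t ^ 4 / 24)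
      (fun t => t ^ 3 / 6)
      (fun t => by
        convert! ((((hexp t).sub_const 1).sub ((hid t).mul_const Complex.I)).add
          (((hid t).pow 2).div_const 2)).add ((((hid t).pow 3).div_const 6).mul_const Complex.I) using 1
        simp only [sub_mul, add_mul, mul_assoc, Complex.I_mul_I]
        push_cast
        ring)
      (fun t => by
        convert! ((hasDerivAt_id t).pow 4).div_const 24 using 1
        simp; ring) (by simp) (by simp)
      (fun t ht => by simpa using k2 t ht)
  exact ⟨k1 x hx, k2 x hx, k3 x hx⟩

lemma norm_conj_aux (x : ℝ) : ‖Complex.exp ((-x : ℝ) * Complex.I) - 1 - (-x : ℝ) * Complex.I‖ =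
      ‖Complex.exp (x * Complex.I) - 1 - x * Complex.I‖ ∧
    ‖Complex.exp ((-x : ℝ) * Complex.I) - 1 - (-x : ℝ) * Complex.I + ((-x : ℝ) : ℂ) ^ 2 / 2‖ =
      ‖Complex.exp (x * Complex.I) - 1 - x * Complex.I + (x : ℂ) ^ 2 / 2‖ := by
  constructor
  · rw [← Complex.norm_conj]
    simp [← Complex.exp_conj, sub_eq_add_neg]
  · rw [← Complex.norm_conj]
    simp [← Complex.exp_conj, sub_eq_add_neg, Complex.conj_ofNat]

lemma norm_exp_sub_one_sub_le (x : ℝ) :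
    ‖Complex.exp (x * Complex.I) - 1 - x * Complex.I‖ ≤ x ^ 2 / 2 := by
  rcases le_total 0 x with h | h
  · exact (norm_exp_taylor_aux x h).1
  · have := (norm_exp_taylor_aux (-x) (by linarith)).1
    rw [(norm_conj_aux x).1] at this
    simpa using this

lemma norm_exp_sub_taylor_two_le (x : ℝ) :
    ‖Complex.exp (x * Complex.I) - 1 - x * Complex.I + (x : ℂ) ^ 2 / 2‖ ≤ |x| ^ 3 / 6 := by
  rcases le_total 0 x with h | h
  · rw [abs_of_nonneg h]; exact (norm_exp_taylor_aux x h).2.1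
  · have := (norm_exp_taylor_aux (-x) (by linarith)).2.1
    rw [(norm_conj_aux x).2] at this
    rwa [abs_of_nonpos h]

lemma cos_le_cubic (x : ℝ) : cos x ≤ 1 - x ^ 2 / 2 + |x| ^ 3 / 10 := by
  wlog hx : 0 ≤ x generalizing x
  · have := this (-x) (by linarith)
    simpa using this
  rw [abs_of_nonneg hx]
  rcases le_total x 2.4 with h | h
  · have h1 := (norm_exp_taylor_aux x hx).2.2
    have h2 := (Complex.re_le_norm _).trans h1
    have h3 : (Complex.exp (x * Complex.I) - 1 - x * Complex.I + x ^ 2 / 2 + x ^ 3 / 6 * Complex.I).re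
        = cos x - 1 + x ^ 2 / 2 := by
      rw [Complex.exp_mul_I, ← Complex.ofReal_cos, ← Complex.ofReal_sin]
      generalize cos x = a
      generalize sin x = b
      have e : (a + b * Complex.I - 1 - x * Complex.I + (x : ℂ) ^ 2 / 2 + (x : ℂ) ^ 3 / 6 * Complex.I) =
        ((a - 1 + x ^ 2 / 2 : ℝ) : ℂ) + ((b - x + x ^ 3 / 6 : ℝ) : ℂ) * Complex.I := by push_cast; ring
      rw [e, Complex.add_re, Complex.ofReal_re, Complex.re_ofReal_mul, Complex.I_re, mul_zero, add_zero]
    rw [h3] at h2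
    have : x ^ 4 / 24 ≤ x ^ 3 / 10 := by
      have : x ^ 4 = x ^ 3 * x := by ring
      have h4 : 0 ≤ x ^ 3 := by positivity
      nlinarith
    linarith
  · have h1 := one_sub_sq_div_two_le_cos (x := x - π)
    rw [cos_sub_pi] at h1
    have hl := pi_gt_d4
    have hu := pi_lt_d4
    have hq : 0 ≤ (π - 3.1415) * (3.1416 - π) := mul_nonneg (by linarith) (by linarith)
    have hm : 0 ≤ (π - 3.1415) * (x - 2.4) := mul_nonneg (by linarith) (by linarith)
    nlinarith [mul_nonneg hx (sq_nonneg (x - 4.13)), sq_nonneg (x - 4.13)]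

lemma norm_exp_sub_one_le_of_re_le {z : ℂ} {r : ℝ} (hr : 0 < r) (hz : z.re ≤ r) :
    ‖Complex.exp z - 1‖ ≤ ‖z‖ * ((exp r - 1) / r) := by
  have hid : ∀ t : ℝ, HasDerivAt (fun t : ℝ => (t : ℂ)) 1 t := fun t => Complex.ofRealCLM.hasDerivAt
  have hf : ∀ t : ℝ, HasDerivAt (fun t : ℝ => Complex.exp (t * z) - 1) (Complex.exp (t * z) * z) t := by
    intro t
    simpa using (((hid t).mul_const z).cexp).sub_const 1
  have hB : ∀ t : ℝ, HasDerivAt (fun t : ℝ => ‖z‖ * ((exp (t * r) - 1) / r)) (‖z‖ * exp (t * r)) t := by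
    intro t
    have := (((((hasDerivAt_id t).mul_const r).exp).sub_const 1).div_const r).const_mul ‖z‖
    convert! this using 1
    simp only [id]
    field_simp
  have := image_norm_le_of_norm_deriv_right_le_deriv_boundary (a := 0) (b := 1)
      (f := fun t : ℝ => Complex.exp (t * z) - 1)
      (fun s _ => (hf s).continuousAt.continuousWithinAt) (fun s _ => (hf s).hasDerivWithinAt)
      (by simp) hB (fun s hs => by
        rw [norm_mul, Complex.norm_exp, mul_comm]
        gcongr
        rw [Complex.re_ofReal_mul]
        exact mul_le_mul_of_nonneg_left hz hs.1) (x := 1) ⟨zero_le_one, le_rfl⟩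
  simpa using this

namespace IsSteinPair

variable {μ τ : Measure ℝ} {L : ℝ}

lemma memLp (h : IsSteinPair μ τ L) : MemLp id 2 μ :=
  (memLp_two_iff_integrable_sq (by fun_prop)).2 (by simpa using h.integrable_sq)

lemma integrable_id (h : IsSteinPair μ τ L) : Integrable (fun w => w) μ :=
  have := h.isProb
  h.memLp.integrable (by norm_num)

lemma L_pos (h : IsSteinPair μ τ L) : 0 < L := by
  have := h.isProb_jump
  rw [← h.integral_abs, integral_pos_iff_support_of_nonneg (fun _ => abs_nonneg _) h.integrable_abs]
  have h1 : Function.support (fun y : ℝ => |y|) = {y | y ≠ 0} := by ext; simp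
  rw [h1, pos_iff_ne_zero]
  intro h0
  have h2 : ∀ᵐ y ∂τ, ¬ y ≠ 0 := measure_eq_zero_iff_ae_notMem.1 h0
  obtain ⟨y, hy1, hy2⟩ := (h.jump_ne_zero.and h2).exists
  exact hy2 hy1

/-- Derivative of the characteristic exponent, up to a factor `I`. -/
noncomputable def expo' (τ : Measure ℝ) (t : ℝ) : ℂ :=
  ∫ y, (Complex.exp ((t * y : ℝ) * Complex.I) - 1) / y ∂τ

/-- The characteristic exponent. -/
noncomputable def expo (τ : Measure ℝ) (t : ℝ) : ℂ :=
  ∫ y, (Complex.exp ((t * y : ℝ) * Complex.I) - 1 - (t * y : ℝ) * Complex.I) / y ^ 2 ∂τ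

lemma norm_expo'_integrand_le (t y : ℝ) : ‖(Complex.exp ((t * y : ℝ) * Complex.I) - 1) / y‖ ≤ |t| := by
  rw [norm_div, Complex.norm_real, norm_eq_abs]
  refine div_le_of_le_mul₀ (abs_nonneg _) (abs_nonneg _) ?_
  have := norm_exp_I_mul_ofReal_sub_one_le (x := t * y)
  rwa [mul_comm, norm_eq_abs, abs_mul] at this

lemma norm_expo_integrand_le (t y : ℝ) :
    ‖(Complex.exp ((t * y : ℝ) * Complex.I) - 1 - (t * y : ℝ) * Complex.I) / y ^ 2‖ ≤ t ^ 2 / 2 := by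
  rw [norm_div, norm_pow, Complex.norm_real, norm_eq_abs, sq_abs]
  refine div_le_of_le_mul₀ (by positivity) (by positivity) ?_
  refine (norm_exp_sub_one_sub_le _).trans (le_of_eq (by ring))

lemma integrable_expo' [IsProbabilityMeasure τ] (t : ℝ) :
    Integrable (fun y : ℝ => (Complex.exp ((t * y : ℝ) * Complex.I) - 1) / y) τ :=
  Integrable.of_bound (Measurable.aestronglyMeasurable (by fun_prop)) |t|
    (Eventually.of_forall fun y => norm_expo'_integrand_le t y)

lemma integrable_expo [IsProbabilityMeasure τ] (t : ℝ) :
    Integrable (fun y : ℝ => (Complex.exp ((t * y : ℝ) * Complex.I) - 1 - (t * y : ℝ) * Complex.I) / y ^ 2) τ :=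
  Integrable.of_bound (Measurable.aestronglyMeasurable (by fun_prop)) (t ^ 2 / 2)
    (Eventually.of_forall fun y => norm_expo_integrand_le t y)

lemma hasDerivAt_expo [IsProbabilityMeasure τ] (t : ℝ) :
    HasDerivAt (expo τ) (Complex.I * expo' τ t) t := by
  have := (hasDerivAt_integral_of_dominated_loc_of_deriv_le (μ := τ)
    (F := fun t y => (Complex.exp ((t * y : ℝ) * Complex.I) - 1 - (t * y : ℝ) * Complex.I) / (y : ℂ) ^ 2)
    (F' := fun t y => Complex.I * ((Complex.exp ((t * y : ℝ) * Complex.I) - 1) / y)) (x₀ := t)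
    (bound := fun _ => |t| + 1) (Metric.ball_mem_nhds t one_pos)
    (Eventually.of_forall fun s => (integrable_expo s).aestronglyMeasurable)
    (integrable_expo t) ((integrable_expo' t).const_mul _).aestronglyMeasurable
    (Eventually.of_forall fun y s hs => ?_) (integrable_const _)
    (Eventually.of_forall fun y s hs => ?_)).2
  · rw [integral_const_mul] at this
    exact this
  · rw [norm_mul, Complex.norm_I, one_mul]
    refine (norm_expo'_integrand_le s y).trans ?_
    have h1 : |s - t| < 1 := hs
    have h2 := abs_sub_abs_le_abs_sub s t
    linarith
  · have h1 : HasDerivAt (fun s : ℝ => ((s * y : ℝ) : ℂ) * Complex.I) (y * Complex.I) s := by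
      have : HasDerivAt (fun s : ℝ => ((s * y : ℝ) : ℂ)) y s := by
        have := ((hasDerivAt_id s).mul_const y).ofReal_comp
        simpa using this
      exact this.mul_const _
    have h2 := (((h1.cexp).sub_const 1).sub h1).div_const ((y : ℂ) ^ 2)
    convert! h2 using 1
    by_cases hy : y = 0
    · simp [hy]
    · have : (y : ℂ) ≠ 0 := by exact_mod_cast hy
      field_simp

lemma integrable_expMul (μ : Measure ℝ) [IsProbabilityMeasure μ] (t : ℝ) :
    Integrable (fun w : ℝ => Complex.exp (t * w * Complex.I)) μ := by
  refine Integrable.of_bound (C := 1) (by fun_prop) (Eventually.of_forall fun w => ?_)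
  rw [← Complex.ofReal_mul, Complex.norm_exp_ofReal_mul_I]

lemma integral_mul_exp (h : IsSteinPair μ τ L) (t : ℝ) :
    ∫ w : ℝ, (w : ℂ) * Complex.exp (t * w * Complex.I) ∂μ = expo' τ t * charFun μ t := by
  have := h.isProb
  have := h.isProb_jump
  have hprod : Integrable (fun y : ℝ => (Complex.exp ((t * y : ℝ) * Complex.I) - 1) / y * charFun μ t) τ :=
    (integrable_expo' t).mul_const _
  have hwexp : Integrable (fun w : ℝ => (w : ℂ) * Complex.exp (t * w * Complex.I)) μ := by
    refine (h.integrable_id.norm).mono' (by fun_prop) (Eventually.of_forall fun w => ?_)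
    rw [norm_mul, ← Complex.ofReal_mul, Complex.norm_exp_ofReal_mul_I, mul_one, Complex.norm_real]
  have hy : ∀ y : ℝ, (Complex.exp ((t * y : ℝ) * Complex.I) - 1) / y * charFun μ t =
      ∫ w : ℝ, (Complex.exp (((t * (w + y) : ℝ) : ℂ) * Complex.I) - Complex.exp (((t * w : ℝ) : ℂ) * Complex.I)) / y ∂μ := by
    intro y
    rw [charFun_apply_real, ← integral_const_mul]
    congr 1; ext w
    rw [show ((t * (w + y) : ℝ) : ℂ) * Complex.I = (t * y : ℝ) * Complex.I + t * w * Complex.I by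
      push_cast; ring, Complex.exp_add]
    push_cast
    ring
  have hyi : ∀ y : ℝ, Integrable (fun w : ℝ => (Complex.exp (((t * (w + y) : ℝ) : ℂ) * Complex.I) - Complex.exp (((t * w : ℝ) : ℂ) * Complex.I)) / y) μ := by
    intro y
    have := (integrable_expMul μ t).const_mul ((Complex.exp ((t * y : ℝ) * Complex.I) - 1) / y)
    refine this.congr (Eventually.of_forall fun w => ?_)
    simp only
    rw [show ((t * (w + y) : ℝ) : ℂ) * Complex.I = (t * y : ℝ) * Complex.I + t * w * Complex.I by
      push_cast; ring, Complex.exp_add]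
    push_cast
    ring
  have hre : ∀ a b : ℝ, ∀ y : ℝ, ((Complex.exp ((a : ℂ) * Complex.I) - Complex.exp ((b : ℂ) * Complex.I)) / y).re
      = (cos a - cos b) / y := by
    intro a b y
    rw [Complex.div_ofReal_re, Complex.sub_re, Complex.exp_ofReal_mul_I_re, Complex.exp_ofReal_mul_I_re]
  have him : ∀ a b : ℝ, ∀ y : ℝ, ((Complex.exp ((a : ℂ) * Complex.I) - Complex.exp ((b : ℂ) * Complex.I)) / y).im
      = (sin a - sin b) / y := by
    intro a b y
    rw [Complex.div_ofReal_im, Complex.sub_im, Complex.exp_ofReal_mul_I_im, Complex.exp_ofReal_mul_I_im]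
  rw [expo', ← integral_mul_const]
  apply Complex.ext
  · have e1 := integral_re hwexp
    have e2 := integral_re hprod
    simp only [RCLike.re_to_complex] at e1 e2
    rw [← e1, ← e2]
    have e3 : ∀ w : ℝ, ((w : ℂ) * Complex.exp (t * w * Complex.I)).re = w * cos (t * w) := by
      intro w
      rw [Complex.re_ofReal_mul, ← Complex.ofReal_mul, Complex.exp_ofReal_mul_I_re]
    simp_rw [e3, hy]
    rw [h.stein (fun w => cos (t * w)) (by fun_prop) ⟨1, fun w => abs_cos_le_one _⟩]
    congr 1; ext y
    have := integral_re (hyi y)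
    simp only [RCLike.re_to_complex] at this
    rw [← this]
    simp_rw [hre]
  · have e1 := integral_im hwexp
    have e2 := integral_im hprod
    simp only [RCLike.im_to_complex] at e1 e2
    rw [← e1, ← e2]
    have e3 : ∀ w : ℝ, ((w : ℂ) * Complex.exp (t * w * Complex.I)).im = w * sin (t * w) := by
      intro w
      rw [Complex.im_ofReal_mul, ← Complex.ofReal_mul, Complex.exp_ofReal_mul_I_im]
    simp_rw [e3, hy]
    rw [h.stein (fun w => sin (t * w)) (by fun_prop) ⟨1, fun w => abs_sin_le_one _⟩]
    congr 1; ext y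
    have := integral_im (hyi y)
    simp only [RCLike.im_to_complex] at this
    rw [← this]
    simp_rw [him]

lemma hasDerivAt_charFun (h : IsSteinPair μ τ L) (t : ℝ) :
    HasDerivAt (charFun μ) (Complex.I * expo' τ t * charFun μ t) t := by
  have := h.isProb
  have hm : MemLp id ((1 : ℕ) : ENNReal) μ := h.memLp.mono_exponent (by norm_num)
  have h1 := iteratedDeriv_charFun (t := t) hm
  have h2 : DifferentiableAt ℝ (charFun μ) t := by
    have := contDiff_charFun hm
    exact this.differentiable (by norm_num) t
  rw [iteratedDeriv_one] at h1
  simp only [pow_one] at h1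
  rw [h.integral_mul_exp] at h1
  rw [mul_assoc, ← h1]
  exact h2.hasDerivAt

lemma charFun_eq (h : IsSteinPair μ τ L) (t : ℝ) : charFun μ t = Complex.exp (expo τ t) := by
  have := h.isProb
  have := h.isProb_jump
  have hd : ∀ s, HasDerivAt (fun s => charFun μ s * Complex.exp (-expo τ s)) 0 s := by
    intro s
    have := (h.hasDerivAt_charFun s).mul ((hasDerivAt_expo (τ := τ) s).neg.cexp)
    convert! this using 1
    ring
  have hc := is_const_of_deriv_eq_zero (fun s => (hd s).differentiableAt) (fun s => (hd s).deriv) t 0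
  have h0 : expo τ 0 = 0 := by simp [expo]
  simp only [h0, neg_zero, Complex.exp_zero, mul_one, charFun_zero, probReal_univ, Complex.ofReal_one] at hc
  rw [Complex.exp_neg] at hc
  have hne := Complex.exp_ne_zero (expo τ t)
  field_simp at hc
  exact hc

lemma expo_add_half_sq (h : IsSteinPair μ τ L) (t : ℝ) :
    ‖expo τ t + t ^ 2 / 2‖ ≤ L * |t| ^ 3 / 6 ∧ (expo τ t + t ^ 2 / 2).re ≤ L * |t| ^ 3 / 10 := by
  have := h.isProb_jump
  have e : expo τ t + t ^ 2 / 2 = ∫ y : ℝ, ((Complex.exp ((t * y : ℝ) * Complex.I) - 1 - (t * y : ℝ) * Complex.I) / y ^ 2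
      + (t : ℂ) ^ 2 / 2) ∂τ := by
    rw [integral_add (integrable_expo t) (integrable_const _)]
    simp [expo]
  have hi := (integrable_expo (τ := τ) t).add (integrable_const ((t : ℂ) ^ 2 / 2))
  have hb : ∀ c : ℝ, ∫ y, |t| ^ 3 * |y| / c ∂τ = L * |t| ^ 3 / c := by
    intro c
    rw [integral_div, integral_const_mul, h.integral_abs, mul_comm]
  have hbi : ∀ c : ℝ, Integrable (fun y => |t| ^ 3 * |y| / c) τ :=
    fun c => (h.integrable_abs.const_mul _).div_const c
  have hform : ∀ y : ℝ, y ≠ 0 → (Complex.exp ((t * y : ℝ) * Complex.I) - 1 - (t * y : ℝ) * Complex.I) / (y : ℂ) ^ 2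
      + (t : ℂ) ^ 2 / 2 = (Complex.exp ((t * y : ℝ) * Complex.I) - 1 - (t * y : ℝ) * Complex.I + ((t * y : ℝ) : ℂ) ^ 2 / 2) / ((y ^ 2 : ℝ) : ℂ) := by
    intro y hy
    have : (y : ℂ) ≠ 0 := by exact_mod_cast hy
    push_cast
    field_simp
  rw [e]
  constructor
  · rw [← hb 6]
    refine norm_integral_le_of_norm_le (hbi 6) ?_
    filter_upwards [h.jump_ne_zero] with y hy
    rw [hform y hy, norm_div, Complex.norm_real, norm_of_nonneg (sq_nonneg y),
      div_le_iff₀ (by positivity)]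
    refine (norm_exp_sub_taylor_two_le _).trans (le_of_eq ?_)
    rw [abs_mul, mul_pow, ← sq_abs y]; ring
  · have e1 := integral_re hi
    simp only [RCLike.re_to_complex, Pi.add_apply] at e1
    rw [← e1, ← hb 10]
    refine integral_mono_ae hi.re (hbi 10) ?_
    filter_upwards [h.jump_ne_zero] with y hy
    rw [hform y hy, Complex.div_ofReal_re, div_le_iff₀ (by positivity)]
    have e2 : (Complex.exp ((t * y : ℝ) * Complex.I) - 1 - (t * y : ℝ) * Complex.I + ((t * y : ℝ) : ℂ) ^ 2 / 2).re
        = cos (t * y) - 1 + (t * y) ^ 2 / 2 := by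
      generalize t * y = s
      rw [Complex.add_re, Complex.sub_re, Complex.sub_re, Complex.exp_ofReal_mul_I_re]
      have : ((s : ℂ) ^ 2 / 2).re = s ^ 2 / 2 := by
        rw [show (s : ℂ) ^ 2 / 2 = ((s ^ 2 / 2 : ℝ) : ℂ) by push_cast; ring, Complex.ofReal_re]
      rw [this]; simp
    rw [e2]
    have h3 := cos_le_cubic (t * y)
    have h4 : |t * y| ^ 3 / 10 = |t| ^ 3 * |y| / 10 * y ^ 2 := by
      rw [abs_mul, mul_pow, ← sq_abs y]; ring
    linarith

lemma norm_charFun_sub_le (h : IsSteinPair μ τ L) {t : ℝ} (ht : 0 < t) :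
    ‖charFun μ t - charFun (gaussianReal 0 1) t‖ ≤
      5 / 3 * exp (-t ^ 2 / 2) * (exp (L * t ^ 3 / 10) - 1) := by
  have hL := h.L_pos
  obtain ⟨h1, h2⟩ := h.expo_add_half_sq t
  rw [abs_of_pos ht] at h1 h2
  have hr : 0 < L * t ^ 3 / 10 := by positivity
  have h3 := norm_exp_sub_one_le_of_re_le hr h2
  have e : charFun μ t - charFun (gaussianReal 0 1) t =
      ((exp (-t ^ 2 / 2) : ℝ) : ℂ) * (Complex.exp (expo τ t + t ^ 2 / 2) - 1) := by
    rw [h.charFun_eq, charFun_gaussianReal, mul_sub, mul_one, Complex.ofReal_exp, ← Complex.exp_add]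
    congr 2
    · push_cast; ring
    · push_cast; ring
  rw [e, norm_mul, Complex.norm_real, norm_of_nonneg (exp_pos _).le]
  have h4 : 0 ≤ (exp (L * t ^ 3 / 10) - 1) / (L * t ^ 3 / 10) :=
    div_nonneg (by linarith [add_one_le_exp (L * t ^ 3 / 10)]) hr.le
  calc exp (-t ^ 2 / 2) * ‖Complex.exp (expo τ t + t ^ 2 / 2) - 1‖
      ≤ exp (-t ^ 2 / 2) * (L * t ^ 3 / 6 * ((exp (L * t ^ 3 / 10) - 1) / (L * t ^ 3 / 10))) := by
        refine mul_le_mul_of_nonneg_left (h3.trans ?_) (exp_pos _).le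
        exact mul_le_mul_of_nonneg_right h1 h4
    _ = _ := by field_simp; ring

end IsSteinPair

lemma mul_cos_le {x : ℝ} (hx : 0 ≤ x) (hx' : x ≤ π) : 3 * (x * cos x) ≤ (3 - x ^ 2) * sin x := by
  have hd : ∀ y : ℝ, HasDerivAt (fun y => (3 - y ^ 2) * sin y - 3 * (y * cos y))
      (y * (sin y - y * cos y)) y := by
    intro y
    have := (((hasDerivAt_id y).pow 2).const_sub 3).mul (hasDerivAt_sin y)
      |>.sub (((hasDerivAt_id y).mul (hasDerivAt_cos y)).const_mul 3)
    convert! this using 1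
    simp only [id, Pi.pow_apply]
    push_cast
    ring
  have hd2 : ∀ y : ℝ, HasDerivAt (fun y => sin y - y * cos y) (y * sin y) y := by
    intro y
    have := (hasDerivAt_sin y).sub ((hasDerivAt_id y).mul (hasDerivAt_cos y))
    convert! this using 1
    simp only [id]; ring
  have m2 : MonotoneOn (fun y => sin y - y * cos y) (Set.Icc 0 π) := by
    refine monotoneOn_of_deriv_nonneg (convex_Icc _ _)
      (fun y _ => (hd2 y).continuousAt.continuousWithinAt)
      (fun y _ => (hd2 y).differentiableAt.differentiableWithinAt) fun y hy => ?_
    rw [interior_Icc] at hy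
    rw [(hd2 y).deriv]
    exact mul_nonneg hy.1.le (sin_nonneg_of_nonneg_of_le_pi hy.1.le hy.2.le)
  have m1 : MonotoneOn (fun y => (3 - y ^ 2) * sin y - 3 * (y * cos y)) (Set.Icc 0 π) := by
    refine monotoneOn_of_deriv_nonneg (convex_Icc _ _)
      (fun y _ => (hd y).continuousAt.continuousWithinAt)
      (fun y _ => (hd y).differentiableAt.differentiableWithinAt) fun y hy => ?_
    rw [interior_Icc] at hy
    rw [(hd y).deriv]
    have := m2 ⟨le_rfl, pi_pos.le⟩ ⟨hy.1.le, hy.2.le⟩ hy.1.le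
    simp only [sin_zero, zero_mul, sub_zero] at this
    exact mul_nonneg hy.1.le this
  have := m1 ⟨le_rfl, pi_pos.le⟩ ⟨hx, hx'⟩ hx
  simp only [sin_zero, zero_mul, sub_zero, mul_zero] at this
  linarith

lemma norm_prawitz_le {t : ℝ} (ht : t ∈ Set.Ioo (0 : ℝ) 1) : ‖prawitz t‖ ≤ 1.05 / (π * t) := by
  obtain ⟨h0, h1⟩ := ht
  have hπ := pi_pos
  have hs := sin_pi_mul_pos ⟨h0, h1⟩
  have hx : 0 ≤ π * t := by positivity
  have hb := mul_cos_le hx (by nlinarith)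
  have hlow : π * (1 - t) * cos (π * t) + sin (π * t) ≥ 0 := by
    have h2 := mul_cos_le (x := π * (1 - t)) (by nlinarith) (by nlinarith)
    have e1 : cos (π * (1 - t)) = - cos (π * t) := by
      rw [show π * (1 - t) = π - π * t by ring, cos_pi_sub]
    have e2 : sin (π * (1 - t)) = sin (π * t) := by
      rw [show π * (1 - t) = π - π * t by ring, sin_pi_sub]
    rw [e1, e2] at h2
    nlinarith [mul_nonneg (sq_nonneg (π * (1 - t))) hs.le]
  have hk : π * t * prawitzIm t = ((1 - t) * (π * t * cos (π * t)) + t * sin (π * t)) / sin (π * t) := by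
    unfold prawitzIm
    generalize sin (π * t) = s at *
    field_simp
  have hk2 : π * prawitzIm t = (π * (1 - t) * cos (π * t) + sin (π * t)) / sin (π * t) := by
    unfold prawitzIm
    generalize sin (π * t) = s at *
    field_simp
  have hk0 : 0 ≤ π * t * prawitzIm t := by
    rw [show π * t * prawitzIm t = t * (π * prawitzIm t) by ring, hk2]
    exact mul_nonneg h0.le (div_nonneg hlow hs.le)
  have hk1 : π * t * prawitzIm t ≤ 1 - π ^ 2 * t ^ 2 * (1 - t) / 3 := by
    rw [hk, div_le_iff₀ hs]
    generalize sin (π * t) = s at *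
    generalize cos (π * t) = c at *
    nlinarith [mul_le_mul_of_nonneg_left hb (show 0 ≤ 1 - t by linarith)]
  rw [le_div_iff₀ (by positivity)]
  refine (sq_le_sq₀ (by positivity) (by norm_num)).1 ?_
  rw [mul_pow, Complex.sq_norm, Complex.normSq_apply]
  simp only [prawitz]
  generalize prawitzIm t = k at *
  have e : ((1 - t) * (1 - t) + k * k) * (π * t) ^ 2 = π ^ 2 * t ^ 2 * (1 - t) ^ 2 + (π * t * k) ^ 2 := by ring
  have hsq : (π * t * k) ^ 2 ≤ (1 - π ^ 2 * t ^ 2 * (1 - t) / 3) ^ 2 := by gcongr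
  have hp : π ^ 2 ≤ 9.87 := by nlinarith [pi_lt_d4]
  have hp0 : 0 ≤ π ^ 2 := by positivity
  rw [e]
  generalize π ^ 2 = p at *
  have hts : t * (1 - t) ≤ 1 / 4 := by nlinarith [sq_nonneg (t - 1 / 2)]
  have ht0 : 0 ≤ t * (1 - t) := mul_nonneg h0.le (by linarith)
  have h5 : 1 / 3 - t + p * t ^ 2 * (1 - t) / 9 ≤ 1 / 3 - 0.725 * t := by
    have : p * (t * (1 - t)) ≤ 9.87 * (1 / 4) := by gcongr
    nlinarith
  have h6 : p * t ^ 2 * (1 - t) * (1 / 3 - 0.725 * t) ≤ 0.1025 := by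
    have h7 : t * (1 / 3 - 0.725 * t) ≤ 0.0384 := by nlinarith [sq_nonneg (t - 0.23)]
    have h8 : p * (t * (1 - t)) ≤ 9.87 * (1 / 4) := by gcongr
    have h9 : 0 ≤ p * (t * (1 - t)) := by positivity
    nlinarith
  have h10 : 0 ≤ p * t ^ 2 * (1 - t) := mul_nonneg (by positivity) (by linarith)
  nlinarith [mul_le_mul_of_nonneg_left h5 h10]

lemma exp_mul_sub_one_le {t X : ℝ} (h0 : 0 ≤ t) (h1 : t ≤ 1) (hX : 0 ≤ X) :
    exp (t * X) - 1 ≤ t * X * (1 - t) + t ^ 2 * (exp X - 1) := by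
  have hd : ∀ y : ℝ, HasDerivAt (fun y => t * y * (1 - t) + t ^ 2 * (exp y - 1) - (exp (t * y) - 1))
      (t * ((1 - t) + t * exp y - exp (t * y))) y := by
    intro y
    have := ((((hasDerivAt_id y).const_mul t).mul_const (1 - t)).add
      (((hasDerivAt_exp y).sub_const 1).const_mul (t ^ 2))).sub
      ((((hasDerivAt_id y).const_mul t).exp).sub_const 1)
    convert! this using 1
    simp only [id]; ring
  have m1 : Monotone (fun y => t * y * (1 - t) + t ^ 2 * (exp y - 1) - (exp (t * y) - 1)) := by
    refine monotone_of_deriv_nonneg (fun y => (hd y).differentiableAt) fun y => ?_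
    rw [(hd y).deriv]
    have := convexOn_exp.2 (Set.mem_univ 0) (Set.mem_univ y) (show 0 ≤ 1 - t by linarith) h0 (by ring)
    simp only [smul_eq_mul, mul_zero, zero_add, exp_zero, mul_one] at this
    exact mul_nonneg h0 (by linarith)
  have := m1 hX
  simp only [mul_zero, exp_zero, sub_self, zero_mul, add_zero] at this
  linarith

lemma sqrt_pi_div_two_le : √(π / 2) ≤ 1.25332 := by
  rw [sqrt_le_left (by norm_num)]
  have := pi_lt_d6
  norm_num at this ⊢
  linarith

/-- An antiderivative which occurs in the smoothing bound. -/
noncomputable def smoothingPrim (T t : ℝ) : ℝ :=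
  -0.4 * (t * exp (-T ^ 2 * t ^ 2 / 2)) + 0.4 * ((t ^ 2 + 2 / T ^ 2) * exp (-T ^ 2 * t ^ 2 / 2))
    - 5 / T ^ 2 * exp (-T ^ 2 * t ^ 2 / 10) + 1 / T ^ 2 * exp (-T ^ 2 * t ^ 2 / 2)

/-- The derivative of `smoothingPrim`. -/
noncomputable def smoothingDeriv (T t : ℝ) : ℝ :=
  0.4 * T ^ 2 * t ^ 2 * (1 - t) * exp (-T ^ 2 * t ^ 2 / 2)
    + t * (exp (-T ^ 2 * t ^ 2 / 10) - exp (-T ^ 2 * t ^ 2 / 2)) - 0.4 * exp (-T ^ 2 * t ^ 2 / 2)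

lemma hasDerivAt_smoothingPrim {T : ℝ} (hT : 0 < T) (t : ℝ) :
    HasDerivAt (smoothingPrim T) (smoothingDeriv T t) t := by
  have he : ∀ c : ℝ, HasDerivAt (fun t : ℝ => exp (-T ^ 2 * t ^ 2 / c))
      (exp (-T ^ 2 * t ^ 2 / c) * (-T ^ 2 * (2 * t) / c)) t := by
    intro c
    have := ((((hasDerivAt_id t).pow 2).const_mul (-T ^ 2)).div_const c).exp
    convert! this using 1
    simp
  have := (((((hasDerivAt_id t).mul (he 2)).const_mul (-0.4)).add
    (((((hasDerivAt_id t).pow 2).add_const (2 / T ^ 2)).mul (he 2)).const_mul 0.4)).sub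
    ((he 10).const_mul (5 / T ^ 2))).add ((he 2).const_mul (1 / T ^ 2))
  convert! this using 1
  simp only [smoothingDeriv, id, Pi.pow_apply]
  generalize exp (-T ^ 2 * t ^ 2 / 2) = a
  generalize exp (-T ^ 2 * t ^ 2 / 10) = b
  field_simp
  ring

lemma integral_smoothingDeriv {T : ℝ} (hT : 0 < T) :
    ∫ t in Set.Ioo 0 1, smoothingDeriv T t =
      (3.2 + 1.8 * exp (-T ^ 2 / 2) - 5 * exp (-T ^ 2 / 10)) / T ^ 2 := by
  rw [← integral_Ioc_eq_integral_Ioo, ← intervalIntegral.integral_of_le zero_le_one,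
    intervalIntegral.integral_eq_sub_of_hasDerivAt (fun t _ => hasDerivAt_smoothingPrim hT t)
      (Continuous.intervalIntegrable (by unfold smoothingDeriv; fun_prop) _ _)]
  simp only [smoothingPrim]
  norm_num
  generalize exp (-T ^ 2 / 2) = a
  generalize exp (-T ^ 2 / 10) = b
  field_simp
  ring

lemma exp_neg_bound {T : ℝ} (hT : 3.5 ≤ T) :
    3.2 + 1.8 * exp (-T ^ 2 / 2) - 5 * exp (-T ^ 2 / 10) ≤ 0.684 * T := by
  have h1 : 1.8 * exp (-T ^ 2 / 2) ≤ exp (-T ^ 2 / 10) := by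
    rw [show -T ^ 2 / 10 = 4 * T ^ 2 / 10 + -T ^ 2 / 2 by ring, exp_add]
    gcongr
    have := add_one_le_exp (4 * T ^ 2 / 10)
    nlinarith
  have h0 := exp_pos (-T ^ 2 / 10)
  rcases le_total 4.71 T with h | h
  · linarith
  have h2 : exp (-2) * (3 - T ^ 2 / 10) ≤ exp (-T ^ 2 / 10) := by
    rw [show -T ^ 2 / 10 = -2 + (2 - T ^ 2 / 10) by ring, exp_add]
    gcongr
    linarith [add_one_le_exp (2 - T ^ 2 / 10)]
  have h3 : (0.135 : ℝ) ≤ exp (-2) := by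
    have h5 : (0.3678 : ℝ) ≤ exp (-1) := by linarith [exp_neg_one_gt_d9]
    rw [show (-2 : ℝ) = -1 + -1 by norm_num, exp_add]
    nlinarith
  have h4 : 0 ≤ 3 - T ^ 2 / 10 := by nlinarith
  nlinarith [mul_le_mul_of_nonneg_right h3 h4]

lemma gaussianReal_real_Iic (x : ℝ) : (gaussianReal 0 1).real (Set.Iic x) =
    (∫ t in Set.Iic x, exp (-t ^ 2 / 2)) / √(2 * π) := by
  rw [measureReal_def, gaussianReal_apply_eq_integral _ (by norm_num), ENNReal.toReal_ofReal
    (integral_nonneg fun _ => gaussianPDFReal_nonneg _ _ _)]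
  simp only [gaussianPDFReal]
  rw [integral_const_mul, inv_mul_eq_div]
  simp

lemma gaussianReal_real_Iic_neg (x : ℝ) : (gaussianReal 0 1).real (Set.Iic (-x)) =
    1 - (gaussianReal 0 1).real (Set.Iic x) := by
  have h1 : (gaussianReal 0 1).real (Set.Iic (-x)) = (gaussianReal 0 1).real (Set.Ici x) := by
    conv_lhs => rw [show (gaussianReal 0 1) = (gaussianReal 0 1).map (fun y => -y) by
      rw [gaussianReal_map_neg, neg_zero]]
    rw [map_measureReal_apply measurable_neg measurableSet_Iic]
    congr 1; ext y; simp
  have h2 : (gaussianReal 0 1).real (Set.Ici x) = (gaussianReal 0 1).real (Set.Ioi x) := by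
    have := nullSingletonClass_gaussianReal (μ := 0) (v := 1) (by norm_num)
    exact measureReal_congr Ioi_ae_eq_Ici.symm
  rw [h1, h2, ← Set.compl_Iic, probReal_compl_eq_one_sub measurableSet_Iic]

lemma gaussianReal_real_Iic_zero : (gaussianReal 0 1).real (Set.Iic 0) = 1 / 2 := by
  have := gaussianReal_real_Iic_neg 0
  rw [neg_zero] at this
  linarith

lemma gaussianReal_real_Iic_ge {x : ℝ} (hx : x ≤ 0) :
    1 / 2 + 0.399 * x ≤ (gaussianReal 0 1).real (Set.Iic x) := by
  have h1 : (gaussianReal 0 1).real (Set.Ioc x 0) ≤ 0.399 * (-x) := by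
    rw [measureReal_def, gaussianReal_apply_eq_integral _ (by norm_num), ENNReal.toReal_ofReal
      (integral_nonneg fun _ => gaussianPDFReal_nonneg _ _ _)]
    have : ∫ t in Set.Ioc x 0, gaussianPDFReal 0 1 t ≤ ∫ t in Set.Ioc x 0, 0.399 := by
      refine integral_mono (integrable_gaussianPDFReal 0 1).integrableOn (by simp) fun t => ?_
      simp only [gaussianPDFReal]
      have h2 : exp (-(t - 0) ^ 2 / (2 * (1 : NNReal))) ≤ 1 := by
        rw [exp_le_one_iff]
        apply div_nonpos_of_nonpos_of_nonneg
        · nlinarith [sq_nonneg (t - 0)]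
        · norm_num
      have h3 : (√(2 * π * (1 : NNReal)))⁻¹ ≤ 0.399 := by
        apply inv_le_of_inv_le₀ (by norm_num)
        apply le_sqrt_of_sq_le
        have := pi_gt_d4
        norm_num at this ⊢
        linarith
      calc _ ≤ 0.399 * 1 := mul_le_mul h3 h2 (exp_pos _).le (by norm_num)
        _ = _ := by ring
    refine this.trans ?_
    simp [hx]
    linarith
  have h2 : (gaussianReal 0 1).real (Set.Iic 0) = (gaussianReal 0 1).real (Set.Iic x) +
      (gaussianReal 0 1).real (Set.Ioc x 0) := by
    rw [← measureReal_union (s₁ := Set.Iic x) (Set.disjoint_left.2 fun y h h' => not_lt.2 h h'.1) measurableSet_Ioc,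
      Set.Iic_union_Ioc_eq_Iic hx]
  rw [gaussianReal_real_Iic_zero] at h2
  linarith

namespace IsSteinPair

variable {μ τ : Measure ℝ} {L : ℝ}

lemma real_Iic_le (h : IsSteinPair μ τ L) {x : ℝ} (hx : x ≤ 0) :
    μ.real (Set.Iic x) ≤ 1 / (1 + x ^ 2) := by
  have := h.isProb
  have hi : Integrable (fun w => ((1 + x * w) / (1 + x ^ 2)) ^ 2) μ := by
    have := (((integrable_const 1).add (h.integrable_id.const_mul (2 * x))).add
      (h.integrable_sq.const_mul (x ^ 2))).div_const ((1 + x ^ 2) ^ 2)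
    refine this.congr (Eventually.of_forall fun w => ?_)
    simp only [Pi.add_apply, div_pow]
    congr 1
    ring
  have e : ∫ w, ((1 + x * w) / (1 + x ^ 2)) ^ 2 ∂μ = 1 / (1 + x ^ 2) := by
    have e1 : ∀ w : ℝ, ((1 + x * w) / (1 + x ^ 2)) ^ 2 = (1 + 2 * x * w + x ^ 2 * w ^ 2) / (1 + x ^ 2) ^ 2 := by
      intro w; rw [div_pow]; congr 1; ring
    simp_rw [e1]
    have hi2 : Integrable (fun w => 1 + 2 * x * w) μ :=
      (integrable_const 1).add (h.integrable_id.const_mul (2 * x))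
    rw [integral_div, integral_add hi2
      (h.integrable_sq.const_mul (x ^ 2)), integral_add (integrable_const 1) (h.integrable_id.const_mul (2 * x)),
      integral_const_mul, integral_const_mul, h.integral_id, h.integral_sq]
    simp
    field_simp
  rw [← e, ← integral_indicator_one measurableSet_Iic]
  refine integral_mono ((integrable_const 1).indicator measurableSet_Iic) hi fun w => ?_
  by_cases hw : w ≤ x
  · rw [Set.indicator_of_mem (by exact hw)]
    have : 1 ≤ (1 + x * w) / (1 + x ^ 2) := by
      rw [le_div_iff₀ (by positivity)]
      nlinarith
    simp only [Pi.one_apply]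
    nlinarith
  · rw [Set.indicator_of_notMem (by exact hw)]
    positivity

lemma real_Iic_sub_le (h : IsSteinPair μ τ L) (x : ℝ) :
    μ.real (Set.Iic x) - (gaussianReal 0 1).real (Set.Iic x) ≤ 0.4785 * L := by
  have := h.isProb
  have hL := h.L_pos
  have hπ := pi_pos
  rcases le_total (4 / 3.5) L with hL' | hL'
  · have hb : (0.546 : ℝ) ≤ 0.4785 * L := by norm_num at hL' ⊢; linarith
    rcases le_total 0 x with hx | hx
    · have h1 : μ.real (Set.Iic x) ≤ 1 := measureReal_le_one
      have h2 : (gaussianReal 0 1).real (Set.Iic 0) ≤ (gaussianReal 0 1).real (Set.Iic x) :=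
        measureReal_mono (Set.Iic_subset_Iic.2 hx)
      rw [gaussianReal_real_Iic_zero] at h2
      linarith
    · have h1 := h.real_Iic_le hx
      have h2 := gaussianReal_real_Iic_ge hx
      rcases le_total x (-1) with hx1 | hx1
      · have h3 : 1 / (1 + x ^ 2) ≤ 0.5 := by
          rw [div_le_iff₀ (by positivity)]
          nlinarith
        have h4 : 0 ≤ (gaussianReal 0 1).real (Set.Iic x) := measureReal_nonneg
        linarith
      have h3 : 1 / (1 + x ^ 2) ≤ 1.046 + 0.399 * x := by
        rw [div_le_iff₀ (by positivity)]
        nlinarith [mul_nonneg (show 0 ≤ 0.8704 + 0.399 * x by linarith) (sq_nonneg (x + 0.22))]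
      linarith
  · set T := 4 / L with hTd
    have hT : 3.5 ≤ T := by
      rw [hTd, le_div_iff₀ hL]
      norm_num at hL' ⊢
      linarith
    have hT0 : 0 < T := by linarith
    have hLT : L = 4 / T := by rw [hTd]; field_simp
    have hih : Integrable (fun t => 1.75 / π * (0.4 * exp (-T ^ 2 * t ^ 2 / 2) + smoothingDeriv T t))
        (volume.restrict (Set.Ioo 0 1)) := by
      refine IntegrableOn.mono_set (t := Set.Icc 0 1) ?_ Set.Ioo_subset_Icc_self
      refine Continuous.integrableOn_Icc ?_
      unfold smoothingDeriv
      fun_prop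
    have hg : ∫ t in Set.Ioo 0 1, exp (-T ^ 2 * t ^ 2 / 2) ≤ √(π / 2) / T := by
      have e1 : ∀ t : ℝ, exp (-T ^ 2 * t ^ 2 / 2) = exp (-(T ^ 2 / 2) * t ^ 2) := fun t => by ring_nf
      simp_rw [e1]
      have hii : Integrable (fun t : ℝ => exp (-(T ^ 2 / 2) * t ^ 2)) :=
        integrable_exp_neg_mul_sq (by positivity)
      have := setIntegral_mono_set (s := Set.Ioo 0 1) (t := Set.Ioi 0) hii.integrableOn
        (Eventually.of_forall fun t => (exp_pos _).le) (Set.Ioo_subset_Ioi_self.eventuallyLE)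
      refine this.trans (le_of_eq ?_)
      rw [integral_gaussian_Ioi]
      have : π / (T ^ 2 / 2) = (2 / T) ^ 2 * (π / 2) := by field_simp
      rw [this, sqrt_mul (by positivity), sqrt_sq (by positivity)]
      ring
    have hie : IntegrableOn (fun t => exp (-T ^ 2 * t ^ 2 / 2)) (Set.Ioo 0 1) :=
      (Continuous.integrableOn_Icc (by fun_prop)).mono_set Set.Ioo_subset_Icc_self
    have his : IntegrableOn (smoothingDeriv T) (Set.Ioo 0 1) :=
      (Continuous.integrableOn_Icc (by unfold smoothingDeriv; fun_prop)).mono_set Set.Ioo_subset_Icc_self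
    have hS := smoothing μ h.integrable_id hT0 hih (fun t ht => ?_) x
    · refine hS.trans ?_
      rw [integral_const_mul, integral_add (hie.const_mul 0.4) his, integral_const_mul,
        integral_smoothingDeriv hT0]
      have hsq := sqrt_pi_div_two_le
      have hb := exp_neg_bound hT
      have h1 : 0.4 * ∫ t in Set.Ioo 0 1, exp (-T ^ 2 * t ^ 2 / 2) ≤ 0.501328 / T := by
        have : √(π / 2) / T ≤ 1.25332 / T := by gcongr
        calc _ ≤ 0.4 * (1.25332 / T) := by linarith
          _ = _ := by ring
      have h2 : (3.2 + 1.8 * exp (-T ^ 2 / 2) - 5 * exp (-T ^ 2 / 10)) / T ^ 2 ≤ 0.684 / T := by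
        rw [div_le_div_iff₀ (by positivity) hT0]
        nlinarith
      have h3 : 1.75 / π ≤ 0.55706 := by
        rw [div_le_iff₀ hπ]
        nlinarith [pi_gt_d4]
      have h4 : √(π / 2) / T ≤ 1.25332 / T := by gcongr
      have h5 : 0.501328 / T + 0.684 / T = 1.185328 / T := by ring
      calc _ ≤ 0.55706 * (1.185328 / T) + 1.25332 / T := by
            refine add_le_add (mul_le_mul h3 (by linarith) ?_ (by norm_num)) h4
            rw [← integral_smoothingDeriv hT0, ← integral_const_mul, ← integral_add (hie.const_mul 0.4) his]
            refine setIntegral_nonneg measurableSet_Ioo fun t ht => ?_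
            simp only [smoothingDeriv]
            have h7 : exp (-T ^ 2 * t ^ 2 / 2) ≤ exp (-T ^ 2 * t ^ 2 / 10) := by
              rw [exp_le_exp]
              nlinarith [mul_nonneg (sq_nonneg T) (sq_nonneg t)]
            have h8 : 0 ≤ 0.4 * T ^ 2 * t ^ 2 * (1 - t) * exp (-T ^ 2 * t ^ 2 / 2) :=
              mul_nonneg (mul_nonneg (by positivity) (by linarith [ht.2])) (exp_pos _).le
            have h9 := mul_nonneg ht.1.le (sub_nonneg.2 h7)
            linarith
        _ = (0.55706 * 1.185328 + 1.25332) / T := by ring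
        _ ≤ 0.4785 * (4 / T) := by
            rw [show 0.4785 * (4 / T) = 1.914 / T by ring]
            gcongr
            norm_num
        _ = _ := by rw [← hLT]
    · have h0 := ht.1
      have h1 := h.norm_charFun_sub_le (t := T * t) (by positivity)
      have h2 := norm_prawitz_le ht
      have h3 := exp_mul_sub_one_le ht.1.le ht.2.le (X := 0.4 * T ^ 2 * t ^ 2) (by positivity)
      have e1 : L * (T * t) ^ 3 / 10 = t * (0.4 * T ^ 2 * t ^ 2) := by
        rw [hLT]; field_simp; norm_num
      rw [e1] at h1
      calc _ ≤ 1.05 / (π * t) * (5 / 3 * exp (-(T * t) ^ 2 / 2) * (t * (0.4 * T ^ 2 * t ^ 2) * (1 - t)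
              + t ^ 2 * (exp (0.4 * T ^ 2 * t ^ 2) - 1))) := by
            refine mul_le_mul h2 (h1.trans ?_) (norm_nonneg _) (by positivity)
            gcongr
        _ = _ := by
            have e2 : exp (-T ^ 2 * t ^ 2 / 10) = exp (-(T * t) ^ 2 / 2) * exp (0.4 * T ^ 2 * t ^ 2) := by
              rw [← exp_add]; congr 1; ring
            have e3 : exp (-T ^ 2 * t ^ 2 / 2) = exp (-(T * t) ^ 2 / 2) := by congr 1; ring
            simp only [smoothingDeriv]
            rw [e2, e3]
            generalize exp (-(T * t) ^ 2 / 2) = a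
            generalize exp (0.4 * T ^ 2 * t ^ 2) = b
            field_simp
            ring

lemma neg (h : IsSteinPair μ τ L) :
    IsSteinPair (μ.map (fun w => -w)) (τ.map (fun y => -y)) L where
  isProb := have := h.isProb; Measure.isProbabilityMeasure_map measurable_neg.aemeasurable
  isProb_jump := have := h.isProb_jump; Measure.isProbabilityMeasure_map measurable_neg.aemeasurable
  integrable_sq := by
    rw [integrable_map_measure (by fun_prop) (by fun_prop)]
    simpa [Function.comp_def] using h.integrable_sq
  integral_id := by
    rw [integral_map (by fun_prop) (by fun_prop), integral_neg, h.integral_id, neg_zero]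
  integral_sq := by
    rw [integral_map (by fun_prop) (by fun_prop)]
    simpa using h.integral_sq
  jump_ne_zero := by
    have hm : MeasurableSet {y : ℝ | y ≠ 0} := (measurableSet_singleton (0 : ℝ)).compl
    rw [ae_map_iff (by fun_prop) hm]
    simpa using h.jump_ne_zero
  integrable_abs := by
    rw [integrable_map_measure (by fun_prop) (by fun_prop)]
    simpa [Function.comp_def] using h.integrable_abs
  integral_abs := by
    rw [integral_map (by fun_prop) (by fun_prop)]
    simpa using h.integral_abs
  integrable_inv := by
    rw [integrable_map_measure (by fun_prop) (by fun_prop)]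
    simpa [Function.comp_def, inv_neg] using h.integrable_inv.neg
  stein := by
    intro g hg ⟨C, hC⟩
    have := h.isProb
    have h1 := h.stein (fun w => -g (-w)) (by fun_prop) ⟨C, fun w => by simpa using hC (-w)⟩
    have hsm : StronglyMeasurable fun y : ℝ => ∫ w, (g (w + y) - g w) / y ∂μ.map (fun w => -w) := by
      have : IsProbabilityMeasure (μ.map (fun w => -w)) :=
        Measure.isProbabilityMeasure_map measurable_neg.aemeasurable
      refine StronglyMeasurable.integral_prod_right (f := fun y w => (g (w + y) - g w) / y) ?_
      exact Measurable.stronglyMeasurable (by simp only [Function.uncurry_def]; fun_prop)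
    rw [integral_map (by fun_prop) (by fun_prop), integral_map (by fun_prop) hsm.aestronglyMeasurable]
    simp only [neg_mul_comm, mul_neg] at h1 ⊢
    rw [h1]
    congr 1; ext y
    rw [integral_map (by fun_prop) (by fun_prop)]
    congr 1; ext w
    rw [neg_add]
    rw [div_neg, ← neg_div]
    ring

lemma map_neg_real_Iic (x : ℝ) [IsProbabilityMeasure μ] :
    (μ.map (fun w => -w)).real (Set.Iic (-x)) = 1 - μ.real (Set.Iio x) := by
  rw [map_measureReal_apply measurable_neg measurableSet_Iic]
  rw [← probReal_compl_eq_one_sub measurableSet_Iio, Set.compl_Iio]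
  congr 1; ext y; simp

/-- A one-sided bound which is invariant under reflection gives a two-sided bound. -/
lemma abs_sub_le_of_forall {K : ℝ → ℝ} (hK : ∀ x, K (-x) = K x)
    (H : ∀ μ τ : Measure ℝ, IsSteinPair μ τ L → ∀ x,
      μ.real (Set.Iic x) - (gaussianReal 0 1).real (Set.Iic x) ≤ K x)
    (h : IsSteinPair μ τ L) (x : ℝ) :
    |μ.real (Set.Iic x) - (gaussianReal 0 1).real (Set.Iic x)| ≤ K x := by
  have := h.isProb
  have h1 := H _ _ h x
  have h2 := H _ _ h.neg (-x)
  rw [map_neg_real_Iic, gaussianReal_real_Iic_neg, hK] at h2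
  have h3 : μ.real (Set.Iio x) ≤ μ.real (Set.Iic x) := measureReal_mono Set.Iio_subset_Iic_self
  rw [abs_le]
  constructor <;> linarith

lemma abs_real_Iic_sub_le (h : IsSteinPair μ τ L) (x : ℝ) :
    |μ.real (Set.Iic x) - (gaussianReal 0 1).real (Set.Iic x)| ≤ 0.4785 * L :=
  abs_sub_le_of_forall (K := fun _ => 0.4785 * L) (fun _ => rfl)
    (fun _ _ h x => h.real_Iic_sub_le x) h x

end IsSteinPair

/-- The unnormalized tail of the standard normal law. -/
noncomputable def gaussTail (w : ℝ) : ℝ := ∫ t in Set.Ioi w, exp (-t ^ 2 / 2)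

/-- The Mills ratio of the standard normal law. -/
noncomputable def mills (w : ℝ) : ℝ := gaussTail w * exp (w ^ 2 / 2)

lemma integrable_exp_neg_sq_div_two : Integrable fun t : ℝ => exp (-t ^ 2 / 2) := by
  have := integrable_exp_neg_mul_sq (b := 1 / 2) (by norm_num)
  refine this.congr (Eventually.of_forall fun t => ?_)
  simp only
  congr 1; ring

lemma integral_exp_neg_sq_div_two : ∫ t : ℝ, exp (-t ^ 2 / 2) = √(2 * π) := by
  have := integral_gaussian (1 / 2)
  rw [show π / (1 / 2) = 2 * π by ring] at this
  rw [← this]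
  congr 1; ext t; congr 1; ring

lemma gaussTail_pos (w : ℝ) : 0 < gaussTail w := by
  unfold gaussTail
  rw [setIntegral_pos_iff_support_of_nonneg_ae (Eventually.of_forall fun t => (exp_pos _).le)
    integrable_exp_neg_sq_div_two.integrableOn]
  have : Function.support (fun t : ℝ => exp (-t ^ 2 / 2)) = Set.univ := by
    ext t; simp [(exp_pos _).ne']
  rw [this, Set.univ_inter, Real.volume_Ioi]
  exact ENNReal.zero_lt_top

lemma gaussTail_add_integral_Iic (w : ℝ) :
    (∫ t in Set.Iic w, exp (-t ^ 2 / 2)) + gaussTail w = √(2 * π) := by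
  rw [← integral_exp_neg_sq_div_two]
  exact intervalIntegral.integral_Iic_add_Ioi integrable_exp_neg_sq_div_two.integrableOn
    integrable_exp_neg_sq_div_two.integrableOn

lemma gaussTail_neg (w : ℝ) : gaussTail (-w) = ∫ t in Set.Iic w, exp (-t ^ 2 / 2) := by
  rw [gaussTail, ← integral_comp_neg_Iic]
  simp

lemma gaussTail_add_neg (w : ℝ) : gaussTail w + gaussTail (-w) = √(2 * π) := by
  rw [gaussTail_neg, add_comm, gaussTail_add_integral_Iic]

lemma gaussTail_lt (w : ℝ) : gaussTail w < √(2 * π) := by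
  have := gaussTail_add_neg w
  linarith [gaussTail_pos (-w)]

lemma gaussianReal_real_Iic_eq_sub (x : ℝ) :
    (gaussianReal 0 1).real (Set.Iic x) = 1 - gaussTail x / √(2 * π) := by
  have h : 0 < √(2 * π) := by have := pi_pos; positivity
  rw [gaussianReal_real_Iic, eq_sub_iff_add_eq, ← add_div, gaussTail_add_integral_Iic, div_self h.ne']

lemma hasDerivAt_gaussTail (w : ℝ) : HasDerivAt gaussTail (-exp (-w ^ 2 / 2)) w := by
  have h1 : HasDerivAt (fun u => ∫ t in (0 : ℝ)..u, exp (-t ^ 2 / 2)) (exp (-w ^ 2 / 2)) w := by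
    have hc : Continuous fun t : ℝ => exp (-t ^ 2 / 2) := by fun_prop
    exact hc.integral_hasStrictDerivAt 0 w |>.hasDerivAt
  have h2 : gaussTail = fun u => gaussTail 0 - ∫ t in (0 : ℝ)..u, exp (-t ^ 2 / 2) := by
    ext u
    have h3 := intervalIntegral.integral_Iic_sub_Iic (μ := volume) (a := 0) (b := u)
      (f := fun t : ℝ => exp (-t ^ 2 / 2))
      integrable_exp_neg_sq_div_two.integrableOn integrable_exp_neg_sq_div_two.integrableOn
    have h4 := gaussTail_add_integral_Iic 0
    have h5 := gaussTail_add_integral_Iic u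
    linarith
  rw [h2]
  exact h1.const_sub _

lemma hasDerivAt_mills (w : ℝ) : HasDerivAt mills (w * mills w - 1) w := by
  have h1 : HasDerivAt (fun w : ℝ => exp (w ^ 2 / 2)) (exp (w ^ 2 / 2) * w) w := by
    have := (((hasDerivAt_id w).pow 2).div_const 2).exp
    convert! this using 1
    simp
  have := (hasDerivAt_gaussTail w).mul h1
  convert! this using 1
  have e : exp (-w ^ 2 / 2) * exp (w ^ 2 / 2) = 1 := by
    rw [← exp_add]; ring_nf; simp
  rw [mills]
  linear_combination e

lemma mills_pos (w : ℝ) : 0 < mills w := mul_pos (gaussTail_pos w) (exp_pos _)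

lemma gaussTail_eq (w : ℝ) : gaussTail w = mills w * exp (-w ^ 2 / 2) := by
  rw [mills, mul_assoc, ← exp_add, show w ^ 2 / 2 + -w ^ 2 / 2 = 0 by ring, exp_zero, mul_one]

lemma tendsto_exp_neg_sq_mul : Tendsto (fun w : ℝ => w * exp (-w ^ 2 / 2)) atTop (𝓝 0) := by
  have h1 : Tendsto (fun w : ℝ => w ^ 1 * exp (-w)) atTop (𝓝 0) := tendsto_pow_mul_exp_neg_atTop_nhds_zero 1
  refine squeeze_zero' ?_ ?_ h1
  · filter_upwards [eventually_ge_atTop 0] with w hw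
    positivity
  · filter_upwards [eventually_ge_atTop 2] with w hw
    rw [pow_one]
    gcongr
    nlinarith

lemma mul_gaussTail_le (w : ℝ) : w * gaussTail w ≤ exp (-w ^ 2 / 2) := by
  have hd : ∀ t : ℝ, HasDerivAt (fun t : ℝ => -exp (-t ^ 2 / 2)) (t * exp (-t ^ 2 / 2)) t := by
    intro t
    have := ((((hasDerivAt_id t).pow 2).neg).div_const 2).exp.neg
    convert! this using 1
    simp; ring
  have hlim : Tendsto (fun t : ℝ => -exp (-t ^ 2 / 2)) atTop (𝓝 (-0)) := by
    refine Tendsto.neg (tendsto_exp_atBot.comp ?_)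
    have : Tendsto (fun t : ℝ => t ^ 2 / 2) atTop atTop :=
      (tendsto_pow_atTop two_ne_zero).atTop_div_const two_pos
    refine (tendsto_neg_atTop_atBot.comp this).congr fun t => ?_
    simp [neg_div]
  rcases le_or_gt w 0 with hw | hw
  · exact (mul_nonpos_of_nonpos_of_nonneg hw (gaussTail_pos w).le).trans (exp_pos _).le
  have h1 := integral_Ioi_of_hasDerivAt_of_nonneg' (a := w) (fun t _ => hd t)
    (fun t ht => mul_nonneg (hw.trans ht).le (exp_pos _).le) hlim
  have h2 := integrableOn_Ioi_deriv_of_nonneg' (a := w) (fun t _ => hd t)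
    (fun t ht => mul_nonneg (hw.trans ht).le (exp_pos _).le) hlim
  rw [gaussTail, ← integral_const_mul]
  have h3 : ∫ t in Set.Ioi w, w * exp (-t ^ 2 / 2) ≤ ∫ t in Set.Ioi w, t * exp (-t ^ 2 / 2) := by
    refine setIntegral_mono_on (integrable_exp_neg_sq_div_two.integrableOn.const_mul w) h2
      measurableSet_Ioi fun t ht => ?_
    exact mul_le_mul_of_nonneg_right (le_of_lt ht) (exp_pos _).le
  rw [h1] at h3
  simpa using h3

lemma mul_mills_le_one (w : ℝ) : w * mills w ≤ 1 := by
  have := mul_gaussTail_le w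
  rw [mills, ← mul_assoc]
  calc _ ≤ exp (-w ^ 2 / 2) * exp (w ^ 2 / 2) := by gcongr
    _ = 1 := by rw [← exp_add]; ring_nf; simp

lemma le_mul_mills (w : ℝ) : w ≤ (1 + w ^ 2) * mills w := by
  have hd : ∀ t : ℝ, HasDerivAt (fun t : ℝ => (1 + t ^ 2) * gaussTail t - t * exp (-t ^ 2 / 2))
      (2 * (t * gaussTail t - exp (-t ^ 2 / 2))) t := by
    intro t
    have h1 := ((((hasDerivAt_id t).pow 2).neg).div_const 2).exp
    have := ((((hasDerivAt_id t).pow 2).const_add 1).mul (hasDerivAt_gaussTail t)).sub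
      ((hasDerivAt_id t).mul h1)
    convert! this using 1
    simp; ring
  have ha : Antitone (fun t : ℝ => (1 + t ^ 2) * gaussTail t - t * exp (-t ^ 2 / 2)) := by
    refine antitone_of_deriv_nonpos (fun t => (hd t).differentiableAt) fun t => ?_
    rw [(hd t).deriv]
    linarith [mul_gaussTail_le t]
  have hlim : Tendsto (fun t : ℝ => -(t * exp (-t ^ 2 / 2))) atTop (𝓝 0) := by
    simpa using tendsto_exp_neg_sq_mul.neg
  have h0 : 0 ≤ (1 + w ^ 2) * gaussTail w - w * exp (-w ^ 2 / 2) := by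
    refine le_of_tendsto hlim ?_
    filter_upwards [eventually_ge_atTop w] with t ht
    have h2 := ha ht
    simp only at h2
    have h3 : 0 ≤ (1 + t ^ 2) * gaussTail t := mul_nonneg (by positivity) (gaussTail_pos t).le
    linarith
  rw [gaussTail_eq, ← mul_assoc, ← sub_mul] at h0
  have := (mul_nonneg_iff_of_pos_right (exp_pos _)).1 h0
  linarith

lemma monotone_mul_mills : Monotone fun w => w * mills w := by
  have hd : ∀ w, HasDerivAt (fun w => w * mills w) ((1 + w ^ 2) * mills w - w) w := by
    intro w
    have := (hasDerivAt_id w).mul (hasDerivAt_mills w)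
    convert! this using 1
    simp only [id]; ring
  refine monotone_of_deriv_nonneg (fun w => (hd w).differentiableAt) fun w => ?_
  rw [(hd w).deriv]
  linarith [le_mul_mills w]

lemma antitone_mills : Antitone mills := by
  refine antitone_of_deriv_nonpos (fun w => (hasDerivAt_mills w).differentiableAt) fun w => ?_
  rw [(hasDerivAt_mills w).deriv]
  linarith [mul_mills_le_one w]

/-- `J` is a monotone subderivative of `H` with values in `[0, 1]`. -/
structure IsSlope (H J : ℝ → ℝ) : Prop where
  mono : Monotone J
  nonneg : ∀ w, 0 ≤ J w
  le_one : ∀ w, J w ≤ 1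
  slope : ∀ a b, (b - a) * J a ≤ H b - H a

lemma slope_of_hasDerivAt {g g' : ℝ → ℝ} (hg : ∀ w, HasDerivAt g (g' w) w) (hm : Monotone g') (a b : ℝ) :
    (b - a) * g' a ≤ g b - g a := by
  rcases lt_trichotomy a b with h | h | h
  · obtain ⟨c, hc, e⟩ := exists_hasDerivAt_eq_slope g g' h
      (fun w _ => (hg w).continuousAt.continuousWithinAt) (fun w _ => hg w)
    rw [eq_div_iff (by linarith)] at e
    rw [← e, mul_comm]
    exact mul_le_mul_of_nonneg_right (hm hc.1.le) (by linarith)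
  · simp [h]
  · obtain ⟨c, hc, e⟩ := exists_hasDerivAt_eq_slope g g' h
      (fun w _ => (hg w).continuousAt.continuousWithinAt) (fun w _ => hg w)
    rw [eq_div_iff (by linarith)] at e
    nlinarith [hm hc.2.le]

/-- The solution of the Stein equation for the indicator of `(-∞, x]`. -/
noncomputable def tailStein (x w : ℝ) : ℝ :=
  if w ≤ x then gaussTail x / √(2 * π) * mills (-w) else gaussTail (-x) / √(2 * π) * mills w

/-- The convex function `w ↦ tailStein x w + (w - x)₊`. -/
noncomputable def convexStein (x w : ℝ) : ℝ := tailStein x w + max (w - x) 0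

/-- The derivative of `convexStein x`. -/
noncomputable def slopeStein (x w : ℝ) : ℝ := w * tailStein x w + gaussTail x / √(2 * π)

lemma sqrt_two_pi_pos : 0 < √(2 * π) := by have := pi_pos; positivity

lemma tailStein_nonneg (x w : ℝ) : 0 ≤ tailStein x w := by
  have := sqrt_two_pi_pos
  unfold tailStein
  split_ifs
  · exact mul_nonneg (div_nonneg (gaussTail_pos _).le this.le) (mills_pos _).le
  · exact mul_nonneg (div_nonneg (gaussTail_pos _).le this.le) (mills_pos _).le

lemma gaussTail_mul_mills_neg (x : ℝ) :
    gaussTail x * mills (-x) = gaussTail (-x) * mills x := by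
  simp only [mills, neg_sq]; ring

lemma tailStein_le {x : ℝ} (hx : 0 < x) (w : ℝ) : tailStein x w ≤ 1 / x := by
  have hc := sqrt_two_pi_pos
  have h1 : mills x ≤ 1 / x := by
    rw [le_div_iff₀ hx, mul_comm]; exact mul_mills_le_one x
  have h2 : gaussTail (-x) / √(2 * π) ≤ 1 := by
    rw [div_le_one hc]; exact (gaussTail_lt _).le
  have h3 : gaussTail (-x) / √(2 * π) * mills x ≤ 1 / x :=
    (mul_le_of_le_one_left (mills_pos x).le h2).trans h1
  unfold tailStein
  split_ifs with hw
  · refine le_trans ?_ h3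
    rw [div_mul_eq_mul_div, div_mul_eq_mul_div, ← gaussTail_mul_mills_neg]
    gcongr
    · exact (gaussTail_pos x).le
    · exact antitone_mills (by linarith)
  · refine le_trans ?_ h3
    gcongr
    · exact div_nonneg (gaussTail_pos _).le hc.le
    · exact antitone_mills (not_le.1 hw).le

lemma measurable_tailStein (x : ℝ) : Measurable (tailStein x) := by
  have hm : Measurable mills := antitone_mills.measurable
  unfold tailStein
  exact Measurable.ite measurableSet_Iic (by fun_prop) (by fun_prop)

lemma isSlope_convexStein (x : ℝ) : IsSlope (convexStein x) (slopeStein x) := by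
  have hc := sqrt_two_pi_pos
  set b := gaussTail x / √(2 * π) with hb
  set a := gaussTail (-x) / √(2 * π) with ha
  have hb0 : 0 ≤ b := div_nonneg (gaussTail_pos _).le hc.le
  have ha0 : 0 ≤ a := div_nonneg (gaussTail_pos _).le hc.le
  have hab : b + a = 1 := by
    rw [hb, ha, ← add_div, gaussTail_add_neg, div_self hc.ne']
  have hglue : b * mills (-x) = a * mills x := by
    rw [hb, ha, div_mul_eq_mul_div, div_mul_eq_mul_div, gaussTail_mul_mills_neg]
  have hl : ∀ w, w ≤ x → convexStein x w = b * mills (-w) ∧ slopeStein x w = b * (1 + w * mills (-w)) := by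
    intro w hw
    simp only [convexStein, slopeStein, tailStein, if_pos hw, max_eq_right (show w - x ≤ 0 by linarith), ← hb]
    constructor <;> ring
  have hr : ∀ w, x ≤ w → convexStein x w = a * mills w + (w - x) ∧
      slopeStein x w = 1 - a * (1 - w * mills w) := by
    intro w hw
    rcases hw.eq_or_lt with rfl | hw
    · obtain ⟨h1, h2⟩ := hl x le_rfl
      rw [h1, h2, hglue]
      constructor
      · simp
      · linear_combination x * hglue + hab
    · simp only [convexStein, slopeStein, tailStein, if_neg (not_le.2 hw),
        max_eq_left (show 0 ≤ w - x by linarith), ← ha, ← hb]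
      constructor
      · trivial
      · linear_combination hab
  have hml : Monotone fun w => b * (1 + w * mills (-w)) := by
    intro u v huv
    have := monotone_mul_mills (neg_le_neg huv)
    simp only at this ⊢
    refine mul_le_mul_of_nonneg_left ?_ hb0
    linarith
  have hmr : Monotone fun w => 1 - a * (1 - w * mills w) := by
    intro u v huv
    have := monotone_mul_mills huv
    simp only at this ⊢
    have := mul_le_mul_of_nonneg_left this ha0
    linarith
  have hdl : ∀ w, HasDerivAt (fun w => b * mills (-w)) (b * (1 + w * mills (-w))) w := by
    intro w
    have := ((hasDerivAt_mills (-w)).comp w (hasDerivAt_neg w)).const_mul b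
    convert! this using 1
    ring
  have hdr : ∀ w, HasDerivAt (fun w => a * mills w + (w - x)) (1 - a * (1 - w * mills w)) w := by
    intro w
    have := ((hasDerivAt_mills w).const_mul a).add ((hasDerivAt_id w).sub_const x)
    convert! this using 1
    ring
  have hsl : ∀ u v, u ≤ x → v ≤ x → (v - u) * slopeStein x u ≤ convexStein x v - convexStein x u := by
    intro u v hu hv
    rw [(hl u hu).1, (hl u hu).2, (hl v hv).1]
    exact slope_of_hasDerivAt hdl hml u v
  have hsr : ∀ u v, x ≤ u → x ≤ v → (v - u) * slopeStein x u ≤ convexStein x v - convexStein x u := by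
    intro u v hu hv
    rw [(hr u hu).1, (hr u hu).2, (hr v hv).1]
    exact slope_of_hasDerivAt hdr hmr u v
  have hmono : Monotone (slopeStein x) := by
    have h1 : ∀ u v, u ≤ v → v ≤ x → slopeStein x u ≤ slopeStein x v := by
      intro u v huv hv
      rw [(hl u (huv.trans hv)).2, (hl v hv).2]
      exact hml huv
    have h2 : ∀ u v, u ≤ v → x ≤ u → slopeStein x u ≤ slopeStein x v := by
      intro u v huv hu
      rw [(hr u hu).2, (hr v (hu.trans huv)).2]
      exact hmr huv
    intro u v huv
    rcases le_total v x with hv | hv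
    · exact h1 u v huv hv
    · rcases le_total u x with hu | hu
      · exact (h1 u x hu le_rfl).trans (h2 x v hv le_rfl)
      · exact h2 u v huv hu
  refine ⟨hmono, fun w => ?_, fun w => ?_, fun u v => ?_⟩
  · refine le_trans ?_ (hmono (min_le_left w x))
    rw [(hl _ (min_le_right w x)).2]
    have := mul_mills_le_one (-(min w x))
    exact mul_nonneg hb0 (by linarith)
  · refine (hmono (le_max_left w x)).trans ?_
    rw [(hr _ (le_max_right w x)).2]
    have := mul_mills_le_one (max w x)
    have := mul_nonneg ha0 (sub_nonneg.2 this)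
    linarith
  · rcases le_total u x with hu | hu <;> rcases le_total v x with hv | hv
    · exact hsl u v hu hv
    · have h1 := hsl u x hu le_rfl
      have h2 := hsr x v le_rfl hv
      nlinarith [hmono hu]
    · have h1 := hsr u x hu le_rfl
      have h2 := hsl x v le_rfl hv
      nlinarith [hmono hu]
    · exact hsr u v hu hv

lemma isSlope_posPart (x : ℝ) :
    IsSlope (fun w => max (w - x) 0) ((Set.Ioi x).indicator fun _ => 1) := by
  refine ⟨?_, ?_, ?_, ?_⟩
  · intro u v huv
    by_cases hu : x < u
    · simp [hu, hu.trans_le huv]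
    · simp only [Set.indicator, Set.mem_Ioi, hu, if_false]
      split_ifs <;> norm_num
  · intro w; exact Set.indicator_nonneg (fun _ _ => zero_le_one) w
  · intro w; exact Set.indicator_le_self' (fun _ _ => zero_le_one) w
  · intro u v
    by_cases hu : x < u
    · simp only [Set.indicator, Set.mem_Ioi, hu, if_true, max_eq_left (show 0 ≤ u - x by linarith)]
      linarith [le_max_left (v - x) 0]
    · simp only [Set.indicator, Set.mem_Ioi, hu, if_false, max_eq_right (show u - x ≤ 0 by linarith [not_lt.1 hu])]
      linarith [le_max_right (v - x) 0]

lemma exp_six_ge : (400 : ℝ) ≤ exp 6 := by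
  have := exp_one_gt_d9
  rw [show (6 : ℝ) = ((6 : ℕ) : ℝ) * 1 by norm_num, exp_nat_mul]
  calc (400 : ℝ) ≤ 2.718 ^ 6 := by norm_num
    _ ≤ exp 1 ^ 6 := by gcongr; linarith

lemma exp_neg_three_eighths_le {x : ℝ} (hx : 4 ≤ x) : exp (-(3 * x ^ 2 / 8)) ≤ 1 / (6 * x ^ 3) := by
  rw [exp_neg, ← one_div]
  apply one_div_le_one_div_of_le (by positivity)
  have h1 : x ^ 2 / 16 ≤ exp (3 * x ^ 2 / 16 - 3) := by
    have := add_one_le_exp (3 * x ^ 2 / 16 - 3)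
    nlinarith
  have h2 : exp (3 * x ^ 2 / 8) = exp 6 * exp (3 * x ^ 2 / 16 - 3) ^ 2 := by
    rw [← exp_nat_mul, ← exp_add]; congr 1; push_cast; ring
  rw [h2]
  calc 6 * x ^ 3 ≤ 400 * (x ^ 2 / 16) ^ 2 := by
        have : 0 ≤ x ^ 3 := by positivity
        nlinarith
    _ ≤ _ := by
        gcongr
        exact exp_six_ge

lemma slopeStein_le {x w β : ℝ} (hx : 4 ≤ x) (hβ0 : 0 ≤ β) (hβ : β ≤ 0.405) :
    slopeStein x (w + β * x) ≤ (min (max w 0) ((1 - β) * x) / ((1 - β) * x)) ^ 3 + 1 / (10 * x ^ 3) := by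
  have hx0 : 0 < x := by linarith
  have hA : 0 < (1 - β) * x := mul_pos (by linarith) hx0
  have hS := isSlope_convexStein x
  have hc := sqrt_two_pi_pos
  have hc2 : 2.5 ≤ √(2 * π) := by
    apply le_sqrt_of_sq_le; nlinarith [pi_gt_d2]
  have hε : 0 ≤ 1 / (10 * x ^ 3) := by positivity
  rcases le_or_gt ((1 - β) * x) w with hw | hw
  · rw [min_eq_right (hw.trans (le_max_left _ _)), div_self hA.ne']
    linarith [hS.le_one (w + β * x)]
  have hE := exp_neg_three_eighths_le hx
  have hB : gaussTail x / √(2 * π) ≤ 0.1 * exp (-(3 * x ^ 2 / 8)) := by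
    rw [div_le_iff₀ hc]
    have h1 := mul_gaussTail_le x
    have h2 : exp (-x ^ 2 / 2) ≤ exp (-(3 * x ^ 2 / 8)) := by
      rw [exp_le_exp]; nlinarith
    have h3 := gaussTail_pos x
    have h4 := exp_pos (-(3 * x ^ 2 / 8))
    nlinarith
  have hpow : 0 ≤ (min (max w 0) ((1 - β) * x) / ((1 - β) * x)) ^ 3 := by positivity
  have key : ∀ z, 0 ≤ z → z ≤ x → slopeStein x z ≤ z / x * exp (-(x ^ 2 - z ^ 2) / 2) +
      0.1 * exp (-(3 * x ^ 2 / 8)) := by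
    intro z hz hzx
    simp only [slopeStein, tailStein, if_pos hzx]
    refine add_le_add ?_ hB
    have h1 : mills (-z) ≤ √(2 * π) * exp (z ^ 2 / 2) := by
      rw [mills, neg_sq]
      gcongr
      exact (gaussTail_lt _).le
    have h2 : gaussTail x ≤ exp (-x ^ 2 / 2) / x := by
      rw [le_div_iff₀ hx0, mul_comm]; exact mul_gaussTail_le x
    calc z * (gaussTail x / √(2 * π) * mills (-z))
        ≤ z * (exp (-x ^ 2 / 2) / x / √(2 * π) * (√(2 * π) * exp (z ^ 2 / 2))) := by
          have := (mills_pos (-z)).le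
          gcongr
      _ = z / x * (exp (-x ^ 2 / 2) * exp (z ^ 2 / 2)) := by field_simp
      _ = _ := by rw [← exp_add]; congr 2; ring
  rcases le_or_gt (w + β * x) (x / 2) with hz | hz
  · have h1 := hS.mono hz
    have h2 := key (x / 2) (by linarith) (by linarith)
    have e : exp (-(x ^ 2 - (x / 2) ^ 2) / 2) = exp (-(3 * x ^ 2 / 8)) := by congr 1; ring
    rw [e, show x / 2 / x = 1 / 2 by field_simp] at h2
    have h3 : 0.6 * (1 / (6 * x ^ 3)) = 1 / (10 * x ^ 3) := by field_simp; norm_num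
    linarith
  · have h2 := key (w + β * x) (by linarith) (by linarith)
    set δ := 1 - (w + β * x) / x with hδ
    have hw' : w = (1 - δ - β) * x := by rw [hδ]; field_simp; ring
    have hδ0 : 0 ≤ δ := by
      rw [hδ, sub_nonneg, div_le_one hx0]; linarith
    have hδ1 : δ ≤ 1 / 2 := by
      have : 1 / 2 ≤ (w + β * x) / x := by rw [le_div_iff₀ hx0]; linarith
      linarith
    have hw0 : 0 ≤ w := by
      rw [hw']; exact mul_nonneg (by linarith) hx0.le
    have e1 : (w + β * x) / x = 1 - δ := by rw [hδ]; ring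
    have e2 : -(x ^ 2 - (w + β * x) ^ 2) / 2 = -(x ^ 2 * δ * (2 - δ)) / 2 := by rw [hw']; ring
    have h3 : exp (-4 * δ) ≤ 1 - 1.729 * δ := by
      have := convexOn_exp.2 (Set.mem_univ 0) (Set.mem_univ (-2)) (show 0 ≤ 1 - 2 * δ by linarith)
        (show 0 ≤ 2 * δ by linarith) (by ring)
      simp only [smul_eq_mul, mul_zero, zero_add, exp_zero, mul_one] at this
      have h5 : exp (-2) ≤ 0.1354 := by
        have h6 := exp_neg_one_lt_d9
        have h7 := exp_pos (-1)
        rw [show (-2 : ℝ) = -1 + -1 by norm_num, exp_add]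
        norm_num at h6 ⊢
        nlinarith
      rw [show -4 * δ = 2 * δ * -2 by ring]
      nlinarith
    have h4 : (1 - δ) * exp (-(x ^ 2 * δ * (2 - δ)) / 2) ≤ exp (-4 * δ) ^ 3 := by
      rw [← exp_nat_mul]
      calc _ ≤ 1 * exp (-(x ^ 2 * δ * (2 - δ)) / 2) := by gcongr; linarith
        _ ≤ _ := by
          rw [one_mul, exp_le_exp]
          push_cast
          have h6 : 16 ≤ x ^ 2 := by nlinarith
          nlinarith [mul_le_mul_of_nonneg_right h6 (mul_nonneg hδ0 (show 0 ≤ 2 - δ by linarith)),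
            mul_nonneg hδ0 (show 0 ≤ 1 / 2 - δ by linarith)]
    have h5 : exp (-4 * δ) ≤ min (max w 0) ((1 - β) * x) / ((1 - β) * x) := by
      rw [max_eq_left hw0, min_eq_left hw.le]
      refine h3.trans ?_
      rw [hw', mul_div_mul_right _ _ hx0.ne', le_div_iff₀ (by linarith)]
      nlinarith
    have h6 : exp (-4 * δ) ^ 3 ≤ (min (max w 0) ((1 - β) * x) / ((1 - β) * x)) ^ 3 := by gcongr
    rw [e1, e2] at h2
    have h7 : 0.1 * (1 / (6 * x ^ 3)) ≤ 1 / (10 * x ^ 3) := by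
      rw [show 0.1 * (1 / (6 * x ^ 3)) = 1 / 6 * (1 / (10 * x ^ 3)) by field_simp; norm_num]
      linarith
    linarith

namespace IsSlope

variable {H J : ℝ → ℝ}

lemma sub_le (h : IsSlope H J) (a b : ℝ) : H b - H a ≤ (b - a) * J b := by
  have := h.slope b a
  linarith

lemma mono_fun (h : IsSlope H J) : Monotone H := by
  intro a b hab
  have := h.slope a b
  have := mul_nonneg (sub_nonneg.2 hab) (h.nonneg a)
  linarith

lemma abs_sub_le (h : IsSlope H J) (a b : ℝ) : |H b - H a| ≤ |b - a| := by
  wlog hab : a ≤ b generalizing a b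
  · rw [abs_sub_comm, abs_sub_comm b]; exact this b a (not_le.1 hab).le
  rw [abs_of_nonneg (sub_nonneg.2 (h.mono_fun hab)), abs_of_nonneg (sub_nonneg.2 hab)]
  refine (h.sub_le a b).trans (mul_le_of_le_one_right (sub_nonneg.2 hab) (h.le_one b))

lemma measurable (h : IsSlope H J) : Measurable H := h.mono_fun.measurable

lemma measurable_slope (h : IsSlope H J) : Measurable J := h.mono.measurable

lemma integrable_slope (h : IsSlope H J) (μ : Measure ℝ) [IsProbabilityMeasure μ] (a : ℝ) :
    Integrable (fun w => J (w + a)) μ := by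
  have := h.measurable_slope
  refine Integrable.of_bound (C := 1) (Measurable.aestronglyMeasurable (by fun_prop)) (Eventually.of_forall fun w => ?_)
  rw [norm_of_nonneg (h.nonneg _)]
  exact h.le_one _

lemma integrable_quotient (h : IsSlope H J) (μ : Measure ℝ) [IsProbabilityMeasure μ] (y : ℝ) :
    Integrable (fun w => (H (w + y) - H w) / y) μ := by
  have := h.measurable
  refine Integrable.of_bound (C := 1) (by fun_prop) (Eventually.of_forall fun w => ?_)
  rw [norm_div, norm_eq_abs, norm_eq_abs]
  refine div_le_one_of_le₀ ?_ (abs_nonneg _)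
  simpa using h.abs_sub_le w (w + y)

lemma sub_le_sum (h : IsSlope H J) (w s : ℝ) (n : ℕ) :
    H (w + n * s) - H w ≤ s * ∑ k ∈ Finset.range n, J (w + (k + 1) * s) := by
  induction n with
  | zero => simp
  | succ n ih =>
    rw [Finset.sum_range_succ, mul_add]
    have := h.sub_le (w + n * s) (w + (n + 1) * s)
    push_cast
    linarith

/-- The increments of the thickened function `w ↦ H (w + b + κ) - H (w + a - κ)` dominate the
increments of the slope. -/
lemma min_mul_le (h : IsSlope H J) {a b κ : ℝ} (hab : a ≤ b) (hκ : 0 < κ) (w : ℝ) {y : ℝ} (hy : y ≠ 0) :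
    (1 - |y| / (4 * κ)) * (J (w + b) - J (w + a)) ≤
      ((H (w + y + b + κ) - H (w + y + a - κ)) - (H (w + b + κ) - H (w + a - κ))) / y := by
  have hJ : 0 ≤ J (w + b) - J (w + a) := sub_nonneg.2 (h.mono (by linarith))
  have hmono : Monotone fun z => H (z + b + κ) - H (z + a - κ) := by
    intro u v huv
    have h1 := h.slope (u + b + κ) (v + b + κ)
    have h2 := h.sub_le (u + a - κ) (v + a - κ)
    have h3 : (v - u) * J (u + b + κ) ≤ H (v + b + κ) - H (u + b + κ) := by
      refine le_trans (le_of_eq (by ring)) h1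
    have h4 : H (v + a - κ) - H (u + a - κ) ≤ (v - u) * J (v + a - κ) := by
      refine h2.trans (le_of_eq (by ring))
    rcases le_total (v + a - κ) (u + b + κ) with hc | hc
    · have := mul_le_mul_of_nonneg_left (h.mono hc) (sub_nonneg.2 huv)
      simp only
      linarith
    · have h5 := h.slope (v + a - κ) (v + b + κ)
      have h6 := h.sub_le (u + a - κ) (u + b + κ)
      have h7 := mul_le_mul_of_nonneg_left (h.mono hc) (by linarith : 0 ≤ b - a + 2 * κ)
      have e1 : (v + b + κ - (v + a - κ)) = b - a + 2 * κ := by ring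
      have e2 : (u + b + κ - (u + a - κ)) = b - a + 2 * κ := by ring
      rw [e1] at h5
      rw [e2] at h6
      simp only
      linarith
  have hpos : ∀ s, 0 ≤ s → s ≤ κ → s * (J (w + b) - J (w + a)) ≤
      (H (w + s + b + κ) - H (w + s + a - κ)) - (H (w + b + κ) - H (w + a - κ)) := by
    intro s h0 h1
    have i1 := h.slope (w + b + κ) (w + s + b + κ)
    have i2 := h.sub_le (w + a - κ) (w + s + a - κ)
    have e1 : w + s + b + κ - (w + b + κ) = s := by ring
    have e2 : w + s + a - κ - (w + a - κ) = s := by ring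
    rw [e1] at i1
    rw [e2] at i2
    have i3 := mul_le_mul_of_nonneg_left (h.mono (by linarith : w + b ≤ w + b + κ)) h0
    have i4 := mul_le_mul_of_nonneg_left (h.mono (by linarith : w + s + a - κ ≤ w + a)) h0
    linarith
  have hneg : ∀ s, 0 ≤ s → s ≤ κ → s * (J (w + b) - J (w + a)) ≤
      (H (w + b + κ) - H (w + a - κ)) - (H (w - s + b + κ) - H (w - s + a - κ)) := by
    intro s h0 h1
    have i1 := h.slope (w - s + b + κ) (w + b + κ)
    have i2 := h.sub_le (w - s + a - κ) (w + a - κ)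
    have e1 : w + b + κ - (w - s + b + κ) = s := by ring
    have e2 : w + a - κ - (w - s + a - κ) = s := by ring
    rw [e1] at i1
    rw [e2] at i2
    have i3 := mul_le_mul_of_nonneg_left (h.mono (by linarith : w + b ≤ w - s + b + κ)) h0
    have i4 := mul_le_mul_of_nonneg_left (h.mono (by linarith : w + a - κ ≤ w + a)) h0
    linarith
  have hy0 : 0 < |y| := abs_pos.2 hy
  have hmin : |y| * (1 - |y| / (4 * κ)) ≤ min |y| κ := by
    refine le_min (mul_le_of_le_one_right hy0.le ?_) ?_
    · have : 0 ≤ |y| / (4 * κ) := by positivity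
      linarith
    · have : κ - |y| * (1 - |y| / (4 * κ)) = (|y| / 2 - κ) ^ 2 / κ := by
        field_simp
        ring
      have : 0 ≤ (|y| / 2 - κ) ^ 2 / κ := by positivity
      linarith
  have hs0 : 0 ≤ min |y| κ := le_min hy0.le hκ.le
  have hDs := mul_le_mul_of_nonneg_right hmin hJ
  rcases lt_or_gt_of_ne hy with hy' | hy'
  · rw [le_div_iff_of_neg hy']
    have i1 := hneg _ hs0 (min_le_right _ _)
    have i2 := hmono (show w + y ≤ w - min |y| κ by
      have := min_le_left |y| κ
      rw [abs_of_neg hy'] at this ⊢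
      linarith)
    simp only at i2
    rw [abs_of_neg hy'] at *
    linarith
  · rw [le_div_iff₀ hy']
    have i1 := hpos _ hs0 (min_le_right _ _)
    have i2 := hmono (show w + min |y| κ ≤ w + y by
      have := min_le_left |y| κ
      rw [abs_of_pos hy'] at this ⊢
      linarith)
    simp only at i2
    rw [abs_of_pos hy'] at *
    linarith

end IsSlope

namespace IsSteinPair

variable {μ τ : Measure ℝ} {L : ℝ}

lemma integrable_mul_bounded (h : IsSteinPair μ τ L) {g : ℝ → ℝ} (hg : Measurable g) {C : ℝ}
    (hC : ∀ w, |g w| ≤ C) : Integrable (fun w => w * g w) μ :=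
  h.integrable_id.mul_bdd hg.aestronglyMeasurable (Eventually.of_forall hC)

lemma integrable_inner (h : IsSteinPair μ τ L) {g : ℝ → ℝ} (hg : Measurable g) {C : ℝ}
    (hC : ∀ w, |g w| ≤ C) : Integrable (fun y => ∫ w, (g (w + y) - g w) / y ∂μ) τ := by
  have := h.isProb
  refine Integrable.mono' (h.integrable_inv.norm.const_mul (2 * C)) ?_ (Eventually.of_forall fun y => ?_)
  · refine StronglyMeasurable.aestronglyMeasurable ?_
    refine StronglyMeasurable.integral_prod_right' (f := fun p : ℝ × ℝ => (g (p.2 + p.1) - g p.2) / p.1) ?_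
    exact Measurable.stronglyMeasurable (by fun_prop)
  · refine (norm_integral_le_of_norm_le_const (C := 2 * C * ‖y⁻¹‖) (Eventually.of_forall fun w => ?_)).trans ?_
    · rw [div_eq_mul_inv, norm_mul]
      refine mul_le_mul_of_nonneg_right ?_ (norm_nonneg _)
      have := abs_sub (g (w + y)) (g w)
      rw [norm_eq_abs]
      linarith [hC (w + y), hC w]
    · simp

lemma integral_mul_le (h : IsSteinPair μ τ L) {g : ℝ → ℝ} (hg : Measurable g) {C : ℝ}
    (hC : ∀ w, |g w| ≤ C) {U : ℝ → ℝ} (hU : Integrable U τ)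
    (hle : ∀ y, y ≠ 0 → ∫ w, (g (w + y) - g w) / y ∂μ ≤ U y) : ∫ w, w * g w ∂μ ≤ ∫ y, U y ∂τ := by
  rw [h.stein g hg ⟨C, hC⟩]
  refine integral_mono_ae (h.integrable_inner hg hC) hU ?_
  filter_upwards [h.jump_ne_zero] with y hy using hle y hy

lemma le_integral_mul (h : IsSteinPair μ τ L) {g : ℝ → ℝ} (hg : Measurable g) {C : ℝ}
    (hC : ∀ w, |g w| ≤ C) {U : ℝ → ℝ} (hU : Integrable U τ)
    (hle : ∀ y, y ≠ 0 → U y ≤ ∫ w, (g (w + y) - g w) / y ∂μ) : ∫ y, U y ∂τ ≤ ∫ w, w * g w ∂μ := by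
  rw [h.stein g hg ⟨C, hC⟩]
  refine integral_mono_ae hU (h.integrable_inner hg hC) ?_
  filter_upwards [h.jump_ne_zero] with y hy using hle y hy

/-- The truncation of `w` to the interval `[0, A]`. -/
noncomputable def clip (A w : ℝ) : ℝ := min (max w 0) A

lemma clip_nonneg {A : ℝ} (hA : 0 ≤ A) (w : ℝ) : 0 ≤ clip A w := le_min (le_max_right _ _) hA

lemma clip_le (A w : ℝ) : clip A w ≤ A := min_le_right _ _

lemma measurable_clip (A : ℝ) : Measurable (clip A) := by unfold clip; fun_prop

lemma clip_mono (A : ℝ) : Monotone (clip A) := fun _ _ h => min_le_min_right _ (max_le_max_right _ h)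

lemma clip_sub_le {A a b : ℝ} (h : a ≤ b) : clip A b - clip A a ≤ b - a := by
  have h1 : max b 0 ≤ max a 0 + (b - a) := max_le (by linarith [le_max_left a 0]) (by linarith [le_max_right a 0])
  have : clip A b ≤ clip A a + (b - a) := by
    unfold clip
    rw [← min_add_add_right]
    exact min_le_min h1 (by linarith)
  linarith

lemma clip_sq_le {A : ℝ} (hA : 0 ≤ A) (w : ℝ) : clip A w ^ 2 ≤ w ^ 2 := by
  have h1 : clip A w ≤ max w 0 := min_le_left _ _
  have h2 := clip_nonneg hA w
  rcases le_total w 0 with h | h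
  · rw [max_eq_right h] at h1
    have : clip A w = 0 := le_antisymm h1 h2
    simpa [this] using sq_nonneg w
  · rw [max_eq_left h] at h1
    exact pow_le_pow_left₀ h2 h1 2

lemma mul_clip_pow (A w : ℝ) (hA : 0 ≤ A) : max w 0 * clip A w ^ 3 = w * clip A w ^ 3 := by
  rcases le_total w 0 with h | h
  · have : clip A w = 0 := by
      unfold clip; rw [max_eq_right h, min_eq_left hA]
    simp [this]
  · rw [max_eq_left h]

lemma clip_cube_quotient_le {A : ℝ} (hA : 0 ≤ A) (w : ℝ) {y : ℝ} (hy : y ≠ 0) :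
    (clip A (w + y) ^ 3 - clip A w ^ 3) / y ≤ 3 * clip A w ^ 2 + 3 * A * |y| := by
  have a0 := clip_nonneg hA w
  have b0 := clip_nonneg hA (w + y)
  have aA := clip_le A w
  have bA := clip_le A (w + y)
  rcases lt_or_gt_of_ne hy with hy' | hy'
  · have h1 := clip_mono A (by linarith : w + y ≤ w)
    have h2 := clip_sub_le (A := A) (by linarith : w + y ≤ w)
    rw [div_le_iff_of_neg hy', abs_of_neg hy']
    have h3 : clip A (w + y) ^ 2 + clip A (w + y) * clip A w + clip A w ^ 2 ≤ 3 * clip A w ^ 2 := by nlinarith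
    have h4 : (clip A w - clip A (w + y)) * (clip A (w + y) ^ 2 + clip A (w + y) * clip A w + clip A w ^ 2)
        ≤ (-y) * (3 * clip A w ^ 2) := mul_le_mul (by linarith) h3 (by positivity) (by linarith)
    have h5 : 0 ≤ A * y ^ 2 := by positivity
    nlinarith
  · have h1 := clip_mono A (by linarith : w ≤ w + y)
    have h2 := clip_sub_le (A := A) (by linarith : w ≤ w + y)
    rw [div_le_iff₀ hy', abs_of_pos hy']
    have h3 : clip A (w + y) ^ 2 + clip A (w + y) * clip A w + clip A w ^ 2 ≤ 3 * clip A w ^ 2 + 3 * A * y := by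
      have i1 : clip A (w + y) * clip A w ≤ clip A w ^ 2 + A * y := by nlinarith
      have i2 : clip A (w + y) ^ 2 ≤ clip A (w + y) * clip A w + A * y := by nlinarith
      linarith
    have h4 : (clip A (w + y) - clip A w) * (clip A (w + y) ^ 2 + clip A (w + y) * clip A w + clip A w ^ 2)
        ≤ y * (3 * clip A w ^ 2 + 3 * A * y) := mul_le_mul (by linarith) h3 (by positivity) (by linarith)
    nlinarith

lemma integrable_clip_pow [IsProbabilityMeasure μ] {A : ℝ} (hA : 0 ≤ A) (n : ℕ) :
    Integrable (fun w => clip A w ^ n) μ := by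
  refine Integrable.of_bound (C := A ^ n) ((measurable_clip A).pow_const n).aestronglyMeasurable
    (Eventually.of_forall fun w => ?_)
  rw [norm_pow, norm_of_nonneg (clip_nonneg hA w)]
  exact pow_le_pow_left₀ (clip_nonneg hA w) (clip_le A w) n

lemma abs_clip_pow_le {A : ℝ} (hA : 0 ≤ A) (n : ℕ) (w : ℝ) : |clip A w ^ n| ≤ A ^ n := by
  rw [abs_of_nonneg (pow_nonneg (clip_nonneg hA w) n)]
  exact pow_le_pow_left₀ (clip_nonneg hA w) (clip_le A w) n

lemma integral_clip_sq_le (h : IsSteinPair μ τ L) {A : ℝ} (hA : 0 ≤ A) :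
    ∫ w, clip A w ^ 2 ∂μ ≤ 1 := by
  have := h.isProb
  rw [← h.integral_sq]
  exact integral_mono (integrable_clip_pow hA 2) h.integrable_sq fun w => clip_sq_le hA w

lemma integral_mul_clip_cube_le (h : IsSteinPair μ τ L) {A : ℝ} (hA : 0 ≤ A) :
    ∫ w, w * clip A w ^ 3 ∂μ ≤ 3 * (1 + A * L) := by
  have := h.isProb
  have := h.isProb_jump
  have key : ∫ w, w * clip A w ^ 3 ∂μ ≤ ∫ y, (3 + 3 * A * |y|) ∂τ := by
    refine h.integral_mul_le ((measurable_clip A).pow_const 3) (abs_clip_pow_le hA 3)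
      ((integrable_const _).add (h.integrable_abs.const_mul _)) fun y hy => ?_
    have hm := measurable_clip A
    calc ∫ w, (clip A (w + y) ^ 3 - clip A w ^ 3) / y ∂μ
        ≤ ∫ w, (3 * clip A w ^ 2 + 3 * A * |y|) ∂μ := by
          refine integral_mono ?_ (((integrable_clip_pow hA 2).const_mul 3).add (integrable_const _))
            fun w => clip_cube_quotient_le hA w hy
          refine Integrable.div_const (Integrable.sub ?_ (integrable_clip_pow hA 3)) y
          refine Integrable.of_bound (C := A ^ 3) (Measurable.aestronglyMeasurable (by fun_prop))
            (Eventually.of_forall fun w => abs_clip_pow_le hA 3 _)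
      _ = 3 * ∫ w, clip A w ^ 2 ∂μ + 3 * A * |y| := by
          rw [integral_add ((integrable_clip_pow hA 2).const_mul 3) (integrable_const _), integral_const_mul]
          simp
      _ ≤ 3 + 3 * A * |y| := by linarith [h.integral_clip_sq_le hA]
  refine key.trans (le_of_eq ?_)
  rw [integral_add (integrable_const _) (h.integrable_abs.const_mul _), integral_const_mul, h.integral_abs]
  simp
  ring

lemma real_Ioi_le (h : IsSteinPair μ τ L) {x : ℝ} (hx : 0 < x) :
    μ.real (Set.Ioi x) ≤ 3 * (1 + x * L) / x ^ 4 := by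
  have := h.isProb
  rw [le_div_iff₀ (by positivity)]
  refine le_trans ?_ (h.integral_mul_clip_cube_le hx.le)
  rw [← integral_indicator_one measurableSet_Ioi, ← integral_mul_const]
  refine integral_mono (((integrable_const _).indicator measurableSet_Ioi).mul_const _)
    (h.integrable_mul_bounded ((measurable_clip x).pow_const 3) (abs_clip_pow_le hx.le 3)) fun w => ?_
  simp only
  by_cases hw : x < w
  · have : clip x w = x := by unfold clip; rw [max_eq_left (by linarith), min_eq_right hw.le]
    rw [Set.indicator_of_mem (by exact hw), this]
    simp only [Pi.one_apply, one_mul]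
    nlinarith [pow_pos hx 3]
  · rw [Set.indicator_of_notMem (by exact hw), zero_mul, ← mul_clip_pow _ _ hx.le]
    have := clip_nonneg hx.le w
    positivity

/-- Concentration inequality for increments of a slope. -/
lemma mul_integral_slope_sub_le (h : IsSteinPair μ τ L) {H J : ℝ → ℝ} (hs : IsSlope H J) {a b κ : ℝ}
    (hab : a ≤ b) (hκ : 0 < κ) :
    (1 - L / (4 * κ)) * (∫ w, J (w + b) ∂μ - ∫ w, J (w + a) ∂μ) ≤
      (b - a + 2 * κ) * ∫ w, max w 0 * J (w + b + κ) ∂μ := by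
  have := h.isProb
  have := h.isProb_jump
  have hH := hs.measurable
  have hJm := hs.measurable_slope
  have hInt : Integrable (fun w => max w 0 * J (w + b + κ)) μ := by
    refine (h.integrable_id.sup (integrable_const 0)).mul_bdd (c := 1) (Measurable.aestronglyMeasurable (by fun_prop))
      (Eventually.of_forall fun w => ?_)
    rw [norm_of_nonneg (hs.nonneg _)]
    exact hs.le_one _
  have hg : Measurable fun w => H (w + b + κ) - H (w + a - κ) := by fun_prop
  have hgb : ∀ w, |H (w + b + κ) - H (w + a - κ)| ≤ b - a + 2 * κ := by
    intro w
    refine (hs.abs_sub_le _ _).trans (le_of_eq ?_)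
    rw [abs_of_nonneg (by linarith)]
    ring
  have hg0 : ∀ w, 0 ≤ H (w + b + κ) - H (w + a - κ) := fun w =>
    sub_nonneg.2 (hs.mono_fun (by linarith))
  have hup : ∫ w, w * (H (w + b + κ) - H (w + a - κ)) ∂μ ≤
      (b - a + 2 * κ) * ∫ w, max w 0 * J (w + b + κ) ∂μ := by
    rw [← integral_const_mul]
    refine integral_mono (h.integrable_mul_bounded hg hgb) (hInt.const_mul _) fun w => ?_
    have h1 := hs.sub_le (w + a - κ) (w + b + κ)
    have e : w + b + κ - (w + a - κ) = b - a + 2 * κ := by ring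
    rw [e] at h1
    calc w * (H (w + b + κ) - H (w + a - κ)) ≤ max w 0 * (H (w + b + κ) - H (w + a - κ)) :=
          mul_le_mul_of_nonneg_right (le_max_left _ _) (hg0 w)
      _ ≤ max w 0 * ((b - a + 2 * κ) * J (w + b + κ)) := mul_le_mul_of_nonneg_left h1 (le_max_right _ _)
      _ = _ := by ring
  refine le_trans ?_ hup
  set D := ∫ w, J (w + b) ∂μ - ∫ w, J (w + a) ∂μ with hD
  have hU : Integrable (fun y : ℝ => (1 - |y| / (4 * κ)) * D) τ :=
    ((integrable_const _).sub (h.integrable_abs.div_const _)).mul_const _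
  have hDe : D = ∫ w, (J (w + b) - J (w + a)) ∂μ :=
    (integral_sub (hs.integrable_slope μ b) (hs.integrable_slope μ a)).symm
  refine le_trans (le_of_eq ?_) (h.le_integral_mul hg hgb hU fun y hy => ?_)
  · rw [integral_mul_const, integral_sub (integrable_const _) (h.integrable_abs.div_const _),
      integral_div, h.integral_abs]
    simp
  · rw [hDe, ← integral_const_mul]
    refine integral_mono (((hs.integrable_slope μ b).sub (hs.integrable_slope μ a)).const_mul _) ?_
      fun w => hs.min_mul_le hab hκ w hy
    refine Integrable.div_const (Integrable.sub ?_ ?_) y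
    · exact Integrable.of_bound (C := b - a + 2 * κ) (Measurable.aestronglyMeasurable (by fun_prop))
        (Eventually.of_forall fun w => hgb (w + y))
    · exact Integrable.of_bound (C := b - a + 2 * κ) hg.aestronglyMeasurable (Eventually.of_forall hgb)

end IsSteinPair

/-- A slope whose shifts by at most `0.405 x` are negligible away from the tail `w ≥ x`. -/
structure IsTailSlope (x : ℝ) (H J : ℝ → ℝ) : Prop where
  isSlope : IsSlope H J
  le_cube : ∀ β w, 0 ≤ β → β ≤ 0.405 →
    J (w + β * x) ≤ (IsSteinPair.clip ((1 - β) * x) w / ((1 - β) * x)) ^ 3 + 1 / (10 * x ^ 3)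

lemma isTailSlope_convexStein {x : ℝ} (hx : 4 ≤ x) : IsTailSlope x (convexStein x) (slopeStein x) :=
  ⟨isSlope_convexStein x, fun _ _ h0 h1 => slopeStein_le hx h0 h1⟩

lemma isTailSlope_posPart {x : ℝ} (hx : 0 < x) :
    IsTailSlope x (fun w => max (w - x) 0) ((Set.Ioi x).indicator fun _ => 1) := by
  refine ⟨isSlope_posPart x, fun β w h0 h1 => ?_⟩
  have hA : 0 < (1 - β) * x := mul_pos (by norm_num at h1; linarith) hx
  have hc := IsSteinPair.clip_nonneg hA.le w
  by_cases hw : x < w + β * x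
  · have : IsSteinPair.clip ((1 - β) * x) w = (1 - β) * x := by
      have : (1 - β) * x ≤ w := by linarith
      unfold IsSteinPair.clip
      rw [max_eq_left (by linarith), min_eq_right this]
    rw [Set.indicator_of_mem (by exact hw), this, div_self hA.ne']
    have : 0 ≤ 1 / (10 * x ^ 3) := by positivity
    linarith
  · rw [Set.indicator_of_notMem (by exact hw)]
    positivity

lemma shift_cube_bound {ρ k : ℝ} (h0 : 0 ≤ ρ) (h1 : ρ ≤ 0.4) (k0 : 0 ≤ k) (k1 : k ≤ 0.00464) :
    ρ + 2 * k ≤ (2.1 * k + 5 * ρ) * (1 - ρ - k) ^ 3 := by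
  have hk2 : 0 ≤ 2.1 * k + 5 * ρ := by positivity
  rcases le_total 0.15 ρ with h | h
  · have : (0.211 : ℝ) ≤ (1 - ρ - k) ^ 3 := by
      calc (0.211 : ℝ) ≤ 0.59536 ^ 3 := by norm_num
        _ ≤ _ := pow_le_pow_left₀ (by norm_num) (by norm_num at *; linarith) 3
    have := mul_le_mul_of_nonneg_left this hk2
    norm_num at *
    linarith
  · have i1 : (0.6 : ℝ) ≤ (1 - ρ - k) ^ 3 := by
      calc (0.6 : ℝ) ≤ 0.8453 ^ 3 := by norm_num
        _ ≤ _ := pow_le_pow_left₀ (by norm_num) (by norm_num at *; linarith) 3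
    have i2 : 1 - 3 * (ρ + k) ≤ (1 - ρ - k) ^ 3 := by
      have := one_add_mul_le_pow (a := -(ρ + k)) (by norm_num at *; linarith) 3
      push_cast at this
      calc _ ≤ _ := by linarith
        _ ≤ _ := this
        _ = _ := by ring
    have j1 := mul_le_mul_of_nonneg_left i1 h0
    have j2 := mul_le_mul_of_nonneg_left i2 k0
    have j3 : k * ρ ≤ 0.00464 * ρ := mul_le_mul_of_nonneg_right k1 h0
    have j4 : k * k ≤ 0.00464 * k := mul_le_mul_of_nonneg_right k1 k0
    norm_num at *
    linarith

namespace IsSteinPair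

variable {μ τ : Measure ℝ} {L x : ℝ} {H J : ℝ → ℝ}

lemma integral_max_le_one (h : IsSteinPair μ τ L) : ∫ w, max w 0 ∂μ ≤ 1 := by
  have := h.isProb
  have hi : Integrable (fun w : ℝ => (1 + w ^ 2) / 2) μ := ((integrable_const _).add h.integrable_sq).div_const 2
  calc ∫ w, max w 0 ∂μ ≤ ∫ w, (1 + w ^ 2) / 2 ∂μ := by
        refine integral_mono (h.integrable_id.sup (integrable_const 0)) hi fun w => ?_
        exact max_le (by nlinarith [sq_nonneg (w - 1)]) (by positivity)
    _ = 1 := by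
        rw [integral_div, integral_add (integrable_const _) h.integrable_sq, h.integral_sq]
        norm_num

lemma integral_max_mul_le (h : IsSteinPair μ τ L) (hx : 0 < x) (hJ : IsTailSlope x H J) {β : ℝ}
    (h0 : 0 ≤ β) (h1 : β ≤ 0.405) :
    ∫ w, max w 0 * J (w + β * x) ∂μ ≤
      3 * (1 + (1 - β) * x * L) / ((1 - β) * x) ^ 3 + 1 / (10 * x ^ 3) := by
  have := h.isProb
  have hA : 0 < (1 - β) * x := mul_pos (by norm_num at h1; linarith) hx
  set A := (1 - β) * x with hAdef
  have hJm := hJ.isSlope.measurable_slope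
  have hmax : Integrable (fun w : ℝ => max w 0) μ := h.integrable_id.sup (integrable_const 0)
  have hInt : Integrable (fun w => max w 0 * J (w + β * x)) μ := by
    refine hmax.mul_bdd (c := 1) (Measurable.aestronglyMeasurable (by fun_prop))
      (Eventually.of_forall fun w => ?_)
    rw [norm_of_nonneg (hJ.isSlope.nonneg _)]
    exact hJ.isSlope.le_one _
  have hclip : Integrable (fun w => w * clip A w ^ 3) μ :=
    h.integrable_mul_bounded ((measurable_clip A).pow_const 3) (abs_clip_pow_le hA.le 3)
  calc ∫ w, max w 0 * J (w + β * x) ∂μ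
      ≤ ∫ w, (w * clip A w ^ 3 / A ^ 3 + max w 0 * (1 / (10 * x ^ 3))) ∂μ := by
        refine integral_mono hInt ((hclip.div_const _).add (hmax.mul_const _)) fun w => ?_
        have := mul_le_mul_of_nonneg_left (hJ.le_cube β w h0 h1) (le_max_right w 0)
        rw [mul_add, ← hAdef, div_pow, ← mul_div_assoc, mul_clip_pow _ _ hA.le] at this
        exact this
    _ = (∫ w, w * clip A w ^ 3 ∂μ) / A ^ 3 + (∫ w, max w 0 ∂μ) * (1 / (10 * x ^ 3)) := by
        rw [integral_add (hclip.div_const _) (hmax.mul_const _), integral_div, integral_mul_const]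
    _ ≤ _ := by
        have i1 := h.integral_mul_clip_cube_le hA.le
        have i2 := h.integral_max_le_one
        have : 0 ≤ 1 / (10 * x ^ 3) := by positivity
        have := mul_le_mul_of_nonneg_right i2 this
        have := div_le_div_of_nonneg_right i1 (by positivity : 0 ≤ A ^ 3)
        linarith

lemma slope_increment_le (h : IsSteinPair μ τ L) (hx : 4 ≤ x) (hL : x * L ≤ 0.106)
    (hJ : IsTailSlope x H J) {a b : ℝ} (hab : a ≤ b) (ha : a ≤ 0) (hu : b - a ≤ 0.4 * x) :
    ∫ w, J (w + b) ∂μ - ∫ w, J (w + a) ∂μ ≤ (7.81 * L + 25.97 * (b - a)) / x ^ 3 := by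
  have := h.isProb
  have hx0 : 0 < x := by linarith
  have hLp := h.L_pos
  set u := b - a with hudef
  set κ := 0.7 * L with hκdef
  have hκ : 0 < κ := by positivity
  have hu0 : 0 ≤ u := sub_nonneg.2 hab
  have hconc := h.mul_integral_slope_sub_le hJ.isSlope hab hκ
  have hL4 : L / (4 * κ) = 5 / 14 := by
    rw [hκdef]; field_simp; norm_num
  rw [hL4] at hconc
  have hLx : L ≤ 0.106 / 16 * x := by
    have : L * 4 ≤ x * L := by nlinarith
    norm_num at *
    linarith
  set β := (u + κ) / x with hβdef
  have hβx : β * x = u + κ := by rw [hβdef]; field_simp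
  have hβ0 : 0 ≤ β := by positivity
  have hβ1 : β ≤ 0.405 := by
    rw [hβdef, div_le_iff₀ hx0]
    norm_num at *
    linarith
  have hJm := hJ.isSlope.measurable_slope
  have hmax : Integrable (fun w : ℝ => max w 0) μ := h.integrable_id.sup (integrable_const 0)
  have hInt : ∀ c, Integrable (fun w => max w 0 * J (w + c)) μ := by
    intro c
    refine hmax.mul_bdd (c := 1) (Measurable.aestronglyMeasurable (by fun_prop))
      (Eventually.of_forall fun w => ?_)
    rw [norm_of_nonneg (hJ.isSlope.nonneg _)]
    exact hJ.isSlope.le_one _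
  have hmono : ∫ w, max w 0 * J (w + b + κ) ∂μ ≤ ∫ w, max w 0 * J (w + β * x) ∂μ := by
    refine integral_mono (by simpa only [add_assoc] using hInt (b + κ)) (hInt _) fun w => ?_
    refine mul_le_mul_of_nonneg_left (hJ.isSlope.mono ?_) (le_max_right _ _)
    rw [hβx]
    linarith
  have hE := hmono.trans (h.integral_max_mul_le hx0 hJ hβ0 hβ1)
  have hA : (1 - β) * x = x - u - κ := by rw [sub_mul, hβx]; ring
  have hApos : 0 < x - u - κ := by
    rw [← hA]; exact mul_pos (by norm_num at hβ1; linarith) hx0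
  rw [hA] at hE
  have hcube : (u + 2 * κ) / (x - u - κ) ^ 3 ≤ (2.1 * κ + 5 * u) / x ^ 3 := by
    have hs := shift_cube_bound (ρ := u / x) (k := κ / x) (by positivity)
      (by rw [div_le_iff₀ hx0]; exact hu) (by positivity)
      (by rw [div_le_iff₀ hx0]; norm_num at *; linarith)
    rw [div_le_div_iff₀ (by positivity) (by positivity)]
    have e1 : (1 - u / x - κ / x) = (x - u - κ) / x := by field_simp
    rw [e1, div_pow] at hs
    have := mul_le_mul_of_nonneg_right hs (by positivity : 0 ≤ x ^ 4)
    have e2 : (u / x + 2 * (κ / x)) * x ^ 4 = x * ((u + 2 * κ) * x ^ 3) / x := by field_simp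
    have e3 : (2.1 * (κ / x) + 5 * (u / x)) * ((x - u - κ) ^ 3 / x ^ 3) * x ^ 4 =
      (2.1 * κ + 5 * u) * (x - u - κ) ^ 3 := by field_simp
    rw [e2, e3, mul_comm x, mul_div_assoc, div_self hx0.ne', mul_one] at this
    exact this
  have hnum : 3 * (1 + (x - u - κ) * L) ≤ 3.318 := by
    have : (x - u - κ) * L ≤ x * L := mul_le_mul_of_nonneg_right (by linarith) hLp.le
    norm_num at *
    linarith
  have hE' : ∫ w, max w 0 * J (w + b + κ) ∂μ ≤ 3.318 / (x - u - κ) ^ 3 + 1 / (10 * x ^ 3) := by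
    refine hE.trans ?_
    have := div_le_div_of_nonneg_right hnum (by positivity : 0 ≤ (x - u - κ) ^ 3)
    linarith
  have hprod := mul_le_mul_of_nonneg_left hE' (by positivity : 0 ≤ u + 2 * κ)
  have hsplit : (u + 2 * κ) * (3.318 / (x - u - κ) ^ 3 + 1 / (10 * x ^ 3)) =
      3.318 * ((u + 2 * κ) / (x - u - κ) ^ 3) + (0.1 * (u + 2 * κ)) / x ^ 3 := by
    field_simp
    ring
  rw [hsplit] at hprod
  have hfin : 3.318 * ((2.1 * κ + 5 * u) / x ^ 3) + (0.1 * (u + 2 * κ)) / x ^ 3 ≤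
      (9 / 14) * ((7.81 * L + 25.97 * u) / x ^ 3) := by
    rw [← mul_div_assoc, ← add_div, ← mul_div_assoc]
    refine div_le_div_of_nonneg_right ?_ (by positivity)
    rw [hκdef]
    norm_num
    linarith
  norm_num at hconc hfin hcube hprod ⊢
  linarith

lemma abs_integral_slope_sub_le (h : IsSteinPair μ τ L) (hx : 4 ≤ x) (hL : x * L ≤ 0.106)
    (hJ : IsTailSlope x H J) {y : ℝ} (hy : y ≠ 0) (hy' : |y| ≤ 0.4 * x) :
    (0 < y → ∫ w, (J w - (H (w + y) - H w) / y) ∂μ ∈ Set.Icc (-((7.81 * L + 13.64 * |y|) / x ^ 3)) 0) ∧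
    (y < 0 → ∫ w, (J w - (H (w + y) - H w) / y) ∂μ ∈ Set.Icc 0 ((7.81 * L + 13.64 * |y|) / x ^ 3)) := by
  have := h.isProb
  have hx0 : 0 < x := by linarith
  have hLp := h.L_pos
  have hs := hJ.isSlope
  have hJi : Integrable J μ := by simpa using hs.integrable_slope μ 0
  have hq := hs.integrable_quotient μ y
  have hsum : Integrable (fun w => (∑ k ∈ Finset.range 20, J (w + (k + 1) * (y / 20))) / 20) μ :=
    (integrable_finsetSum _ fun k _ => hs.integrable_slope μ _).div_const _
  have hkey := fun w => hs.sub_le_sum w (y / 20) 20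
  have hsumint : ∫ w, (J w - (∑ k ∈ Finset.range 20, J (w + (k + 1) * (y / 20))) / 20) ∂μ =
      (∑ k ∈ Finset.range 20, (∫ w, J w ∂μ - ∫ w, J (w + (k + 1) * (y / 20)) ∂μ)) / 20 := by
    rw [integral_sub hJi hsum, integral_div, integral_finsetSum _ fun k _ => hs.integrable_slope μ _,
      Finset.sum_sub_distrib]
    simp
    ring
  have hcoef : (∑ k ∈ Finset.range 20, (7.81 * L + 25.97 * ((k + 1) * (|y| / 20))) / x ^ 3) / 20 ≤
      (7.81 * L + 13.64 * |y|) / x ^ 3 := by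
    rw [← Finset.sum_div, div_right_comm]
    refine div_le_div_of_nonneg_right ?_ (by positivity)
    have := abs_nonneg y
    norm_num [Finset.sum_range_succ]
    linarith
  have hk20 : ∀ k ∈ Finset.range 20, ((k : ℝ) + 1) * (|y| / 20) ≤ 0.4 * x := by
    intro k hk
    have : (k : ℝ) + 1 ≤ 20 := by exact_mod_cast Finset.mem_range.1 hk
    refine le_trans ?_ hy'
    have := mul_le_mul_of_nonneg_right this (by positivity : 0 ≤ |y| / 20)
    linarith
  constructor
  · intro hpos
    rw [abs_of_pos hpos] at *
    have hstep : ∀ k ∈ Finset.range 20, -((7.81 * L + 25.97 * ((k + 1) * (y / 20))) / x ^ 3) ≤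
        ∫ w, J w ∂μ - ∫ w, J (w + (k + 1) * (y / 20)) ∂μ := by
      intro k hk
      have h0 : 0 ≤ ((k : ℝ) + 1) * (y / 20) := by positivity
      have := h.slope_increment_le hx hL hJ (a := 0) h0 le_rfl (by simpa using hk20 k hk)
      simp only [add_zero, sub_zero] at this
      linarith
    refine ⟨?_, ?_⟩
    · have h1 : ∫ w, (J w - (∑ k ∈ Finset.range 20, J (w + (k + 1) * (y / 20))) / 20) ∂μ ≤
          ∫ w, (J w - (H (w + y) - H w) / y) ∂μ := by
        refine integral_mono (hJi.sub hsum) (hJi.sub hq) fun w => ?_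
        have := hkey w
        have e : w + ((20 : ℕ) : ℝ) * (y / 20) = w + y := by push_cast; ring
        rw [e] at this
        have h2 : (H (w + y) - H w) / y ≤ (∑ k ∈ Finset.range 20, J (w + (k + 1) * (y / 20))) / 20 := by
          rw [div_le_iff₀ hpos]
          linarith
        simp only
        linarith
      refine le_trans ?_ h1
      rw [hsumint]
      have := Finset.sum_le_sum hstep
      rw [Finset.sum_neg_distrib] at this
      linarith
    · refine integral_nonpos fun w => ?_
      have := hs.slope w (w + y)
      have h2 : J w ≤ (H (w + y) - H w) / y := by
        rw [le_div_iff₀ hpos]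
        linarith
      simpa using h2
  · intro hneg
    rw [abs_of_neg hneg] at *
    have hstep : ∀ k ∈ Finset.range 20, ∫ w, J w ∂μ - ∫ w, J (w + (k + 1) * (y / 20)) ∂μ ≤
        (7.81 * L + 25.97 * ((k + 1) * (-y / 20))) / x ^ 3 := by
      intro k hk
      have h0 : ((k : ℝ) + 1) * (y / 20) ≤ 0 :=
        mul_nonpos_of_nonneg_of_nonpos (by positivity) (by linarith)
      have h3 : 0 - ((k : ℝ) + 1) * (y / 20) = (k + 1) * (-y / 20) := by ring
      have := h.slope_increment_le hx hL hJ (b := 0) h0 h0 (by rw [h3]; exact hk20 k hk)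
      rw [h3] at this
      simpa only [add_zero] using this
    refine ⟨?_, ?_⟩
    · refine integral_nonneg fun w => ?_
      have := hs.slope w (w + y)
      have h2 : (H (w + y) - H w) / y ≤ J w := by
        rw [div_le_iff_of_neg hneg]
        linarith
      simpa using h2
    · have h1 : ∫ w, (J w - (H (w + y) - H w) / y) ∂μ ≤
          ∫ w, (J w - (∑ k ∈ Finset.range 20, J (w + (k + 1) * (y / 20))) / 20) ∂μ := by
        refine integral_mono (hJi.sub hq) (hJi.sub hsum) fun w => ?_
        have := hkey w
        have e : w + ((20 : ℕ) : ℝ) * (y / 20) = w + y := by push_cast; ring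
        rw [e] at this
        have h2 : (∑ k ∈ Finset.range 20, J (w + (k + 1) * (y / 20))) / 20 ≤ (H (w + y) - H w) / y := by
          rw [le_div_iff_of_neg hneg]
          linarith
        simp only
        linarith
      refine h1.trans ?_
      rw [hsumint]
      have := Finset.sum_le_sum hstep
      linarith

end IsSteinPair

namespace IsSteinPair

variable {μ τ : Measure ℝ} {L x : ℝ}

lemma real_Iic_sub_eq (h : IsSteinPair μ τ L) (hx : 0 < x) :
    μ.real (Set.Iic x) - (gaussianReal 0 1).real (Set.Iic x) =
      ∫ y, (∫ w, (slopeStein x w - (Set.Ioi x).indicator (fun _ => 1) w) ∂μ -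
        ∫ w, (tailStein x (w + y) - tailStein x w) / y ∂μ) ∂τ := by
  have := h.isProb
  have := h.isProb_jump
  have hfm := measurable_tailStein x
  have hfb : ∀ w, |tailStein x w| ≤ 1 / x := fun w => by
    rw [abs_of_nonneg (tailStein_nonneg x w)]; exact tailStein_le hx w
  have hst := h.stein _ hfm ⟨_, hfb⟩
  have hmul := h.integrable_mul_bounded hfm hfb
  have hind : Integrable ((Set.Ioi x).indicator fun _ => (1 : ℝ)) μ :=
    (integrable_const _).indicator measurableSet_Ioi
  rw [integral_sub (integrable_const _) (h.integrable_inner hfm hfb), ← hst]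
  have e1 : ∫ w, (slopeStein x w - (Set.Ioi x).indicator (fun _ => 1) w) ∂μ =
      ∫ w, w * tailStein x w ∂μ + gaussTail x / √(2 * π) - μ.real (Set.Ioi x) := by
    simp only [slopeStein]
    have hadd : Integrable (fun w => w * tailStein x w + gaussTail x / √(2 * π)) μ :=
      hmul.add (integrable_const _)
    rw [integral_sub hadd hind, integral_add hmul (integrable_const _)]
    have : ∫ w, (Set.Ioi x).indicator (fun _ => (1 : ℝ)) w ∂μ = μ.real (Set.Ioi x) :=
      integral_indicator_one measurableSet_Ioi
    rw [this]
    simp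
  have e2 : μ.real (Set.Iic x) = 1 - μ.real (Set.Ioi x) := by
    rw [← Set.compl_Ioi, probReal_compl_eq_one_sub measurableSet_Ioi]
  rw [e1, e2, gaussianReal_real_Iic_eq_sub]
  simp
  ring

lemma abs_integral_slopeStein_sub_le (h : IsSteinPair μ τ L) (hx : 4 ≤ x) :
    |∫ w, (slopeStein x w - (Set.Ioi x).indicator (fun _ => 1) w) ∂μ| ≤ 1 / x ^ 2 + 1 / (10 * x ^ 3) := by
  have := h.isProb
  have hx0 : 0 < x := by linarith
  have hε : 0 ≤ 1 / (10 * x ^ 3) := by positivity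
  have hs := isSlope_convexStein x
  have hpt : ∀ w, |slopeStein x w - (Set.Ioi x).indicator (fun _ => 1) w| ≤
      clip x w ^ 2 / x ^ 2 + 1 / (10 * x ^ 3) := by
    intro w
    have hc := clip_nonneg hx0.le w
    have hr1 : clip x w / x ≤ 1 := div_le_one_of_le₀ (clip_le x w) hx0.le
    have hr0 : 0 ≤ clip x w / x := by positivity
    by_cases hw : x < w
    · have hcx : clip x w = x := by unfold clip; rw [max_eq_left (by linarith), min_eq_right hw.le]
      rw [Set.indicator_of_mem (by exact hw), hcx, div_self (by positivity), abs_le]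
      constructor <;> linarith [hs.nonneg w, hs.le_one w]
    · rw [Set.indicator_of_notMem (by exact hw), sub_zero, abs_of_nonneg (hs.nonneg w)]
      have := (isTailSlope_convexStein hx).le_cube 0 w le_rfl (by norm_num)
      simp only [zero_mul, add_zero, sub_zero, one_mul] at this
      refine this.trans (add_le_add_left ?_ _)
      rw [← div_pow]
      exact pow_le_pow_of_le_one hr0 hr1 (by norm_num)
  have hU : Integrable (fun w => clip x w ^ 2 / x ^ 2 + 1 / (10 * x ^ 3)) μ :=
    ((integrable_clip_pow hx0.le 2).div_const (x ^ 2)).add (integrable_const _)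
  rw [← norm_eq_abs]
  refine (norm_integral_le_of_norm_le hU (Eventually.of_forall hpt)).trans ?_
  rw [integral_add ((integrable_clip_pow hx0.le 2).div_const (x ^ 2)) (integrable_const _), integral_div]
  have := div_le_div_of_nonneg_right (h.integral_clip_sq_le hx0.le) (by positivity : 0 ≤ x ^ 2)
  simp only [integral_const, probReal_univ, one_smul]
  linarith

lemma abs_stein_kernel_le (h : IsSteinPair μ τ L) (hx : 4 ≤ x) (hL : x * L ≤ 0.106) {y : ℝ} (hy : y ≠ 0) :
    |∫ w, (slopeStein x w - (Set.Ioi x).indicator (fun _ => 1) w) ∂μ -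
        ∫ w, (tailStein x (w + y) - tailStein x w) / y ∂μ| ≤ (7.81 * L + 13.64 * |y|) / x ^ 3 := by
  have := h.isProb
  have hx0 : 0 < x := by linarith
  have hLp := h.L_pos
  have hy0 : 0 < |y| := abs_pos.2 hy
  rcases le_total |y| (0.4 * x) with hle | hge
  · have h1 := isTailSlope_convexStein hx
    have h2 := isTailSlope_posPart hx0
    have b1 := h.abs_integral_slope_sub_le hx hL h1 hy hle
    have b2 := h.abs_integral_slope_sub_le hx hL h2 hy hle
    have j1 : Integrable (slopeStein x) μ := by simpa using h1.isSlope.integrable_slope μ 0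
    have j2 : Integrable ((Set.Ioi x).indicator fun _ => (1 : ℝ)) μ := by
      simpa using h2.isSlope.integrable_slope μ 0
    have q1 := h1.isSlope.integrable_quotient μ y
    have q2 := h2.isSlope.integrable_quotient μ y
    have e : ∫ w, (slopeStein x w - (Set.Ioi x).indicator (fun _ => 1) w) ∂μ -
        ∫ w, (tailStein x (w + y) - tailStein x w) / y ∂μ =
        ∫ w, (slopeStein x w - (convexStein x (w + y) - convexStein x w) / y) ∂μ -
        ∫ w, ((Set.Ioi x).indicator (fun _ => 1) w - (max (w + y - x) 0 - max (w - x) 0) / y) ∂μ := by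
      have e' : ∫ w, (tailStein x (w + y) - tailStein x w) / y ∂μ =
          ∫ w, (convexStein x (w + y) - convexStein x w) / y ∂μ -
          ∫ w, (max (w + y - x) 0 - max (w - x) 0) / y ∂μ := by
        rw [← integral_sub q1 q2]
        refine integral_congr_ae (Eventually.of_forall fun w => ?_)
        simp only [convexStein]
        ring
      rw [e', integral_sub j1 j2, integral_sub j1 q1, integral_sub j2 q2]
      ring
    rw [e, abs_le]
    rcases lt_or_gt_of_ne hy with hn | hp
    · have c1 := b1.2 hn
      have c2 := b2.2 hn
      constructor <;> linarith [c1.1, c1.2, c2.1, c2.2]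
    · have c1 := b1.1 hp
      have c2 := b2.1 hp
      constructor <;> linarith [c1.1, c1.2, c2.1, c2.2]
  · have b1 := h.abs_integral_slopeStein_sub_le hx
    have b2 : |∫ w, (tailStein x (w + y) - tailStein x w) / y ∂μ| ≤ 1 / (x * |y|) := by
      rw [← norm_eq_abs]
      refine (norm_integral_le_of_norm_le_const (μ := μ) (C := 1 / (x * |y|)) (Eventually.of_forall fun w => ?_)).trans
        (le_of_eq (by rw [probReal_univ, mul_one]))
      rw [norm_div, norm_eq_abs, norm_eq_abs, ← div_div]
      refine div_le_div_of_nonneg_right ?_ hy0.le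
      rw [abs_le]
      constructor <;>
        linarith [tailStein_nonneg x w, tailStein_nonneg x (w + y), tailStein_le hx0 w, tailStein_le hx0 (w + y)]
    have b3 : 1 / x ^ 2 ≤ 2.5 * |y| / x ^ 3 := by
      rw [div_le_div_iff₀ (by positivity) (by positivity)]
      have := mul_le_mul_of_nonneg_left hge (by positivity : 0 ≤ x ^ 2)
      norm_num at *
      nlinarith
    have b4 : 1 / (10 * x ^ 3) ≤ 0.1 * |y| / x ^ 3 := by
      rw [div_le_div_iff₀ (by positivity) (by positivity)]
      have h1 : 1 ≤ |y| := by norm_num at hge; linarith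
      have := mul_le_mul_of_nonneg_left h1 (by positivity : 0 ≤ x ^ 3)
      norm_num at *
      nlinarith
    have b5 : 1 / (x * |y|) ≤ 6.25 * |y| / x ^ 3 := by
      rw [div_le_div_iff₀ (by positivity) (by positivity)]
      have h1 : (0.4 * x) ^ 2 ≤ |y| ^ 2 := pow_le_pow_left₀ (by positivity) hge 2
      have h2 := mul_le_mul_of_nonneg_left h1 hx0.le
      calc 1 * x ^ 3 = 6.25 * (x * (0.4 * x) ^ 2) := by ring
        _ ≤ 6.25 * (x * |y| ^ 2) := by linarith
        _ = _ := by ring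
    have b6 : 2.5 * |y| / x ^ 3 + 0.1 * |y| / x ^ 3 + 6.25 * |y| / x ^ 3 ≤
        (7.81 * L + 13.64 * |y|) / x ^ 3 := by
      rw [← add_div, ← add_div]
      refine div_le_div_of_nonneg_right ?_ (by positivity)
      norm_num
      linarith
    refine (abs_sub _ _).trans ?_
    linarith

lemma gaussTail_div_le {x : ℝ} (hx : 4 ≤ x) : gaussTail x / √(2 * π) ≤ 3 / x ^ 4 := by
  have hx0 : 0 < x := by linarith
  have h1 := mul_gaussTail_le x
  have h2 := exp_neg_three_eighths_le hx
  have h3 : exp (-x ^ 2 / 2) ≤ exp (-(3 * x ^ 2 / 8)) := exp_le_exp.2 (by nlinarith [sq_nonneg x])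
  have h4 : 1 ≤ √(2 * π) := by
    rw [Real.one_le_sqrt]; linarith [pi_gt_three]
  have h5 : gaussTail x / √(2 * π) ≤ gaussTail x := div_le_self (gaussTail_pos x).le h4
  refine h5.trans ?_
  rw [le_div_iff₀ (by positivity)]
  have h6 : x * gaussTail x ≤ 1 / (6 * x ^ 3) := h1.trans (h3.trans h2)
  have h7 := mul_le_mul_of_nonneg_left h6 (by positivity : 0 ≤ x ^ 3)
  have e : x ^ 3 * (1 / (6 * x ^ 3)) = 1 / 6 := by field_simp
  rw [e] at h7
  nlinarith

lemma abs_real_Iic_sub_le_cube (h : IsSteinPair μ τ L) (hx : 4 ≤ x) :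
    |μ.real (Set.Iic x) - (gaussianReal 0 1).real (Set.Iic x)| ≤ 31.44 * L / x ^ 3 := by
  have := h.isProb
  have := h.isProb_jump
  have hx0 : 0 < x := by linarith
  have hLp := h.L_pos
  rcases le_total (x * L) 0.106 with hL | hL
  · rw [h.real_Iic_sub_eq hx0]
    have hU : Integrable (fun y : ℝ => (7.81 * L + 13.64 * |y|) / x ^ 3) τ :=
      ((integrable_const _).add (h.integrable_abs.const_mul _)).div_const _
    rw [← norm_eq_abs]
    refine (norm_integral_le_of_norm_le (μ := τ) hU ?_).trans ?_
    · filter_upwards [h.jump_ne_zero] with y hy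
      rw [norm_eq_abs]
      exact h.abs_stein_kernel_le hx hL hy
    · rw [integral_div, integral_add (integrable_const _) (h.integrable_abs.const_mul _)]
      simp only [integral_const_mul, h.integral_abs, integral_const, probReal_univ, one_smul]
      refine div_le_div_of_nonneg_right ?_ (by positivity)
      norm_num
      linarith
  · have e2 : μ.real (Set.Iic x) = 1 - μ.real (Set.Ioi x) := by
      rw [← Set.compl_Ioi, probReal_compl_eq_one_sub measurableSet_Ioi]
    rw [e2, gaussianReal_real_Iic_eq_sub]
    have b1 := h.real_Ioi_le hx0
    have b2 := gaussTail_div_le hx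
    have b3 : 3 * (1 + x * L) / x ^ 4 ≤ 31.44 * L / x ^ 3 := by
      rw [div_le_div_iff₀ (by positivity) (by positivity)]
      have : 3 * (1 + x * L) ≤ 31.44 * (x * L) := by norm_num at *; linarith
      have := mul_le_mul_of_nonneg_right this (by positivity : 0 ≤ x ^ 3)
      norm_num at *
      nlinarith
    have b4 : 3 / x ^ 4 ≤ 3 * (1 + x * L) / x ^ 4 :=
      div_le_div_of_nonneg_right (by nlinarith) (by positivity)
    have b5 : 0 ≤ gaussTail x / √(2 * π) := div_nonneg (gaussTail_pos x).le (sqrt_nonneg _)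
    have b6 : 0 ≤ μ.real (Set.Ioi x) := measureReal_nonneg
    rw [abs_le]
    constructor <;> linarith

lemma abs_real_Iic_sub_le_cube_neg (h : IsSteinPair μ τ L) (hx : 4 < x) :
    |μ.real (Set.Iic (-x)) - (gaussianReal 0 1).real (Set.Iic (-x))| ≤ 31.44 * L / x ^ 3 := by
  have := h.isProb
  have hx0 : 0 < x := by linarith
  have hF : ∀ z, 4 ≤ z → |(1 - μ.real (Set.Iio (-z))) - (gaussianReal 0 1).real (Set.Iic z)| ≤
      31.44 * L / z ^ 3 := by
    intro z hz
    have := h.neg.abs_real_Iic_sub_le_cube hz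
    have e := map_neg_real_Iic (μ := μ) (-z)
    rw [neg_neg] at e
    rwa [e] at this
  rw [gaussianReal_real_Iic_neg]
  have hcont : Continuous fun z => (gaussianReal 0 1).real (Set.Iic z) := by
    simp only [gaussianReal_real_Iic_eq_sub]
    refine continuous_const.sub (Continuous.div_const ?_ _)
    exact continuous_iff_continuousAt.2 fun w => (hasDerivAt_gaussTail w).continuousAt
  have hlo := abs_le.1 (hF x hx.le)
  have hle : μ.real (Set.Iio (-x)) ≤ μ.real (Set.Iic (-x)) := measureReal_mono Set.Iio_subset_Iic_self
  have hup : μ.real (Set.Iic (-x)) - (1 - (gaussianReal 0 1).real (Set.Iic x)) ≤ 31.44 * L / x ^ 3 := by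
    have hlim : Tendsto (fun z => 31.44 * L / z ^ 3 + (1 - (gaussianReal 0 1).real (Set.Iic z))) (𝓝[<] x)
        (𝓝 (31.44 * L / x ^ 3 + (1 - (gaussianReal 0 1).real (Set.Iic x)))) := by
      refine tendsto_nhdsWithin_of_tendsto_nhds (Tendsto.add ?_ (tendsto_const_nhds.sub (hcont.tendsto x)))
      exact tendsto_const_nhds.div ((continuous_pow 3).tendsto x) (by positivity)
    have : μ.real (Set.Iic (-x)) ≤ 31.44 * L / x ^ 3 + (1 - (gaussianReal 0 1).real (Set.Iic x)) := by
      refine ge_of_tendsto hlim ?_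
      filter_upwards [Ioo_mem_nhdsLT hx] with z hz
      have h1 := abs_le.1 (hF z hz.1.le)
      have h2 : μ.real (Set.Iic (-x)) ≤ μ.real (Set.Iio (-z)) :=
        measureReal_mono (Set.Iic_subset_Iio.2 (by linarith [hz.2]))
      linarith
    linarith
  rw [abs_le]
  constructor <;> linarith

theorem abs_real_Iic_sub_le_min (h : IsSteinPair μ τ L) (x : ℝ) :
    |μ.real (Set.Iic x) - (gaussianReal 0 1).real (Set.Iic x)| ≤ L * min 0.4785 (31.935 / (1 + |x| ^ 3)) := by
  have hLp := h.L_pos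
  have hx3 : 0 < 1 + |x| ^ 3 := by positivity
  rcases le_or_gt |x| 4 with hx | hx
  · have : |x| ^ 3 ≤ 4 ^ 3 := pow_le_pow_left₀ (abs_nonneg x) hx 3
    rw [min_eq_left (by rw [le_div_iff₀ hx3]; norm_num at *; linarith), mul_comm]
    exact h.abs_real_Iic_sub_le x
  · have hcube : |μ.real (Set.Iic x) - (gaussianReal 0 1).real (Set.Iic x)| ≤ 31.44 * L / |x| ^ 3 := by
      rcases le_total 0 x with h0 | h0
      · rw [abs_of_nonneg h0] at *
        exact h.abs_real_Iic_sub_le_cube hx.le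
      · rw [abs_of_nonpos h0] at *
        simpa using h.abs_real_Iic_sub_le_cube_neg hx
    rw [mul_min_of_nonneg _ _ hLp.le]
    refine le_min (by rw [mul_comm]; exact h.abs_real_Iic_sub_le x) (hcube.trans ?_)
    rw [← mul_div_assoc, div_le_div_iff₀ (by positivity) hx3]
    have : 4 ^ 3 ≤ |x| ^ 3 := pow_le_pow_left₀ (by norm_num) hx.le 3
    have : 31.44 * (1 + |x| ^ 3) ≤ 31.935 * |x| ^ 3 := by norm_num at *; linarith
    have := mul_le_mul_of_nonneg_left this hLp.le
    linarith

end IsSteinPair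

lemma Iio_subset_integrableExpSet {μ : Measure ℝ} [IsFiniteMeasure μ] (h0 : ∀ᵐ x ∂μ, 0 ≤ x) :
    Set.Iio (0 : ℝ) ⊆ interior (integrableExpSet id μ) := by
  refine interior_maximal (fun s hs => ?_) isOpen_Iio
  refine Integrable.of_bound (C := 1) (Measurable.aestronglyMeasurable (by fun_prop)) ?_
  filter_upwards [h0] with x hx
  rw [norm_of_nonneg (exp_pos _).le]
  exact exp_le_one_iff.2 (mul_nonpos_of_nonpos_of_nonneg (le_of_lt hs) hx)

/-- Finite measures on the half-line are determined by their Laplace transforms. -/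
lemma ext_of_laplace {μ ν : Measure ℝ} [IsFiniteMeasure μ] [IsFiniteMeasure ν]
    (hμ : ∀ᵐ x ∂μ, 0 ≤ x) (hν : ∀ᵐ x ∂ν, 0 ≤ x)
    (h : ∀ s, 0 < s → ∫ x, exp (-(s * x)) ∂μ = ∫ x, exp (-(s * x)) ∂ν) : μ = ν := by
  have hU : Set.EqOn (complexMGF id μ) (complexMGF id ν) {z | z.re ∈ Set.Iio (0 : ℝ)} := by
    refine AnalyticOnNhd.eqOn_of_preconnected_of_frequently_eq (z₀ := ((-1 : ℝ) : ℂ))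
      (analyticOnNhd_complexMGF.mono fun z hz => Iio_subset_integrableExpSet hμ hz)
      (analyticOnNhd_complexMGF.mono fun z hz => Iio_subset_integrableExpSet hν hz)
      ((convex_Iio (0 : ℝ)).linear_preimage Complex.reLm).isPreconnected (by simp) ?_
    have h_real : ∃ᶠ x : ℝ in 𝓝[≠] (-1), complexMGF id μ x = complexMGF id ν x := by
      refine Eventually.frequently ?_
      filter_upwards [mem_nhdsWithin_of_mem_nhds (Iio_mem_nhds (by norm_num : (-1 : ℝ) < 0))] with x hx
      rw [complexMGF_ofReal, complexMGF_ofReal]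
      have := h (-x) (by simpa using hx)
      simp only [neg_mul, neg_neg] at this
      simpa [mgf] using this
    rw [frequently_iff_seq_forall] at h_real ⊢
    obtain ⟨xs, hx_tendsto, hx_eq⟩ := h_real
    refine ⟨fun n ↦ xs n, ?_, fun n ↦ ?_⟩
    · rw [tendsto_nhdsWithin_iff] at hx_tendsto ⊢
      refine ⟨?_, ?_⟩
      · exact (Complex.continuous_ofReal.tendsto _).comp hx_tendsto.1
      · filter_upwards [hx_tendsto.2] with n hn
        intro h
        exact hn (Complex.ofReal_injective h)
    · simp [hx_eq]
  refine Measure.ext_of_charFun (funext fun t => ?_)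
  have hlim : ∀ (κ : Measure ℝ) [IsFiniteMeasure κ], (∀ᵐ x ∂κ, 0 ≤ x) →
      Tendsto (fun s : ℝ => complexMGF id κ (-s + t * Complex.I)) (𝓝[>] 0) (𝓝 (charFun κ t)) := by
    intro κ _ hκ
    rw [charFun_apply_real]
    refine tendsto_integral_filter_of_dominated_convergence (fun _ => 1) ?_ ?_ (integrable_const _) ?_
    · exact Eventually.of_forall fun s => Measurable.aestronglyMeasurable (by fun_prop)
    · filter_upwards [self_mem_nhdsWithin] with s hs
      filter_upwards [hκ] with x hx
      rw [Complex.norm_exp]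
      refine exp_le_one_iff.2 ?_
      have := mul_nonneg (le_of_lt hs) hx
      simpa using this
    · refine Eventually.of_forall fun x => tendsto_nhdsWithin_of_tendsto_nhds ?_
      have : Continuous fun s : ℝ => Complex.exp ((-s + t * Complex.I) * x) := by fun_prop
      convert! this.tendsto 0 using 2
      simp
      ring_nf
  refine tendsto_nhds_unique (hlim μ hμ) ((hlim ν hν).congr' ?_)
  filter_upwards [self_mem_nhdsWithin] with s hs
  exact (hU (by simpa using hs)).symm

lemma mul_exp_neg_mul_le {s x : ℝ} (hs : 0 < s) : x * exp (-(s * x)) ≤ 1 / s := by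
  have h1 := add_one_le_exp (s * x)
  rw [exp_neg, ← div_eq_mul_inv, div_le_div_iff₀ (exp_pos _) hs]
  linarith

/-- `x μ(dx) = (μ ∗ ρ)(dx)` in terms of Laplace transforms. -/
structure IsSizeBias (μ ρ : Measure ℝ) : Prop where
  isProb : IsProbabilityMeasure μ
  isFinite : IsFiniteMeasure ρ
  nonneg : ∀ᵐ x ∂μ, 0 ≤ x
  pos : ∀ᵐ y ∂ρ, 0 < y
  integrable_sq : Integrable (fun y => y ^ 2) ρ
  laplace : ∀ s, 0 < s → ∫ x, x * exp (-(s * x)) ∂μ = (∫ x, exp (-(s * x)) ∂μ) * ∫ y, exp (-(s * y)) ∂ρ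

namespace IsSizeBias

variable {μ ρ : Measure ℝ}

lemma integrable_exp {κ : Measure ℝ} [IsFiniteMeasure κ] (hκ : ∀ᵐ x ∂κ, 0 ≤ x) {s : ℝ} (hs : 0 < s) :
    Integrable (fun x => exp (-(s * x))) κ := by
  refine Integrable.of_bound (C := 1) (Measurable.aestronglyMeasurable (by fun_prop)) ?_
  filter_upwards [hκ] with x hx
  rw [norm_of_nonneg (exp_pos _).le]
  exact exp_le_one_iff.2 (by have := mul_nonneg hs.le hx; linarith)

lemma integral_exp_le {κ : Measure ℝ} [IsFiniteMeasure κ] (hκ : ∀ᵐ x ∂κ, 0 ≤ x) {s : ℝ} (hs : 0 < s) :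
    ∫ x, exp (-(s * x)) ∂κ ≤ κ.real Set.univ := by
  calc ∫ x, exp (-(s * x)) ∂κ ≤ ∫ x, (1 : ℝ) ∂κ := by
        refine integral_mono_ae (integrable_exp hκ hs) (integrable_const _) ?_
        filter_upwards [hκ] with x hx
        exact exp_le_one_iff.2 (by have := mul_nonneg hs.le hx; linarith)
    _ = _ := by simp

lemma integrable_id (h : IsSizeBias μ ρ) : Integrable (fun x => x) μ := by
  have := h.isProb
  have := h.isFinite
  have hpos : ∀ᵐ y ∂ρ, 0 ≤ y := h.pos.mono fun _ => le_of_lt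
  refine integrable_of_tendsto (G := fun n x => x * exp (-((1 / ((n : ℝ) + 1)) * x)))
    (Eventually.of_forall fun x => ?_) (fun n => Measurable.aestronglyMeasurable (by fun_prop)) ?_
  · have h1 : Tendsto (fun n : ℕ => 1 / ((n : ℝ) + 1)) atTop (𝓝 0) := tendsto_one_div_add_atTop_nhds_zero_nat
    have h2 : Continuous fun s : ℝ => x * exp (-(s * x)) := by fun_prop
    simpa using! (h2.tendsto 0).comp h1
  · refine ne_top_of_le_ne_top (ENNReal.ofReal_ne_top (r := ρ.real Set.univ)) ?_
    refine liminf_le_of_frequently_le' (Frequently.of_forall fun n => ?_)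
    have hs : 0 < 1 / ((n : ℝ) + 1) := by positivity
    have hInt : Integrable (fun x => x * exp (-((1 / ((n : ℝ) + 1)) * x))) μ := by
      refine Integrable.of_bound (C := 1 / (1 / ((n : ℝ) + 1))) (Measurable.aestronglyMeasurable (by fun_prop)) ?_
      filter_upwards [h.nonneg] with x hx
      rw [norm_of_nonneg (by positivity)]
      exact mul_exp_neg_mul_le hs
    have hn : ∫⁻ x, ‖x * exp (-((1 / ((n : ℝ) + 1)) * x))‖ₑ ∂μ =
        ENNReal.ofReal (∫ x, x * exp (-((1 / ((n : ℝ) + 1)) * x)) ∂μ) := by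
      rw [ofReal_integral_eq_lintegral_ofReal hInt]
      · refine lintegral_congr_ae ?_
        filter_upwards [h.nonneg] with x hx
        rw [Real.enorm_of_nonneg (by positivity)]
      · filter_upwards [h.nonneg] with x hx
        simp only [Pi.zero_apply]
        positivity
    rw [hn, h.laplace _ hs]
    refine ENNReal.ofReal_le_ofReal ?_
    have i1 := integral_exp_le h.nonneg hs
    have i2 := integral_exp_le hpos hs
    rw [probReal_univ] at i1
    have i3 : 0 ≤ ∫ y, exp (-((1 / ((n : ℝ) + 1)) * y)) ∂ρ := integral_nonneg fun y => (exp_pos _).le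
    exact (mul_le_of_le_one_left i3 i1).trans i2

lemma integrable_id_bias (h : IsSizeBias μ ρ) : Integrable (fun y => y) ρ := by
  have := h.isFinite
  refine Integrable.mono' ((integrable_const (1 : ℝ)).add h.integrable_sq) measurable_id.aestronglyMeasurable
    (Eventually.of_forall fun y => ?_)
  simp only [Pi.add_apply, norm_eq_abs]
  rw [← sq_abs]
  nlinarith [sq_nonneg (|y| - 1)]

lemma isFinite_withDensity (h : IsSizeBias μ ρ) : IsFiniteMeasure (μ.withDensity fun x => ENNReal.ofReal x) :=
  isFiniteMeasure_withDensity_ofReal h.integrable_id.2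

lemma withDensity_eq (h : IsSizeBias μ ρ) :
    μ.withDensity (fun x => ENNReal.ofReal x) = (μ.prod ρ).map (fun p => p.1 + p.2) := by
  have := h.isProb
  have := h.isFinite
  have := h.isFinite_withDensity
  have hm : Measurable fun p : ℝ × ℝ => p.1 + p.2 := by fun_prop
  refine ext_of_laplace ?_ ?_ fun s hs => ?_
  · exact (withDensity_absolutelyContinuous _ _).ae_le h.nonneg
  · rw [ae_map_iff hm.aemeasurable measurableSet_Ici]
    have h1 : ∀ᵐ p ∂μ.prod ρ, 0 ≤ p.1 := Measure.quasiMeasurePreserving_fst.ae h.nonneg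
    have h2 : ∀ᵐ p ∂μ.prod ρ, 0 < p.2 := Measure.quasiMeasurePreserving_snd.ae h.pos
    filter_upwards [h1, h2] with p a b using by positivity
  · rw [integral_withDensity_eq_integral_toReal_smul (by fun_prop) (by simp),
      integral_map hm.aemeasurable (Measurable.aestronglyMeasurable (by fun_prop))]
    have e1 : ∫ p : ℝ × ℝ, exp (-(s * (p.1 + p.2))) ∂μ.prod ρ =
        (∫ x, exp (-(s * x)) ∂μ) * ∫ y, exp (-(s * y)) ∂ρ := by
      rw [← integral_prod_mul]
      refine integral_congr_ae (Eventually.of_forall fun p => ?_)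
      simp only [← exp_add]
      ring_nf
    rw [e1, ← h.laplace s hs]
    refine integral_congr_ae ?_
    filter_upwards [h.nonneg] with x hx
    rw [ENNReal.toReal_ofReal hx, smul_eq_mul]

lemma integrable_mul_iff (h : IsSizeBias μ ρ) {g : ℝ → ℝ} (hg : Measurable g) :
    Integrable (fun x => x * g x) μ ↔ Integrable (fun p : ℝ × ℝ => g (p.1 + p.2)) (μ.prod ρ) := by
  have hm : Measurable fun p : ℝ × ℝ => p.1 + p.2 := by fun_prop
  have e := integrable_map_measure (μ := μ.prod ρ) (f := fun p : ℝ × ℝ => p.1 + p.2) (g := g)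
    hg.aestronglyMeasurable hm.aemeasurable
  rw [← h.withDensity_eq, integrable_withDensity_iff_integrable_smul' (by fun_prop) (by simp)] at e
  rw [← Function.comp_def g, ← e]
  refine integrable_congr ?_
  filter_upwards [h.nonneg] with x hx
  rw [ENNReal.toReal_ofReal hx, smul_eq_mul]

lemma integral_mul (h : IsSizeBias μ ρ) {g : ℝ → ℝ} (hg : Measurable g) :
    ∫ x, x * g x ∂μ = ∫ p : ℝ × ℝ, g (p.1 + p.2) ∂μ.prod ρ := by
  have hm : Measurable fun p : ℝ × ℝ => p.1 + p.2 := by fun_prop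
  have e := integral_map (μ := μ.prod ρ) (φ := fun p : ℝ × ℝ => p.1 + p.2) (f := g)
    hm.aemeasurable hg.aestronglyMeasurable
  rw [← h.withDensity_eq, integral_withDensity_eq_integral_toReal_smul (by fun_prop) (by simp)] at e
  rw [← e]
  refine integral_congr_ae ?_
  filter_upwards [h.nonneg] with x hx
  rw [ENNReal.toReal_ofReal hx, smul_eq_mul]

lemma integral_id (h : IsSizeBias μ ρ) : ∫ x, x ∂μ = ρ.real Set.univ := by
  have := h.isProb
  have := h.isFinite
  have e := h.integral_mul (g := fun _ => 1) measurable_const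
  simp only [mul_one] at e
  rw [e]
  simp [measureReal_def, Measure.prod_apply]

lemma integrable_sq_self (h : IsSizeBias μ ρ) : Integrable (fun x => x ^ 2) μ := by
  have := h.isProb
  have := h.isFinite
  have := (h.integrable_mul_iff (g := fun x => x) measurable_id).2
    ((h.integrable_id.comp_fst ρ).add (h.integrable_id_bias.comp_snd μ))
  simpa only [sq] using this

lemma integral_sq (h : IsSizeBias μ ρ) :
    ∫ x, x ^ 2 ∂μ = (ρ.real Set.univ) ^ 2 + ∫ y, y ∂ρ := by
  have := h.isProb
  have := h.isFinite
  have e := h.integral_mul (g := fun x => x) measurable_id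
  rw [integral_add (h.integrable_id.comp_fst ρ) (h.integrable_id_bias.comp_snd μ)] at e
  have e1 := integral_prod_mul (μ := μ) (ν := ρ) (fun x => x) (fun _ => (1 : ℝ))
  have e2 := integral_prod_mul (μ := μ) (ν := ρ) (fun _ => (1 : ℝ)) (fun y => y)
  simp only [mul_one, one_mul, integral_const, probReal_univ, smul_eq_mul] at e1 e2
  rw [e1, e2, h.integral_id] at e
  simp only [sq]
  exact e

end IsSizeBias

namespace IsSizeBias

variable {μ ρ : Measure ℝ}

/-- The normalized second-moment measure of the rescaled jumps. -/
noncomputable def jump (ρ : Measure ℝ) (V : ℝ) : Measure ℝ :=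
  (ρ.withDensity fun y => ENNReal.ofReal (y / V)).map fun y => y / √V

lemma integral_jump {V : ℝ} (h : IsSizeBias μ ρ) (hV : 0 < V) {f : ℝ → ℝ} (hf : Measurable f) :
    ∫ y, f y ∂jump ρ V = ∫ y, y / V * f (y / √V) ∂ρ := by
  rw [jump, integral_map (by fun_prop) hf.aestronglyMeasurable,
    integral_withDensity_eq_integral_toReal_smul (by fun_prop) (by simp)]
  refine integral_congr_ae ?_
  filter_upwards [h.pos] with y hy
  rw [ENNReal.toReal_ofReal (by positivity), smul_eq_mul]

lemma integrable_jump {V : ℝ} (h : IsSizeBias μ ρ) (hV : 0 < V) {f : ℝ → ℝ} (hf : Measurable f)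
    (hi : Integrable (fun y => y / V * f (y / √V)) ρ) : Integrable f (jump ρ V) := by
  rw [jump, integrable_map_measure hf.aestronglyMeasurable (by fun_prop),
    integrable_withDensity_iff_integrable_smul' (by fun_prop) (by simp)]
  refine hi.congr ?_
  filter_upwards [h.pos] with y hy
  rw [ENNReal.toReal_ofReal (by positivity), smul_eq_mul, Function.comp]

lemma ae_jump {V : ℝ} (h : IsSizeBias μ ρ) (hV : 0 < V) : ∀ᵐ y ∂jump ρ V, y ≠ 0 := by
  have hm : Measurable fun y : ℝ => y / √V := by fun_prop
  rw [jump, ae_map_iff hm.aemeasurable (by exact (measurableSet_singleton 0).compl)]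
  refine (withDensity_absolutelyContinuous _ _).ae_le ?_
  filter_upwards [h.pos] with y hy
  have := Real.sqrt_pos.2 hV
  positivity

/-- The standardization of a law with a size-bias decomposition forms a Stein pair. -/
theorem isSteinPair (h : IsSizeBias μ ρ) {V : ℝ} (hV : 0 < V) (hρ : ∫ y, y ∂ρ = V) :
    IsSteinPair (μ.map fun x => (x - ρ.real Set.univ) / √V) (jump ρ V)
      ((∫ y, y ^ 2 ∂ρ) / V ^ (3 / 2 : ℝ)) := by
  have := h.isProb
  have := h.isFinite
  have hσ : 0 < √V := Real.sqrt_pos.2 hV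
  have hσ2 : √V * √V = V := Real.mul_self_sqrt hV.le
  set σ := √V with hσdef
  set m := ρ.real Set.univ with hm
  have hmeas : Measurable fun x : ℝ => (x - m) / σ := by fun_prop
  have hsq1 := h.integrable_sq_self
  have hid := h.integrable_id
  have hVpow : V ^ (3 / 2 : ℝ) = V * σ := by
    rw [hσdef, Real.sqrt_eq_rpow, ← Real.rpow_one_add' hV.le (by norm_num)]
    norm_num
  have hjumpm : Measurable fun y : ℝ => y / σ := by fun_prop
  have hμ' : IsProbabilityMeasure (μ.map fun x => (x - m) / σ) :=
    Measure.isProbabilityMeasure_map hmeas.aemeasurable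
  have hexp : ∀ x : ℝ, ((x - m) / σ) ^ 2 = (x ^ 2 - 2 * m * x + m ^ 2) / V := by
    intro x
    rw [div_pow, sq σ, hσ2]
    ring
  have hsub : Integrable (fun x : ℝ => x ^ 2 - 2 * m * x) μ := hsq1.sub (hid.const_mul _)
  have hint2 : Integrable (fun x : ℝ => x ^ 2 - 2 * m * x + m ^ 2) μ :=
    hsub.add (integrable_const _)
  have hτ : IsProbabilityMeasure (jump ρ V) := by
    have : IsProbabilityMeasure (ρ.withDensity fun y => ENNReal.ofReal (y / V)) := by
      refine ⟨?_⟩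
      rw [withDensity_apply _ MeasurableSet.univ, Measure.restrict_univ,
        ← ofReal_integral_eq_lintegral_ofReal (h.integrable_id_bias.div_const V)
          (h.pos.mono fun y hy => by simp only [Pi.zero_apply]; positivity), integral_div, hρ, div_self hV.ne']
      simp
    exact Measure.isProbabilityMeasure_map hjumpm.aemeasurable
  refine ⟨hμ', hτ, ?_, ?_, ?_, h.ae_jump hV, ?_, ?_, ?_, ?_⟩
  · rw [integrable_map_measure (by fun_prop) hmeas.aemeasurable]
    simp only [Function.comp_def, hexp]
    exact hint2.div_const _
  · rw [integral_map hmeas.aemeasurable (by fun_prop), integral_div, integral_sub hid (integrable_const _),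
      h.integral_id]
    simp [hm]
  · rw [integral_map hmeas.aemeasurable (by fun_prop)]
    simp only [hexp]
    rw [integral_div, integral_add hsub (integrable_const _),
      integral_sub hsq1 (hid.const_mul _), integral_const_mul, h.integral_id, h.integral_sq, hρ]
    rw [div_eq_one_iff_eq hV.ne']
    simp
    ring
  · refine h.integrable_jump hV (by fun_prop) ((h.integrable_sq.div_const (V * σ)).congr ?_)
    filter_upwards [h.pos] with y hy
    rw [abs_of_pos (by positivity)]
    rw [← hσdef]
    field_simp
  · rw [h.integral_jump hV (by fun_prop), hVpow, ← integral_div]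
    refine integral_congr_ae ?_
    filter_upwards [h.pos] with y hy
    rw [abs_of_pos (by positivity)]
    rw [← hσdef]
    field_simp
  · refine h.integrable_jump hV (by fun_prop) ((integrable_const (σ / V)).congr ?_)
    filter_upwards [h.pos] with y hy
    rw [← hσdef]
    field_simp
  · rintro g hg ⟨C, hC⟩
    have hgm : Measurable fun x => g ((x - m) / σ) := hg.comp hmeas
    have hgi : Integrable (fun x => g ((x - m) / σ)) μ :=
      Integrable.of_bound (C := C) hgm.aestronglyMeasurable (Eventually.of_forall fun x => hC _)
    have hk : Measurable fun y => ∫ w, (g (w + y) - g w) / y ∂(μ.map fun x => (x - m) / σ) := by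
      refine StronglyMeasurable.measurable ?_
      refine StronglyMeasurable.integral_prod_right' (f := fun p : ℝ × ℝ => (g (p.2 + p.1) - g p.2) / p.1) ?_
      exact Measurable.stronglyMeasurable (by fun_prop)
    rw [h.integral_jump hV hk, integral_map hmeas.aemeasurable (Measurable.aestronglyMeasurable (by fun_prop))]
    have hprod : Integrable (fun p : ℝ × ℝ => g ((p.1 + p.2 - m) / σ)) (μ.prod ρ) :=
      Integrable.of_bound (C := C) (Measurable.aestronglyMeasurable (by fun_prop)) (Eventually.of_forall fun x => hC _)
    have hprod1 : Integrable (fun p : ℝ × ℝ => g ((p.1 - m) / σ)) (μ.prod ρ) :=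
      Integrable.of_bound (C := C) (Measurable.aestronglyMeasurable (by fun_prop)) (Eventually.of_forall fun x => hC _)
    have hpd : Integrable (fun p : ℝ × ℝ => g ((p.1 + p.2 - m) / σ) - g ((p.1 - m) / σ)) (μ.prod ρ) :=
      hprod.sub hprod1
    have e1 : ∫ x, (x - m) / σ * g ((x - m) / σ) ∂μ =
        (∫ p : ℝ × ℝ, (g ((p.1 + p.2 - m) / σ) - g ((p.1 - m) / σ)) ∂μ.prod ρ) / σ := by
      rw [integral_sub hprod hprod1, ← h.integral_mul hgm]
      have e2 := integral_prod_mul (μ := μ) (ν := ρ) (fun x => g ((x - m) / σ)) (fun _ => (1 : ℝ))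
      simp only [mul_one, integral_const, smul_eq_mul] at e2
      rw [e2, ← hm, ← integral_mul_const, ← integral_sub ((h.integrable_mul_iff hgm).2 hprod) (hgi.mul_const _),
        ← integral_div]
      refine integral_congr_ae (Eventually.of_forall fun x => ?_)
      simp only
      ring
    rw [e1, integral_prod_symm _ hpd, ← integral_div]
    refine integral_congr_ae ?_
    filter_upwards [h.pos] with y hy
    rw [integral_map hmeas.aemeasurable (Measurable.aestronglyMeasurable (by fun_prop)), integral_div]
    have e3 : ∀ x, (x - m) / σ + y / σ = (x + y - m) / σ := fun x => by ring
    simp only [← hσdef, e3]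
    rw [← hσ2]
    field_simp

end IsSizeBias

section BiasedLaw

variable {E : Type*} [MeasurableSpace E] {N : Measure E} {Y : E → ℝ}

/-- The law of the sizes `Y` of the points of a Poisson process with intensity measure `N`, weighted by
size. -/
noncomputable def biasedLaw (N : Measure E) (Y : E → ℝ) : Measure ℝ :=
  (N.withDensity fun e => ENNReal.ofReal (Y e)).map Y

lemma integral_biasedLaw (hY : Measurable Y) (hY0 : ∀ᵐ e ∂N, 0 ≤ Y e) {f : ℝ → ℝ} (hf : Measurable f) :
    ∫ y, f y ∂biasedLaw N Y = ∫ e, Y e * f (Y e) ∂N := by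
  rw [biasedLaw, integral_map hY.aemeasurable hf.aestronglyMeasurable,
    integral_withDensity_eq_integral_toReal_smul (by fun_prop) (by simp)]
  refine integral_congr_ae ?_
  filter_upwards [hY0] with e he
  rw [ENNReal.toReal_ofReal he, smul_eq_mul]

lemma integrable_biasedLaw (hY : Measurable Y) (hY0 : ∀ᵐ e ∂N, 0 ≤ Y e) {f : ℝ → ℝ} (hf : Measurable f)
    (hi : Integrable (fun e => Y e * f (Y e)) N) : Integrable f (biasedLaw N Y) := by
  rw [biasedLaw, integrable_map_measure hf.aestronglyMeasurable hY.aemeasurable,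
    integrable_withDensity_iff_integrable_smul' (by fun_prop) (by simp)]
  refine hi.congr ?_
  filter_upwards [hY0] with e he
  rw [ENNReal.toReal_ofReal he, smul_eq_mul, Function.comp]

lemma ae_biasedLaw_pos (hY : Measurable Y) : ∀ᵐ y ∂biasedLaw N Y, 0 < y := by
  rw [biasedLaw, ae_map_iff hY.aemeasurable measurableSet_Ioi, ae_withDensity_iff (by fun_prop)]
  refine Eventually.of_forall fun e he => ?_
  simpa using he

lemma isFiniteMeasure_biasedLaw (h1 : Integrable Y N) : IsFiniteMeasure (biasedLaw N Y) := by
  have := isFiniteMeasure_withDensity_ofReal h1.2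
  rw [biasedLaw]
  infer_instance

lemma hasDerivAt_integral_one_sub_exp (hY : Measurable Y) (hY0 : ∀ᵐ e ∂N, 0 ≤ Y e) (h1 : Integrable Y N)
    {s : ℝ} (hs : 0 < s) :
    HasDerivAt (fun s => ∫ e, (1 - exp (-(s * Y e))) ∂N) (∫ e, Y e * exp (-(s * Y e)) ∂N) s := by
  refine (hasDerivAt_integral_of_dominated_loc_of_deriv_le (F := fun s e => 1 - exp (-(s * Y e)))
    (F' := fun s e => Y e * exp (-(s * Y e))) (bound := Y) (Ioi_mem_nhds hs) ?_ ?_ ?_ ?_ h1 ?_).2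
  · exact Eventually.of_forall fun s => Measurable.aestronglyMeasurable (by fun_prop)
  · refine (h1.const_mul s).mono' (Measurable.aestronglyMeasurable (by fun_prop)) ?_
    filter_upwards [hY0] with e he
    have h2 : exp (-(s * Y e)) ≤ 1 := exp_le_one_iff.2 (by have := mul_nonneg hs.le he; linarith)
    have h3 := add_one_le_exp (-(s * Y e))
    rw [norm_of_nonneg (by linarith)]
    linarith
  · exact Measurable.aestronglyMeasurable (by fun_prop)
  · filter_upwards [hY0] with e he t ht
    rw [norm_of_nonneg (by positivity)]
    refine mul_le_of_le_one_right he (exp_le_one_iff.2 ?_)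
    have := mul_nonneg (le_of_lt ht) he
    linarith
  · refine Eventually.of_forall fun e t _ => ?_
    have h2 : HasDerivAt (fun t => -(t * Y e)) (-(1 * Y e)) t := ((hasDerivAt_id t).mul_const _).neg
    convert! (h2.exp.const_sub 1) using 1
    ring

/-- A law with the Laplace transform of a Poisson shot noise satisfies a size-bias identity. -/
theorem isSizeBias_of_laplace {μ : Measure ℝ} [IsProbabilityMeasure μ] (hμ : ∀ᵐ x ∂μ, 0 ≤ x)
    (hY : Measurable Y) (hY0 : ∀ᵐ e ∂N, 0 ≤ Y e) (h1 : Integrable Y N)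
    (h3 : Integrable (fun e => Y e ^ 3) N)
    (hL : ∀ s, 0 < s → ∫ x, exp (-(s * x)) ∂μ = exp (-∫ e, (1 - exp (-(s * Y e))) ∂N)) :
    IsSizeBias μ (biasedLaw N Y) where
  isProb := inferInstance
  isFinite := isFiniteMeasure_biasedLaw h1
  nonneg := hμ
  pos := ae_biasedLaw_pos hY
  integrable_sq := by
    refine integrable_biasedLaw hY hY0 (by fun_prop) (h3.congr (Eventually.of_forall fun e => ?_))
    simp only
    ring
  laplace s hs := by
    rw [integral_biasedLaw hY hY0 (by fun_prop)]
    have hl : HasDerivAt (mgf id μ) (∫ x, x * exp (-s * x) ∂μ) (-s) :=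
      hasDerivAt_mgf (Iio_subset_integrableExpSet hμ (by simpa using hs))
    have hl' : HasDerivAt (fun s => mgf id μ (-s)) (-∫ x, x * exp (-s * x) ∂μ) s := by
      simpa using! hl.comp s (hasDerivAt_neg s)
    have hr := (hasDerivAt_integral_one_sub_exp hY hY0 h1 hs).neg.exp
    have heq : (fun s => mgf id μ (-s)) =ᶠ[𝓝 s] fun s => exp (-∫ e, (1 - exp (-(s * Y e))) ∂N) := by
      filter_upwards [Ioi_mem_nhds hs] with t ht
      rw [← hL t ht]
      simp [mgf]
    have huniq := (hr.congr_of_eventuallyEq heq).unique hl'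
    simp only [Pi.neg_apply, ← hL s hs] at huniq
    simp only [neg_mul] at huniq
    linarith

end BiasedLaw

section ShotNoise

variable {E : Type*} [MeasurableSpace E] {N : Measure E} {Y : E → ℝ}

/-- Berry–Esseen bound for a Poisson shot noise `I` with intensity measure `N` and jump sizes `Y`. -/
theorem abs_measure_standardized_le_sub_le {Ω : Type*} [MeasurableSpace Ω] {μ : Measure Ω}
    [IsProbabilityMeasure μ] {I : Ω → ℝ} (hI : Measurable I) (hI0 : ∀ ω, 0 ≤ I ω)
    (hY : Measurable Y) (hY0 : ∀ᵐ e ∂N, 0 ≤ Y e) (h1 : Integrable Y N)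
    (h3 : Integrable (fun e => Y e ^ 3) N) (hpos : 0 < ∫ e, Y e ^ 2 ∂N)
    (hL : ∀ s, 0 < s → ∫ ω, exp (-(s * I ω)) ∂μ = exp (-∫ e, (1 - exp (-(s * Y e))) ∂N)) (x : ℝ) :
    |(μ {ω | (I ω - ∫ ω', I ω' ∂μ) / √(variance I μ) ≤ x}).toReal -
        (∫ t in Set.Iic x, exp (-t ^ 2 / 2)) / √(2 * π)| ≤
      (∫ e, Y e ^ 3 ∂N) / (∫ e, Y e ^ 2 ∂N) ^ (3 / 2 : ℝ) * min 0.4785 (31.935 / (1 + |x| ^ 3)) := by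
  have := Measure.isProbabilityMeasure_map (μ := μ) hI.aemeasurable
  have hb : IsSizeBias (μ.map I) (biasedLaw N Y) := by
    refine isSizeBias_of_laplace ?_ hY hY0 h1 h3 fun s hs => ?_
    · exact (ae_map_iff hI.aemeasurable measurableSet_Ici).2 (Eventually.of_forall hI0)
    · rw [integral_map hI.aemeasurable (Measurable.aestronglyMeasurable (by fun_prop)), hL s hs]
  have hV : ∫ y, y ∂biasedLaw N Y = ∫ e, Y e ^ 2 ∂N := by
    rw [integral_biasedLaw hY hY0 (f := fun y => y) measurable_id]
    exact integral_congr_ae (Eventually.of_forall fun e => (sq (Y e)).symm)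
  have hT : ∫ y, y ^ 2 ∂biasedLaw N Y = ∫ e, Y e ^ 3 ∂N := by
    rw [integral_biasedLaw hY hY0 (by fun_prop)]
    exact integral_congr_ae (Eventually.of_forall fun e => by simp only; ring)
  have hE : ∫ ω, I ω ∂μ = (biasedLaw N Y).real Set.univ := by
    rw [← hb.integral_id, integral_map hI.aemeasurable (by fun_prop)]
  have hI2 : MemLp I 2 μ := by
    rw [memLp_two_iff_integrable_sq hI.aestronglyMeasurable]
    exact (integrable_map_measure (by fun_prop) hI.aemeasurable).1 hb.integrable_sq_self
  have hvar : variance I μ = ∫ e, Y e ^ 2 ∂N := by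
    have hsq := hb.integral_sq
    rw [integral_map hI.aemeasurable (by fun_prop), hV] at hsq
    rw [variance_eq_sub hI2, hE]
    simp only [Pi.pow_apply, hsq]
    ring
  have key := (hb.isSteinPair hpos hV).abs_real_Iic_sub_le_min x
  rw [hT, gaussianReal_real_Iic, map_measureReal_apply (by fun_prop) measurableSet_Iic,
    map_measureReal_apply hI (measurableSet_Iic.preimage (by fun_prop))] at key
  rw [hE, hvar]
  exact key

end ShotNoise

section MarkedPlane

variable {lam P : ℝ} {G q : ℝ → ℝ}

/-- The radial intensity of a stationary planar process. -/
noncomputable def radialIntensity (lam : ℝ) : Measure ℝ :=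
  (volume.restrict (Set.Ioi 0)).withDensity fun t => ENNReal.ofReal (lam * (2 * π * t))

/-- The law on the half-line with density `q`. -/
noncomputable def markLaw (q : ℝ → ℝ) : Measure ℝ :=
  (volume.restrict (Set.Ioi 0)).withDensity fun h => ENNReal.ofReal (q h)

instance : SFinite (radialIntensity lam) := by unfold radialIntensity; infer_instance

instance : SFinite (markLaw q) := by unfold markLaw; infer_instance

lemma integral_radialIntensity (hlam : 0 < lam) (f : ℝ → ℝ) :
    ∫ t, f t ∂radialIntensity lam = lam * (2 * π) * ∫ t in Set.Ioi 0, f t * t := by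
  rw [radialIntensity, integral_withDensity_eq_integral_toReal_smul (by fun_prop) (by simp),
    ← integral_const_mul]
  refine setIntegral_congr_fun measurableSet_Ioi fun t ht => ?_
  have ht : 0 < t := ht
  rw [ENNReal.toReal_ofReal (by positivity), smul_eq_mul]
  ring

lemma integrable_radialIntensity (hlam : 0 < lam) {f : ℝ → ℝ}
    (hf : IntegrableOn (fun t => f t * t) (Set.Ioi 0)) : Integrable f (radialIntensity lam) := by
  rw [radialIntensity, integrable_withDensity_iff_integrable_smul' (by fun_prop) (by simp)]
  refine IntegrableOn.congr_fun (hf.const_mul (lam * (2 * π))) (fun t ht => ?_) measurableSet_Ioi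
  have ht : 0 < t := ht
  rw [ENNReal.toReal_ofReal (by positivity), smul_eq_mul]
  ring

lemma integral_markLaw (hq : Measurable q) (hq0 : ∀ h, 0 ≤ q h) (f : ℝ → ℝ) :
    ∫ h, f h ∂markLaw q = ∫ h in Set.Ioi 0, f h * q h := by
  rw [markLaw, integral_withDensity_eq_integral_toReal_smul (by fun_prop) (by simp)]
  refine setIntegral_congr_fun measurableSet_Ioi fun h _ => ?_
  rw [ENNReal.toReal_ofReal (hq0 h), smul_eq_mul, mul_comm]

lemma integrable_markLaw (hq : Measurable q) (hq0 : ∀ h, 0 ≤ q h) {f : ℝ → ℝ}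
    (hf : IntegrableOn (fun h => f h * q h) (Set.Ioi 0)) : Integrable f (markLaw q) := by
  rw [markLaw, integrable_withDensity_iff_integrable_smul' (by fun_prop) (by simp)]
  refine IntegrableOn.congr_fun hf (fun h _ => ?_) measurableSet_Ioi
  rw [ENNReal.toReal_ofReal (hq0 h), smul_eq_mul, mul_comm]

lemma ae_radialIntensity_pos : ∀ᵐ t ∂radialIntensity lam, 0 < t :=
  (withDensity_absolutelyContinuous _ _).ae_le (ae_restrict_mem measurableSet_Ioi)

lemma ae_markLaw_pos : ∀ᵐ h ∂markLaw q, 0 < h :=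
  (withDensity_absolutelyContinuous _ _).ae_le (ae_restrict_mem measurableSet_Ioi)

/-- A bounded path loss decaying faster than `t ^ (-2)` is radially integrable in the plane. -/
lemma integrableOn_pathLoss {α : ℝ} (hα : 2 < α) (hG : Measurable G) (hG0 : ∀ t, 0 ≤ t → 0 ≤ G t)
    (hGb : ∃ C : ℝ, ∀ t, 0 ≤ t → G t ≤ C)
    (hGt : ∃ K > (0 : ℝ), ∃ B > (0 : ℝ), ∀ t ≥ B, G t ≤ K * t ^ (-α)) :
    IntegrableOn (fun t => G t * t) (Set.Ioi 0) := by
  obtain ⟨C, hC⟩ := hGb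
  obtain ⟨K, -, B, hB, hK⟩ := hGt
  have hC0 : 0 ≤ C := (hG0 0 le_rfl).trans (hC 0 le_rfl)
  rw [← Set.Ioc_union_Ioi_eq_Ioi hB.le]
  refine IntegrableOn.union ?_ ?_
  · refine Measure.integrableOn_of_bounded (M := C * B) (by simp)
      (Measurable.aestronglyMeasurable (by fun_prop)) ?_
    filter_upwards [ae_restrict_mem measurableSet_Ioc] with t ht
    rw [norm_of_nonneg (mul_nonneg (hG0 t ht.1.le) ht.1.le)]
    exact mul_le_mul (hC t ht.1.le) ht.2 ht.1.le hC0
  · refine Integrable.mono' ((integrableOn_Ioi_rpow_of_lt (a := 1 - α) (by linarith) hB).const_mul K)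
      (Measurable.aestronglyMeasurable (by fun_prop)) ?_
    filter_upwards [ae_restrict_mem measurableSet_Ioi] with t ht
    have ht : B < t := ht
    have ht0 : 0 < t := hB.trans ht
    rw [norm_of_nonneg (mul_nonneg (hG0 t ht0.le) ht0.le)]
    calc G t * t ≤ K * t ^ (-α) * t := mul_le_mul_of_nonneg_right (hK t ht.le) ht0.le
      _ = K * t ^ (1 - α) := by
        rw [mul_assoc, ← rpow_add_one ht0.ne']
        ring_nf

lemma integrableOn_pathLoss_pow (hG : Measurable G) (hG0 : ∀ t, 0 ≤ t → 0 ≤ G t)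
    (hGb : ∃ C : ℝ, ∀ t, 0 ≤ t → G t ≤ C) (h : IntegrableOn (fun t => G t * t) (Set.Ioi 0)) (k : ℕ) :
    IntegrableOn (fun t => G t ^ (k + 1) * t) (Set.Ioi 0) := by
  obtain ⟨C, hC⟩ := hGb
  refine Integrable.mono' (h.const_mul (C ^ k)) (Measurable.aestronglyMeasurable (by fun_prop)) ?_
  filter_upwards [ae_restrict_mem measurableSet_Ioi] with t ht
  have ht : 0 < t := ht
  have hGt := hG0 t ht.le
  rw [norm_of_nonneg (by positivity), pow_succ, mul_assoc]
  gcongr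
  exact hC t ht.le

lemma integral_sq_mul_density_pos (hq0 : ∀ h, 0 ≤ q h)
    (hq1 : ∫ h in Set.Ioi (0 : ℝ), q h = 1) (hq2 : IntegrableOn (fun h => h ^ 2 * q h) (Set.Ioi 0)) :
    0 < ∫ h in Set.Ioi (0 : ℝ), h ^ 2 * q h := by
  have hnn : ∀ h : ℝ, 0 ≤ h ^ 2 * q h := fun h => mul_nonneg (sq_nonneg h) (hq0 h)
  refine (integral_nonneg hnn).lt_of_ne fun h0 => ?_
  have hz := (integral_eq_zero_iff_of_nonneg hnn hq2).1 h0.symm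
  have : ∫ h in Set.Ioi (0 : ℝ), q h = 0 := by
    refine integral_eq_zero_of_ae ?_
    filter_upwards [hz, ae_restrict_mem measurableSet_Ioi] with h hh hpos
    have hpos : 0 < h := hpos
    exact (mul_eq_zero.1 hh).resolve_left (by positivity)
  rw [hq1] at this
  exact one_ne_zero this

end MarkedPlane

lemma rpow_three_halves {a : ℝ} (ha : 0 ≤ a) : a ^ (3 / 2 : ℝ) = a * √a := by
  rw [Real.sqrt_eq_rpow, ← Real.rpow_one_add' ha (by norm_num)]
  norm_num

section MarkedPlane

variable {lam P : ℝ} {G q : ℝ → ℝ}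

lemma integral_pow_signal (hlam : 0 < lam) (hq : Measurable q) (hq0 : ∀ h, 0 ≤ q h) (k : ℕ) :
    ∫ p : ℝ × ℝ, (P * p.2 * G p.1) ^ k ∂(radialIntensity lam).prod (markLaw q) =
      P ^ k * (lam * (2 * π)) * (∫ t in Set.Ioi 0, G t ^ k * t) * ∫ h in Set.Ioi 0, h ^ k * q h := by
  have e : ∀ p : ℝ × ℝ, (P * p.2 * G p.1) ^ k = P ^ k * (G p.1 ^ k * p.2 ^ k) := fun p => by ring
  simp only [e]
  rw [integral_const_mul, integral_prod_mul (fun t => G t ^ k) (fun h => h ^ k),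
    integral_radialIntensity hlam, integral_markLaw hq hq0]
  ring

lemma integrable_pow_signal (hlam : 0 < lam) (hq : Measurable q) (hq0 : ∀ h, 0 ≤ q h) {k : ℕ}
    (hG : IntegrableOn (fun t => G t ^ k * t) (Set.Ioi 0))
    (hqk : IntegrableOn (fun h => h ^ k * q h) (Set.Ioi 0)) :
    Integrable (fun p : ℝ × ℝ => (P * p.2 * G p.1) ^ k) ((radialIntensity lam).prod (markLaw q)) := by
  have e : ∀ p : ℝ × ℝ, (P * p.2 * G p.1) ^ k = P ^ k * (G p.1 ^ k * p.2 ^ k) := fun p => by ring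
  simp only [e]
  exact ((integrable_radialIntensity hlam hG).mul_prod (integrable_markLaw hq hq0 hqk)).const_mul _

lemma ae_signal_nonneg (hP : 0 < P) (hG0 : ∀ t, 0 ≤ t → 0 ≤ G t) :
    ∀ᵐ p : ℝ × ℝ ∂(radialIntensity lam).prod (markLaw q), 0 ≤ P * p.2 * G p.1 := by
  filter_upwards [Measure.quasiMeasurePreserving_fst.ae (ae_radialIntensity_pos (lam := lam)),
    Measure.quasiMeasurePreserving_snd.ae (ae_markLaw_pos (q := q))] with p h1 h2
  exact mul_nonneg (mul_nonneg hP.le h2.le) (hG0 _ h1.le)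

lemma integral_one_sub_exp_signal (hlam : 0 < lam) (hP : 0 < P) (hG : Measurable G)
    (hG0 : ∀ t, 0 ≤ t → 0 ≤ G t) (hq : Measurable q) (hq0 : ∀ h, 0 ≤ q h)
    (h1 : Integrable (fun p : ℝ × ℝ => P * p.2 * G p.1) ((radialIntensity lam).prod (markLaw q)))
    {s : ℝ} (hs : 0 < s) :
    ∫ p : ℝ × ℝ, (1 - exp (-(s * (P * p.2 * G p.1)))) ∂(radialIntensity lam).prod (markLaw q) =
      lam * ∫ t in Set.Ioi (0 : ℝ), ∫ h in Set.Ioi (0 : ℝ),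
        (1 - exp (-(s * P * h * G t))) * q h * (2 * π * t) := by
  have hi : Integrable (fun p : ℝ × ℝ => 1 - exp (-(s * (P * p.2 * G p.1))))
      ((radialIntensity lam).prod (markLaw q)) := by
    refine (h1.const_mul s).mono' (Measurable.aestronglyMeasurable (by fun_prop)) ?_
    filter_upwards [ae_signal_nonneg hP hG0] with p hp
    have h2 : exp (-(s * (P * p.2 * G p.1))) ≤ 1 :=
      exp_le_one_iff.2 (by have := mul_nonneg hs.le hp; linarith)
    have h3 := add_one_le_exp (-(s * (P * p.2 * G p.1)))
    rw [norm_of_nonneg (by linarith)]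
    linarith
  rw [integral_prod _ hi, integral_radialIntensity hlam, mul_assoc, ← integral_const_mul]
  congr 1
  refine integral_congr_ae (Eventually.of_forall fun t => ?_)
  simp only
  rw [integral_markLaw hq hq0, integral_mul_const]
  simp only [← mul_assoc]
  ring

end MarkedPlane

end BerryEsseen

open BerryEsseen in
theorem gaussian_approximation_stationary
    {α lam P : ℝ} (hα : 2 < α) (hlam : 0 < lam) (hP : 0 < P)
    (G q : ℝ → ℝ)
    (hG_meas : Measurable G)
    (hG_nonneg : ∀ t, 0 ≤ t → 0 ≤ G t)
    (hG_bdd : ∃ C : ℝ, ∀ t, 0 ≤ t → G t ≤ C)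
    (hG_anti : AntitoneOn G (Set.Ici 0))
    (hG_tail : ∃ K > (0:ℝ), ∃ B > (0:ℝ), ∀ t ≥ B, G t ≤ K * t ^ (-α))
    (hq_meas : Measurable q) (hq_nonneg : ∀ h, 0 ≤ q h)
    (hq_prob : ∫ h in Set.Ioi (0:ℝ), q h = 1)
    (hq_m1 : IntegrableOn (fun h => h * q h) (Set.Ioi 0))
    (hq_m2 : IntegrableOn (fun h => h ^ 2 * q h) (Set.Ioi 0))
    (hq_m3 : IntegrableOn (fun h => h ^ 3 * q h) (Set.Ioi 0))
    {Ω : Type*} [MeasurableSpace Ω] (μ : Measure Ω) [IsProbabilityMeasure μ]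
    (I : Ω → ℝ) (hI_meas : Measurable I) (hI_nonneg : ∀ ω, 0 ≤ I ω)
    (hI_laplace : ∀ s : ℝ, 0 ≤ s →
      ∫ ω, Real.exp (-(s * I ω)) ∂μ =
        Real.exp (-(lam * ∫ t in Set.Ioi (0:ℝ), ∫ h in Set.Ioi (0:ℝ),
          (1 - Real.exp (-(s * P * h * G t))) * q h * (2 * Real.pi * t))))
    (hG2_pos : 0 < ∫ t in Set.Ioi (0:ℝ), G t ^ 2 * t) :
    ∀ x : ℝ,
      |(μ {ω | (I ω - ∫ ω', I ω' ∂μ) / Real.sqrt (variance I μ) ≤ x}).toReal -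
          (∫ t in Set.Iic (x), Real.exp (-t ^ 2 / 2)) / Real.sqrt (2 * Real.pi)| ≤
        ((1 / Real.sqrt (2 * Real.pi)) *
          ((∫ h in Set.Ioi (0:ℝ), h ^ 3 * q h) /
            (∫ h in Set.Ioi (0:ℝ), h ^ 2 * q h) ^ (3/2 : ℝ)) *
          ((∫ t in Set.Ioi (0:ℝ), G t ^ 3 * t) /
            (∫ t in Set.Ioi (0:ℝ), G t ^ 2 * t) ^ (3/2 : ℝ)) *
          min 0.4785 (31.935 / (1 + |x| ^ 3))) / Real.sqrt lam := by
  intro x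
  have hG1 := integrableOn_pathLoss hα hG_meas hG_nonneg hG_bdd hG_tail
  have hGk := integrableOn_pathLoss_pow hG_meas hG_nonneg hG_bdd hG1
  have hi1 := integrable_pow_signal (P := P) hlam hq_meas hq_nonneg (k := 1) (by simpa using hG1)
    (by simpa using hq_m1)
  have hi3 := integrable_pow_signal (P := P) hlam hq_meas hq_nonneg (hGk 2) hq_m3
  simp only [pow_one] at hi1
  have hM2 := integral_pow_signal (P := P) (G := G) hlam hq_meas hq_nonneg 2
  have hM3 := integral_pow_signal (P := P) (G := G) hlam hq_meas hq_nonneg 3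
  have hq2 := integral_sq_mul_density_pos hq_nonneg hq_prob hq_m2
  have key := abs_measure_standardized_le_sub_le hI_meas hI_nonneg (by fun_prop)
    (ae_signal_nonneg hP hG_nonneg) hi1 hi3 (by rw [hM2]; positivity)
    (fun s hs => by
      rw [hI_laplace s hs.le, integral_one_sub_exp_signal hlam hP hG_meas hG_nonneg hq_meas hq_nonneg hi1 hs]) x
  refine key.trans (le_of_eq ?_)
  rw [hM2, hM3, rpow_three_halves hq2.le, rpow_three_halves hG2_pos.le, rpow_three_halves (by positivity)]
  generalize (∫ t in Set.Ioi (0 : ℝ), G t ^ 2 * t) = A at *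
  generalize (∫ h in Set.Ioi (0 : ℝ), h ^ 2 * q h) = D at *
  generalize (∫ t in Set.Ioi (0 : ℝ), G t ^ 3 * t) = A3
  generalize (∫ h in Set.Ioi (0 : ℝ), h ^ 3 * q h) = D3
  generalize min (0.4785 : ℝ) (31.935 / (1 + |x| ^ 3)) = M
  have hpi : 0 < 2 * Real.pi := by positivity
  have hsqrt : √(P ^ 2 * (lam * (2 * Real.pi)) * A * D) = P * (√lam * √(2 * Real.pi)) * √A * √D := by
    rw [Real.sqrt_mul (by positivity), Real.sqrt_mul (by positivity), Real.sqrt_mul (by positivity),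
      Real.sqrt_sq hP.le, Real.sqrt_mul hlam.le]
  rw [hsqrt]
  have := Real.sqrt_pos.2 hlam
  have := Real.sqrt_pos.2 hpi
  have := Real.sqrt_pos.2 hG2_pos
  have := Real.sqrt_pos.2 hq2
  field_simp
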